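/- Let d ≥ 2 and p₀ > p_c(d). There exists a constant κ'_d > 0, depending only on the dimension d and on p₀, such that for all p ≤ q in [p₀, 1], d_H(𝓑_{μ_q}, 𝓑_{μ_p}) ≤ κ'_d (q − p) |log(q − p)|, where d_H denotes the Hausdorff distance between non-empty compact subsets of ℝ^d and 𝓑_{μ_p} is the closed unit ball of the norm μ_p. -/

import Mathlib

open MeasureTheory Filter Topology
open scoped ENNReal

namespace Perco

/-- Vertices of the hypercubic lattice `ℤ^d`. -/
abbrev V (d : ℕ) := Fin d → ℤ

/-- The `ℓ¹` distance on `ℤ^d`. -/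
def dist1 {d : ℕ} (x y : V d) : ℕ := ∑ i, (x i - y i).natAbs

/-- The `ℓ¹` norm, as a real number. -/
def norm1 {d : ℕ} (x : V d) : ℝ := (dist1 x 0 : ℝ)

/-- The `ℓ¹` distance, descended to unordered pairs. -/
def sym2dist1 {d : ℕ} : Sym2 (V d) → ℕ :=
  Sym2.lift ⟨fun x y => dist1 x y, fun x y => by
    unfold dist1
    exact Finset.sum_congr rfl fun i _ => by rw [← Int.natAbs_neg, neg_sub]⟩

/-- Edges of the lattice `(ℤ^d, 𝔼^d)`: unordered pairs of nearest neighbours. -/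
def Edge (d : ℕ) : Type := {e : Sym2 (V d) // sym2dist1 e = 1}

/-- A bond percolation configuration: every edge is open (`true`) or closed (`false`). -/
abbrev Config (d : ℕ) := Edge d → Bool

/-- The unordered pair `e` is an open edge of the configuration `ω`. -/
def openE {d : ℕ} (ω : Config d) (e : Sym2 (V d)) : Prop :=
  ∃ h : sym2dist1 e = 1, ω ⟨e, h⟩ = true

/-- `⟨x, y⟩` is an open edge of the configuration `ω`. -/
def edgeOpen {d : ℕ} (ω : Config d) (x y : V d) : Prop := openE ω s(x, y)

/-- `f 0, f 1, …, f n` is an `ω`-open path (with `n` edges). -/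
def IsOpenPath {d : ℕ} (ω : Config d) (n : ℕ) (f : ℕ → V d) : Prop :=
  ∀ i < n, edgeOpen ω (f i) (f (i + 1))

/-- `f 0, …, f n` is a (not necessarily open) lattice path of `ℤ^d`. -/
def IsLatticePath {d : ℕ} (n : ℕ) (f : ℕ → V d) : Prop :=
  ∀ i < n, dist1 (f i) (f (i + 1)) = 1

/-- The chemical distance between `x` and `y` in the configuration `ω`:
the minimal number of edges of an `ω`-open path from `x` to `y` (`⊤` if there is none). -/
noncomputable def chemDist {d : ℕ} (ω : Config d) (x y : V d) : ℝ≥0∞ :=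
  sInf {r : ℝ≥0∞ | ∃ (n : ℕ) (f : ℕ → V d),
    IsOpenPath ω n f ∧ f 0 = x ∧ f n = y ∧ r = (n : ℝ≥0∞)}

/-- `x` and `y` are connected by an `ω`-open path. -/
def Connected {d : ℕ} (ω : Config d) (x y : V d) : Prop := chemDist ω x y ≠ ⊤

/-- The open cluster of the vertex `x`. -/
def cluster {d : ℕ} (ω : Config d) (x : V d) : Set (V d) := {y | Connected ω x y}

/-- `x` lies in an infinite open cluster. -/
def InInfiniteCluster {d : ℕ} (ω : Config d) (x : V d) : Prop := (cluster ω x).Infinite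

open Classical in
/-- The regularized point `x̃`: a point of the infinite cluster minimizing the `ℓ¹`
distance to `x` (with a deterministic rule to break ties); `x` itself if there is none. -/
noncomputable def regPoint {d : ℕ} (ω : Config d) (x : V d) : V d :=
  if h : ∃ y : V d, InInfiniteCluster ω y ∧
      ∀ z : V d, InInfiniteCluster ω z → dist1 x y ≤ dist1 x z
  then h.choose else x

/-- Real-valued chemical distance (in the configuration `ωdist`) between the
regularizations (w.r.t. the configuration `ωreg`) of `x` and `y`. -/
noncomputable def DReg {d : ℕ} (ωdist ωreg : Config d) (x y : V d) : ℝ :=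
  (chemDist ωdist (regPoint ωreg x) (regPoint ωreg y)).toReal

open Classical in
/-- The number of elements of a set, as an element of `ℝ≥0∞` (`⊤` for infinite sets). -/
noncomputable def eSize {α : Type*} (A : Set α) : ℝ≥0∞ :=
  if h : A.Finite then (h.toFinset.card : ℝ≥0∞) else ⊤

/-!  ### Boxes and renormalization  -/

/-- The box of "radius" `R` centered at `c`: `∏ₖ [c k - R, c k + R)`. -/
def boxC {d : ℕ} (c : V d) (R : ℕ) : Set (V d) :=
  {x | ∀ k, c k - (R : ℤ) ≤ x k ∧ x k < c k + (R : ℤ)}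

/-- The center `i(2N+1)` of the `N`-box of macroscopic index `i`. -/
def center {d : ℕ} (N : ℕ) (i : V d) : V d := fun k => i k * (2 * (N : ℤ) + 1)

/-- The `N`-box `B_N(i) = i(2N+1) + [-N, N)^d`. -/
def macroBox {d : ℕ} (N : ℕ) (i : V d) : Set (V d) := boxC (center N i) N

/-- The enlarged box `B'_N(i) = i(2N+1) + [-3N, 3N)^d`. -/
def macroBox' {d : ℕ} (N : ℕ) (i : V d) : Set (V d) := boxC (center N i) (3 * N)

/-- An open path all of whose vertices stay in the set `S`. -/
def IsOpenPathIn {d : ℕ} (ω : Config d) (S : Set (V d)) (n : ℕ) (f : ℕ → V d) : Prop :=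
  IsOpenPath ω n f ∧ ∀ i ≤ n, f i ∈ S

/-- `x` and `y` are connected by an open path inside `S`. -/
def ConnectedIn {d : ℕ} (ω : Config d) (S : Set (V d)) (x y : V d) : Prop :=
  ∃ (n : ℕ) (f : ℕ → V d), IsOpenPathIn ω S n f ∧ f 0 = x ∧ f n = y

/-- The open cluster of `x` inside the set `S`. -/
def clusterIn {d : ℕ} (ω : Config d) (S : Set (V d)) (x : V d) : Set (V d) :=
  {y | ConnectedIn ω S x y}

/-- `C` is an open cluster of the region `S`. -/
def IsClusterIn {d : ℕ} (ω : Config d) (S : Set (V d)) (C : Set (V d)) : Prop :=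
  ∃ x ∈ S, C = clusterIn ω S x

/-- The cluster `C` has diameter at least `m`. -/
def diamGE {d : ℕ} (C : Set (V d)) (m : ℕ) : Prop :=
  ∃ x ∈ C, ∃ y ∈ C, ∃ k, (m : ℤ) ≤ |x k - y k|

/-- The cluster `C` is crossing for the box `boxC c R`: for each of the `d` directions,
`C ∩ boxC c R` contains an open path connecting the two opposite faces of the box. -/
def CrossingFor {d : ℕ} (ω : Config d) (C : Set (V d)) (c : V d) (R : ℕ) : Prop :=
  ∀ k : Fin d, ∃ (n : ℕ) (f : ℕ → V d), IsOpenPath ω n f ∧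
    (∀ m ≤ n, f m ∈ C ∩ boxC c R) ∧ f 0 k = c k - (R : ℤ) ∧ f n k = c k + (R : ℤ) - 1

/-- The `N`-box `B_N(i)` is good (for the configuration `ω`, with parameter `β`):
(i) there is a unique open cluster `C` of `B'_N(i)` of diameter at least `N`;
(ii) `C` is crossing for each of the `3^d` `N`-boxes included in `B'_N(i)`;
(iii) any two points of `C ∩ B'_N(i)` are at chemical distance at most `12βN`. -/
def IsGoodBox {d : ℕ} (ω : Config d) (N : ℕ) (β : ℝ) (i : V d) : Prop :=
  ∃ C : Set (V d),
    IsClusterIn ω (macroBox' N i) C ∧ diamGE C N ∧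
    (∀ C', IsClusterIn ω (macroBox' N i) C' → diamGE C' N → C' = C) ∧
    (∀ j : V d, (∀ k, |j k - i k| ≤ 1) → CrossingFor ω C (center N j) N) ∧
    (∀ x ∈ macroBox' N i, ∀ y ∈ macroBox' N i, x ∈ C → y ∈ C →
      chemDist ω x y ≤ ENNReal.ofReal (12 * β * N))

/-- `x` belongs to the crossing cluster of the good box `B_N(j)`, i.e. to a cluster of
`B'_N(j)` of diameter at least `N`. -/
def InCrossingCluster {d : ℕ} (ω : Config d) (N : ℕ) (j : V d) (x : V d) : Prop :=
  ∃ C : Set (V d), IsClusterIn ω (macroBox' N j) C ∧ diamGE C N ∧ x ∈ C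

/-!  ### Macroscopic site percolation -/

/-- A nearest-neighbour path of macroscopic sites staying in `S`. -/
def IsSitePathIn {d : ℕ} (S : Set (V d)) (n : ℕ) (f : ℕ → V d) : Prop :=
  (∀ m ≤ n, f m ∈ S) ∧ ∀ m < n, dist1 (f m) (f (m + 1)) = 1

/-- The sites `i` and `j` are connected by a nearest-neighbour path inside `S`. -/
def SiteConnectedIn {d : ℕ} (S : Set (V d)) (i j : V d) : Prop :=
  ∃ (n : ℕ) (f : ℕ → V d), IsSitePathIn S n f ∧ f 0 = i ∧ f n = j

/-- A `*`-path of macroscopic sites staying in `S` (consecutive sites are `*`-neighbours: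
their `ℓ^∞` distance is `1`). -/
def IsStarPathIn {d : ℕ} (S : Set (V d)) (n : ℕ) (f : ℕ → V d) : Prop :=
  (∀ m ≤ n, f m ∈ S) ∧ ∀ m < n, f m ≠ f (m + 1) ∧ ∀ k, |f (m + 1) k - f m k| ≤ 1

/-- The set of good macroscopic sites. -/
def goodSites {d : ℕ} (ω : Config d) (N : ℕ) (β : ℝ) : Set (V d) :=
  {i | IsGoodBox ω N β i}

/-- The macroscopic site `i` belongs to an infinite cluster of good boxes. -/
def InInfiniteGoodCluster {d : ℕ} (ω : Config d) (N : ℕ) (β : ℝ) (i : V d) : Prop :=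
  IsGoodBox ω N β i ∧ {j | SiteConnectedIn (goodSites ω N β) i j}.Infinite

/-- The union of the bad connected components (of the macroscopic site percolation)
meeting the set `Γ`; its size is `Σ_{C ∈ Bad, C ∩ Γ ≠ ∅} |C|`. -/
def badTouching {d : ℕ} (ω : Config d) (N : ℕ) (β : ℝ) (Γ : Set (V d)) : Set (V d) :=
  {j | ∃ i ∈ Γ, i ∉ goodSites ω N β ∧ SiteConnectedIn {k | k ∉ goodSites ω N β} i j}

/-!  ### Edges and sites of a path -/

/-- The set of edges of the path `f 0, …, f n`. -/
def pathEdges {d : ℕ} (n : ℕ) (f : ℕ → V d) : Set (Sym2 (V d)) :=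
  {e | ∃ i < n, e = s(f i, f (i + 1))}

/-- The set of vertices of the path `f 0, …, f n`. -/
def pathVerts {d : ℕ} (n : ℕ) (f : ℕ → V d) : Set (V d) :=
  {v | ∃ i ≤ n, f i = v}

/-- The set of `ω`-closed edges of the path `f 0, …, f n`. -/
def closedEdges {d : ℕ} (ω : Config d) (n : ℕ) (f : ℕ → V d) : Set (Sym2 (V d)) :=
  {e | e ∈ pathEdges n f ∧ ¬ openE ω e}

/-- The set `Γ` of macroscopic sites whose `N`-box is visited by the path `f 0, …, f n`. -/
def visitedSites {d : ℕ} (N : ℕ) (n : ℕ) (f : ℕ → V d) : Set (V d) :=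
  {i | ∃ m ≤ n, f m ∈ macroBox N i}

/-!  ### Probability: i.i.d. Bernoulli bond percolation -/

/-- A family of i.i.d. Bernoulli bond percolation measures on the configurations:
`P p` is a probability measure under which the states of the edges are independent
Bernoulli variables of parameter `p`. -/
structure BernoulliFamily (d : ℕ) where
  P : ℝ → Measure (Config d)
  prob : ∀ p, IsProbabilityMeasure (P p)
  iid : ∀ p, 0 ≤ p → p ≤ 1 → ∀ (s : Finset (Edge d)) (f : Edge d → Bool),
    P p {ω : Config d | ∀ e ∈ s, ω e = f e}
      = ∏ e ∈ s, ENNReal.ofReal (if f e then p else 1 - p)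

/-- The critical parameter `p_c(d)` of the family. -/
noncomputable def pc {d : ℕ} (F : BernoulliFamily d) : ℝ :=
  sInf {p : ℝ | 0 ≤ p ∧ p ≤ 1 ∧ 0 < F.P p {ω : Config d | InInfiniteCluster ω 0}}

/-- `t` is the time constant of the percolation measure `P`: for every `x ∈ ℤ^d`,
`D^{𝒞}(0̃, ñx)/n → t x` almost surely. -/
def ASTimeConstant {d : ℕ} (P : Measure (Config d)) (t : V d → ℝ) : Prop :=
  ∀ x : V d, ∀ᵐ ω ∂P, Tendsto (fun n : ℕ => DReg ω ω 0 (n • x) / n) atTop (𝓝 (t x))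

/-!  ### Couplings -/

/-- Two-stage coupling configurations: each edge carries a pair `(V, Z)` of Booleans. -/
abbrev CConfig (d : ℕ) := Edge d → Bool × Bool

/-- The `q`-configuration of a coupled configuration: `e` is `q`-open iff `V e = 1`. -/
def cfgQ {d : ℕ} (u : CConfig d) : Config d := fun e => (u e).1

/-- The `p`-configuration of a coupled configuration: `e` is `p`-open iff `V e Z e = 1`. -/
def cfgP {d : ℕ} (u : CConfig d) : Config d := fun e => (u e).1 && (u e).2

/-- Two-stage coupling of the `p`- and `q`-percolations: on each edge, independently,
`V` is Bernoulli of parameter `q` and `Z` is an independent Bernoulli of parameter `p/q`. -/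
structure CouplingMeasure (d : ℕ) (p q : ℝ) where
  Q : Measure (CConfig d)
  prob : IsProbabilityMeasure Q
  iid : ∀ (s : Finset (Edge d)) (f : Edge d → Bool × Bool),
    Q {u : CConfig d | ∀ e ∈ s, u e = f e}
      = ∏ e ∈ s,
          (ENNReal.ofReal (if (f e).1 then q else 1 - q) *
            ENNReal.ofReal (if (f e).2 then p / q else 1 - p / q))

/-- Standard coupling: i.i.d. uniform variables on `[0,1]`, one for each edge. -/
structure UniformCoupling (d : ℕ) where
  Q : Measure (Edge d → ℝ)
  prob : IsProbabilityMeasure Q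
  iid : ∀ (s : Finset (Edge d)) (a : Edge d → ℝ), (∀ e ∈ s, 0 ≤ a e ∧ a e ≤ 1) →
    Q {u | ∀ e ∈ s, u e ≤ a e} = ∏ e ∈ s, ENNReal.ofReal (a e)

open Classical in
/-- The `p`-configuration of the standard coupling: `e` is `p`-open iff `U e ≤ p`. -/
noncomputable def cfgAt {d : ℕ} (u : Edge d → ℝ) (p : ℝ) : Config d :=
  fun e => if u e ≤ p then true else false

/-- The critical parameter `p_c(d)` read on the standard coupling. -/
noncomputable def pcU {d : ℕ} (U : UniformCoupling d) : ℝ :=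
  sInf {p : ℝ | 0 ≤ p ∧ p ≤ 1 ∧ 0 < U.Q {u | InInfiniteCluster (cfgAt u p) 0}}

open Classical in
/-- A deterministically chosen geodesic (open path of minimal length) from `x` to `y`
in the configuration `ω` (a trivial constant path if there is none). -/
noncomputable def geod {d : ℕ} (ω : Config d) (x y : V d) : ℕ × (ℕ → V d) :=
  if h : ∃ nf : ℕ × (ℕ → V d), IsOpenPath ω nf.1 nf.2 ∧ nf.2 0 = x ∧ nf.2 nf.1 = y ∧
      (nf.1 : ℝ≥0∞) = chemDist ω x y
  then h.choose else (0, fun _ => x)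

/-!  ### Norms on `ℝ^d` -/

/-- `f` is a norm on the Euclidean space `ℝ^d`. -/
def IsNorm {d : ℕ} (f : EuclideanSpace ℝ (Fin d) → ℝ) : Prop :=
  (∀ x, 0 ≤ f x) ∧ (∀ x, f x = 0 ↔ x = 0) ∧
  (∀ (c : ℝ) (x), f (c • x) = |c| * f x) ∧ ∀ x y, f (x + y) ≤ f x + f y

/-- The canonical embedding of `ℤ^d` into the Euclidean space `ℝ^d`. -/
noncomputable def toEuc {d : ℕ} (x : V d) : EuclideanSpace ℝ (Fin d) :=
  (WithLp.equiv 2 (Fin d → ℝ)).symm fun i => (x i : ℝ)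

/-- Property (1) of the path-modification lemma: the edges of `γ' \ γ` decompose as a
disjoint union of self-avoiding `p`-open paths intersecting `γ' ∩ γ` at their endpoints. -/
def DisjointPathDecomposition {d : ℕ} (ωp : Config d) (n : ℕ) (f : ℕ → V d)
    (n' : ℕ) (g : ℕ → V d) : Prop :=
  ∃ (K : ℕ) (m : ℕ → ℕ) (h : ℕ → ℕ → V d),
    (⋃ j ∈ Finset.range K, pathEdges (m j) (h j)) = pathEdges n' g \ pathEdges n f ∧
    (∀ j < K, IsOpenPath ωp (m j) (h j)) ∧
    (∀ j < K, ∀ a ≤ m j, ∀ b ≤ m j, h j a = h j b → a = b) ∧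
    (∀ j < K, ∀ l < K, j ≠ l → Disjoint (pathEdges (m j) (h j)) (pathEdges (m l) (h l))) ∧
    (∀ j < K, h j 0 ∈ pathVerts n f ∧ h j (m j) ∈ pathVerts n f) ∧
    (∀ j < K, ∀ a, 0 < a → a < m j → h j a ∉ pathVerts n f)

/-- The conclusion of the path-modification lemma, for the constant `ρ`:
any `q`-open path between well-connected points of `𝒞_p` can be turned into a `p`-open
path, the total length of the bypasses being controlled by the bad clusters met and the
number of `p`-closed edges. -/
def BypassProperty (d : ℕ) (ρ : ℕ) : Prop :=
  ∀ (N : ℕ), 1 ≤ N → ∀ (β : ℝ), 1 ≤ β → ∀ (ωp ωq : Config d),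
    (∀ e, ωp e = true → ωq e = true) →
    ∀ y z : V d, InInfiniteCluster ωp y → InInfiniteCluster ωp z →
    (∃ i, y ∈ macroBox N i ∧ InInfiniteGoodCluster ωp N β i) →
    (∃ i, z ∈ macroBox N i ∧ InInfiniteGoodCluster ωp N β i) →
    ∀ (n : ℕ) (f : ℕ → V d), IsOpenPath ωq n f → f 0 = y → f n = z →
    ∃ (n' : ℕ) (g : ℕ → V d), IsOpenPath ωp n' g ∧ g 0 = y ∧ g n' = z ∧
      DisjointPathDecomposition ωp n f n' g ∧
      eSize (pathEdges n' g \ pathEdges n f) ≤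
        ((ρ * N : ℕ) : ℝ≥0∞) *
          (eSize (badTouching ωp N β (visitedSites N n f)) + eSize (closedEdges ωp n f))

section
variable {d : ℕ}

/-- Closed sup-norm cube. -/
def cb (c : V d) (r : ℤ) : Set (V d) := {x | ∀ k, |x k - c k| ≤ r}

/-- the same as a finset -/
noncomputable def cbF (c : V d) (r : ℤ) : Finset (V d) :=
  Finset.Icc (fun k => c k - r) (fun k => c k + r)

lemma mem_cb {c : V d} {r : ℤ} {x : V d} : x ∈ cb c r ↔ ∀ k, |x k - c k| ≤ r := Iff.rfl

lemma mem_cbF {c : V d} {r : ℤ} {x : V d} : x ∈ cbF c r ↔ x ∈ cb c r := by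
  simp only [cbF, Finset.mem_Icc, mem_cb, Pi.le_def, abs_le]
  constructor
  · rintro ⟨h1, h2⟩ k
    have := h1 k; have := h2 k; constructor <;> linarith
  · intro h
    exact ⟨fun k => by have := (h k).1; linarith, fun k => by have := (h k).2; linarith⟩

lemma card_cbF (c : V d) (r : ℕ) : (cbF c (r : ℤ)).card = (2 * r + 1) ^ d := by
  rw [cbF, Pi.card_Icc]
  have : ∀ i : Fin d, (Finset.Icc (c i - (r:ℤ)) (c i + r)).card = 2 * r + 1 := by
    intro i; rw [Int.card_Icc]; omega
  simp [this]

lemma cb_finite (c : V d) (r : ℤ) : (cb c r).Finite := by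
  have : cb c r = ↑(cbF c r) := by ext; simp [mem_cbF]
  rw [this]; exact Finset.finite_toSet _

lemma cb_trans {x y z : V d} {r s : ℤ} (h1 : x ∈ cb y r) (h2 : y ∈ cb z s) : x ∈ cb z (r + s) := by
  intro k
  have := abs_le.1 (h1 k); have := abs_le.1 (h2 k); rw [abs_le]; constructor <;> linarith

lemma cb_symm {x y : V d} {r : ℤ} (h : x ∈ cb y r) : y ∈ cb x r := by
  intro k; rw [abs_sub_comm]; exact h k

lemma cb_mono {x y : V d} {r s : ℤ} (h : x ∈ cb y r) (hrs : r ≤ s) : x ∈ cb y s :=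
  fun k => (h k).trans hrs

lemma cb_self {x : V d} {r : ℤ} (hr : 0 ≤ r) : x ∈ cb x r := by
  intro k; simpa using hr

lemma dist1_comm (x y : V d) : dist1 x y = dist1 y x := by
  unfold dist1
  exact Finset.sum_congr rfl fun i _ => by rw [← Int.natAbs_neg, neg_sub]

lemma dist1_triangle (x y z : V d) : dist1 x z ≤ dist1 x y + dist1 y z := by
  unfold dist1
  rw [← Finset.sum_add_distrib]
  exact Finset.sum_le_sum fun i _ => by omega

lemma cb_of_dist1 {x y : V d} {n : ℕ} (h : dist1 x y ≤ n) : x ∈ cb y n := by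
  intro k
  have h2 : (x k - y k).natAbs ≤ dist1 x y :=
    Finset.single_le_sum (f := fun i => (x i - y i).natAbs) (fun i _ => Nat.zero_le _)
      (Finset.mem_univ k)
  have : |x k - y k| = ((x k - y k).natAbs : ℤ) := by simp
  rw [this]; exact_mod_cast h2.trans h

lemma dist1_of_cb {x y : V d} {n : ℕ} (h : x ∈ cb y n) : dist1 x y ≤ d * n := by
  unfold dist1
  calc _ ≤ ∑ _i : Fin d, n := Finset.sum_le_sum fun i _ => by
        have := h i; rw [abs_le] at this; omega
    _ = _ := by simp

lemma dist1_add (x y z : V d) : dist1 (x + z) (y + z) = dist1 x y := by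
  unfold dist1; simp

lemma edgeOpen_symm {ω : Config d} {x y : V d} (h : edgeOpen ω x y) : edgeOpen ω y x := by
  unfold edgeOpen at *; rwa [Sym2.eq_swap]

lemma edgeOpen_dist1 {ω : Config d} {x y : V d} (h : edgeOpen ω x y) : dist1 x y = 1 := h.1

lemma edgeOpen_cb {ω : Config d} {x y : V d} (h : edgeOpen ω x y) : y ∈ cb x 1 := by
  have := cb_of_dist1 (x := x) (y := y) (n := 1) (by rw [edgeOpen_dist1 h])
  exact cb_symm this

/-- one open step inside `S` -/
def stp (ω : Config d) (S : Set (V d)) (x y : V d) : Prop := edgeOpen ω x y ∧ x ∈ S ∧ y ∈ S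

/-- connection by an open path inside `S` (or equality) -/
def Conn (ω : Config d) (S : Set (V d)) (x y : V d) : Prop := Relation.ReflTransGen (stp ω S) x y

lemma stp_symm {ω : Config d} {S : Set (V d)} : Std.Symm (stp ω S) :=
  ⟨fun _ _ h => ⟨edgeOpen_symm h.1, h.2.2, h.2.1⟩⟩

lemma Conn.refl {ω : Config d} {S : Set (V d)} (x : V d) : Conn ω S x x := Relation.ReflTransGen.refl

lemma Conn.symm {ω : Config d} {S : Set (V d)} {x y : V d} (h : Conn ω S x y) : Conn ω S y x := by
  induction h with
  | refl => exact Conn.refl _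
  | tail _ h ih => exact Relation.ReflTransGen.head (stp_symm.symm _ _ h) ih

lemma Conn.trans {ω : Config d} {S : Set (V d)} {x y z : V d} (h : Conn ω S x y)
    (h' : Conn ω S y z) : Conn ω S x z := Relation.ReflTransGen.trans h h'

lemma Conn.mono {ω ω' : Config d} {S S' : Set (V d)} {x y : V d} (h : Conn ω S x y)
    (hω : ω ≤ ω') (hS : S ⊆ S') : Conn ω' S' x y := by
  refine Relation.ReflTransGen.mono (r := stp ω S) (fun a b hab => ⟨?_, hS hab.2.1, hS hab.2.2⟩) _ _ h
  obtain ⟨h1, h2⟩ := hab.1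
  exact ⟨h1, by have := hω ⟨_, h1⟩; rw [h2] at this; exact top_le_iff.1 this⟩

/-- edges with both ends in `S` -/
def EdgesIn (S : Set (V d)) : Set (Edge d) := {e | ∀ v ∈ e.1, v ∈ S}

lemma EdgesIn_mono {S T : Set (V d)} (h : S ⊆ T) : EdgesIn S ⊆ EdgesIn T := fun _ he v hv => h (he v hv)

lemma EdgesIn_finite {S : Set (V d)} (hS : S.Finite) : (EdgesIn S).Finite := by
  classical
  have h1 : {e : Sym2 (V d) | ∀ v ∈ e, v ∈ S}.Finite := by
    refine (hS.toFinset.sym2).finite_toSet.subset fun e he => ?_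
    simp only [Finset.mem_coe, Finset.mem_sym2_iff, Set.Finite.mem_toFinset]
    exact he
  exact h1.preimage (Subtype.val_injective.injOn)

lemma Conn.congr_le {ω ω' : Config d} {S : Set (V d)} {x y : V d} (h : Conn ω S x y)
    (hω : ∀ e ∈ EdgesIn S, ω e ≤ ω' e) : Conn ω' S x y := by
  refine Relation.ReflTransGen.mono (r := stp ω S) (fun a b hab => ⟨?_, hab.2.1, hab.2.2⟩) _ _ h
  obtain ⟨h1, h2⟩ := hab.1
  refine ⟨h1, ?_⟩
  have := hω ⟨_, h1⟩ (by
    intro v hv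
    rcases Sym2.mem_iff.1 hv with rfl | rfl
    exacts [hab.2.1, hab.2.2])
  rw [h2] at this; exact top_le_iff.1 this

lemma Conn.mem_of_ne {ω : Config d} {S : Set (V d)} {x y : V d} (h : Conn ω S x y) (hx : x ∈ S) :
    y ∈ S := by
  induction h with
  | refl => exact hx
  | tail _ h _ => exact h.2.2

lemma conn_of_path {ω : Config d} {S : Set (V d)} {n : ℕ} {f : ℕ → V d}
    (h : IsOpenPath ω n f) (hS : ∀ i ≤ n, f i ∈ S) : Conn ω S (f 0) (f n) := by
  induction n with
  | zero => exact Conn.refl _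
  | succ n ih =>
    exact (ih (fun i hi => h i (by omega)) (fun i hi => hS i (by omega))).tail
      ⟨h n (by omega), hS n (by omega), hS _ le_rfl⟩

lemma path_of_conn {ω : Config d} {S : Set (V d)} {x y : V d} (h : Conn ω S x y) (hx : x ∈ S) :
    ∃ n f, IsOpenPath ω n f ∧ f 0 = x ∧ f n = y ∧ ∀ i ≤ n, f i ∈ S := by
  induction h with
  | refl => exact ⟨0, fun _ => x, fun i hi => by omega, rfl, rfl, fun _ _ => hx⟩
  | @tail b c _ hbc ih =>
    obtain ⟨n, f, h1, h2, h3, h4⟩ := ih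
    refine ⟨n + 1, fun i => if i ≤ n then f i else c, ?_, by simpa using h2, by simp, ?_⟩
    · intro i hi
      rcases Nat.lt_or_ge i n with h | h
      · simpa [h.le, Nat.succ_le_of_lt h] using h1 i h
      · obtain rfl : i = n := by omega
        simpa [h3] using hbc.1
    · intro i _
      dsimp only
      split_ifs with h
      · exact h4 i h
      · exact hbc.2.2

lemma chemDist_le_path {ω : Config d} {n : ℕ} {f : ℕ → V d} (h : IsOpenPath ω n f) :
    chemDist ω (f 0) (f n) ≤ n := sInf_le ⟨n, f, h, rfl, rfl, rfl⟩

lemma exists_path {ω : Config d} {x y : V d} (h : chemDist ω x y ≠ ⊤) :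
    ∃ n f, IsOpenPath ω n f ∧ f 0 = x ∧ f n = y ∧ chemDist ω x y = n := by
  classical
  have hne : ∃ n : ℕ, ∃ f, IsOpenPath ω n f ∧ f 0 = x ∧ f n = y := by
    by_contra hcon
    apply h
    unfold chemDist
    rw [sInf_eq_top]
    rintro r ⟨n, f, h1, h2, h3, -⟩
    exact absurd ⟨n, f, h1, h2, h3⟩ hcon
  obtain ⟨f, h1, h2, h3⟩ := Nat.find_spec hne
  refine ⟨Nat.find hne, f, h1, h2, h3, le_antisymm ?_ ?_⟩
  · conv_lhs => rw [← h2, ← h3]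
    exact chemDist_le_path h1
  · refine le_sInf ?_
    rintro r ⟨n, f, h1, h2, h3, rfl⟩
    exact_mod_cast Nat.find_min' hne ⟨f, h1, h2, h3⟩

lemma connected_iff {ω : Config d} {x y : V d} : Connected ω x y ↔ Conn ω Set.univ x y := by
  constructor
  · intro h
    obtain ⟨n, f, h1, rfl, rfl, -⟩ := exists_path h
    exact conn_of_path h1 (fun _ _ => trivial)
  · intro h
    obtain ⟨n, f, h1, rfl, rfl, -⟩ := path_of_conn h trivial
    exact ne_top_of_le_ne_top (ENNReal.natCast_ne_top n) (chemDist_le_path h1)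

lemma Conn.connected {ω : Config d} {S : Set (V d)} {x y : V d} (h : Conn ω S x y) :
    Connected ω x y := connected_iff.2 (h.mono le_rfl (Set.subset_univ _))

lemma Connected.symm' {ω : Config d} {x y : V d} (h : Connected ω x y) : Connected ω y x :=
  connected_iff.2 (connected_iff.1 h).symm

lemma Connected.trans' {ω : Config d} {x y z : V d} (h : Connected ω x y) (h' : Connected ω y z) :
    Connected ω x z := connected_iff.2 ((connected_iff.1 h).trans (connected_iff.1 h'))

lemma chemDist_self (ω : Config d) (x : V d) : chemDist ω x x = 0 := by
  have := chemDist_le_path (ω := ω) (n := 0) (f := fun _ => x) (fun i hi => by omega)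
  simpa using this

lemma chemDist_comm_le (ω : Config d) (x y : V d) : chemDist ω x y ≤ chemDist ω y x := by
  by_cases h : chemDist ω y x = ⊤
  · rw [h]; exact le_top
  obtain ⟨n, f, h1, h2, h3, h4⟩ := exists_path h
  rw [h4]
  have := chemDist_le_path (ω := ω) (n := n) (f := fun i => f (n - i)) (by
    intro i hi
    have := edgeOpen_symm (h1 (n - i - 1) (by omega))
    rwa [show n - i - 1 + 1 = n - i by omega, show n - i - 1 = n - (i + 1) by omega] at this)
  simpa [h2, h3] using this

lemma chemDist_comm (ω : Config d) (x y : V d) : chemDist ω x y = chemDist ω y x :=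
  le_antisymm (chemDist_comm_le _ _ _) (chemDist_comm_le _ _ _)

lemma chemDist_triangle (ω : Config d) (x y z : V d) :
    chemDist ω x z ≤ chemDist ω x y + chemDist ω y z := by
  by_cases h : chemDist ω x y = ⊤
  · rw [h]; simp
  by_cases h' : chemDist ω y z = ⊤
  · rw [h']; simp
  obtain ⟨n, f, h1, h2, h3, h4⟩ := exists_path h
  obtain ⟨m, g, g1, g2, g3, g4⟩ := exists_path h'
  rw [h4, g4]
  have := chemDist_le_path (ω := ω) (n := n + m) (f := fun i => if i ≤ n then f i else g (i - n)) (by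
    intro i hi
    dsimp only
    rcases Nat.lt_or_ge i n with h | h
    · simpa [h.le, Nat.succ_le_of_lt h] using h1 i h
    · have key : (if i ≤ n then f i else g (i - n)) = g (i - n) := by
        split_ifs with hh
        · obtain rfl : i = n := by omega
          simp [h3, g2]
        · rfl
      rw [key, if_neg (by omega), show i + 1 - n = i - n + 1 by omega]
      exact g1 _ (by omega))
  have e : (if n + m ≤ n then f (n + m) else g (n + m - n)) = z := by
    split_ifs with hh
    · obtain rfl : m = 0 := by omega
      simp only [add_zero, h3, ← g2, g3]
    · simpa using g3
  rw [e] at this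
  simpa [h2] using this

lemma chemDist_mono {ω ω' : Config d} (hω : ω ≤ ω') (x y : V d) :
    chemDist ω' x y ≤ chemDist ω x y := by
  by_cases h : chemDist ω x y = ⊤
  · rw [h]; exact le_top
  obtain ⟨n, f, h1, rfl, rfl, h4⟩ := exists_path h
  rw [h4]
  refine chemDist_le_path fun i hi => ?_
  obtain ⟨h1, h2⟩ := h1 i hi
  exact ⟨h1, by have := hω ⟨_, h1⟩; rw [h2] at this; exact top_le_iff.1 this⟩

lemma chemDist_le_card {ω : Config d} {S : Finset (V d)} {x y : V d} (h : Conn ω S x y)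
    (hx : x ∈ S) : chemDist ω x y ≤ S.card := by
  classical
  let G : SimpleGraph (V d) := SimpleGraph.fromRel (stp ω S)
  have hadj : ∀ a b, G.Adj a b → stp ω S a b := by
    intro a b hab
    rcases (SimpleGraph.fromRel_adj _ _ _).1 hab with ⟨_, h | h⟩
    · exact h
    · exact stp_symm.symm _ _ h
  have hr : G.Reachable x y := by
    induction h with
    | refl => exact SimpleGraph.Reachable.refl _
    | @tail b c _ hbc ih =>
      by_cases e : b = c
      · exact e ▸ ih
      · exact ih.trans (SimpleGraph.Adj.reachable ((SimpleGraph.fromRel_adj _ _ _).2 ⟨e, Or.inl hbc⟩))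
  obtain ⟨p, hp⟩ := hr.exists_isPath
  have hsup : ∀ (a b : V d) (p : G.Walk a b), a ∈ S → ∀ v ∈ p.support, v ∈ S := by
    intro a b p
    induction p with
    | nil => intro ha v hv; simp at hv; exact hv ▸ ha
    | cons hh p ih =>
      intro ha v hv
      rw [SimpleGraph.Walk.support_cons, List.mem_cons] at hv
      rcases hv with rfl | hv
      · exact ha
      · exact ih (hadj _ _ hh).2.2 v hv
  have hlen : p.length ≤ S.card := by
    have h1 : p.support.toFinset ⊆ S := fun v hv => hsup _ _ p hx v (List.mem_toFinset.1 hv)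
    have h2 := Finset.card_le_card h1
    rw [List.toFinset_card_of_nodup hp.support_nodup, SimpleGraph.Walk.length_support] at h2
    omega
  have := chemDist_le_path (ω := ω) (n := p.length) (f := p.getVert) (fun i hi =>
    (hadj _ _ (p.adj_getVert_succ hi)).1)
  rw [SimpleGraph.Walk.getVert_zero, SimpleGraph.Walk.getVert_length] at this
  exact this.trans (by exact_mod_cast hlen)

lemma path_cb {ω : Config d} {n : ℕ} {f : ℕ → V d} (h : IsOpenPath ω n f) {i : ℕ} (hi : i ≤ n) :
    f i ∈ cb (f 0) i := by
  induction i with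
  | zero => exact cb_self (by simp)
  | succ i ih =>
    have := cb_trans (edgeOpen_cb (h i (by omega))) (ih (by omega))
    push_cast; rw [add_comm]; exact this

lemma conn_cb_of_chemDist {ω : Config d} {x y : V d} {n : ℕ} (h : chemDist ω x y ≤ n) :
    Conn ω (cb x n) x y := by
  obtain ⟨m, f, h1, rfl, rfl, h4⟩ := exists_path (ne_top_of_le_ne_top (ENNReal.natCast_ne_top n) h)
  rw [h4] at h
  have h : m ≤ n := by exact_mod_cast h
  exact conn_of_path h1 (fun i hi => cb_mono (path_cb h1 hi) (by exact_mod_cast hi.trans h))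

lemma connected_iff_cb {ω : Config d} {x y : V d} :
    Connected ω x y ↔ ∃ n : ℕ, Conn ω (cb x n) x y := by
  constructor
  · intro h
    obtain ⟨n, _, _, _, _, h⟩ := exists_path h
    exact ⟨n, conn_cb_of_chemDist h.le⟩
  · rintro ⟨n, h⟩; exact h.connected

/-- `x` is connected to sup-distance `> r` -/
lemma inf_iff {ω : Config d} {x : V d} :
    InInfiniteCluster ω x ↔ ∀ r : ℕ, ∃ y, Connected ω x y ∧ y ∉ cb x r := by
  constructor
  · intro h r
    by_contra hc
    push Not at hc
    exact h ((cb_finite x r).subset fun y hy => hc y hy)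
  · intro h hfin
    obtain ⟨B, hB⟩ : ∃ B : ℕ, ∀ y ∈ cluster ω x, dist1 y x ≤ B := by
      obtain ⟨B, hB⟩ := (hfin.image (fun y => dist1 y x)).bddAbove
      exact ⟨B, fun y hy => hB ⟨y, hy, rfl⟩⟩
    obtain ⟨y, h1, h2⟩ := h B
    exact h2 (cb_of_dist1 (hB y h1))

lemma inf_of_connected {ω : Config d} {x y : V d} (h : Connected ω x y)
    (hx : InInfiniteCluster ω x) : InInfiniteCluster ω y :=
  Set.Infinite.mono (fun _ hz => h.symm'.trans' hz) hx

lemma Connected.mono' {ω ω' : Config d} (hω : ω ≤ ω') {x y : V d} (h : Connected ω x y) :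
    Connected ω' x y := connected_iff.2 ((connected_iff.1 h).mono hω le_rfl)

lemma inf_mono {ω ω' : Config d} (hω : ω ≤ ω') {x : V d} (h : InInfiniteCluster ω x) :
    InInfiniteCluster ω' x := Set.Infinite.mono (fun _ hz => Connected.mono' hω hz) h

end

section
variable {d : ℕ}

/-- Bernoulli law on `Bool`. -/
noncomputable def bern (r : unitInterval) : Measure Bool :=
  ENNReal.ofReal (r : ℝ) • Measure.dirac true + ENNReal.ofReal (1 - (r : ℝ)) • Measure.dirac false

lemma bern_true (r : unitInterval) : bern r {true} = ENNReal.ofReal (r : ℝ) := by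
  simp [bern]

lemma bern_false (r : unitInterval) : bern r {false} = ENNReal.ofReal (1 - (r : ℝ)) := by
  simp [bern]

instance (r : unitInterval) : IsProbabilityMeasure (bern r) := ⟨by
  simp only [bern, Measure.coe_add, Measure.coe_smul, Pi.add_apply, Pi.smul_apply, measure_univ,
    smul_eq_mul, mul_one]
  rw [← ENNReal.ofReal_add r.2.1 (by linarith [r.2.2])]
  simp⟩

variable {ι : Type*}

/-- product Bernoulli measure -/
noncomputable def PM (r : ι → unitInterval) : Measure (ι → Bool) :=
  Measure.infinitePi (fun i => bern (r i))

instance (r : ι → unitInterval) : IsProbabilityMeasure (PM r) := by unfold PM; infer_instance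

/-- the event `A` depends only on the coordinates in `s` -/
def Loc (s : Set ι) (A : Set (ι → Bool)) : Prop := ∀ x y, (∀ i ∈ s, x i = y i) → x ∈ A → y ∈ A

lemma Loc.iff {s : Set ι} {A : Set (ι → Bool)} (h : Loc s A) {x y : ι → Bool}
    (hxy : ∀ i ∈ s, x i = y i) : x ∈ A ↔ y ∈ A :=
  ⟨h x y hxy, h y x fun i hi => (hxy i hi).symm⟩

lemma Loc.mono {s t : Set ι} {A : Set (ι → Bool)} (h : Loc s A) (hst : s ⊆ t) : Loc t A :=
  fun x y hxy => h x y fun i hi => hxy i (hst hi)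

lemma Loc.compl {s : Set ι} {A : Set (ι → Bool)} (h : Loc s A) : Loc s Aᶜ :=
  fun _ _ hxy hx hy => hx ((h.iff hxy).2 hy)

lemma Loc.inter {s : Set ι} {A B : Set (ι → Bool)} (h : Loc s A) (h' : Loc s B) : Loc s (A ∩ B) :=
  fun x y hxy hx => ⟨h x y hxy hx.1, h' x y hxy hx.2⟩

lemma Loc.union {s : Set ι} {A B : Set (ι → Bool)} (h : Loc s A) (h' : Loc s B) : Loc s (A ∪ B) :=
  fun x y hxy hx => hx.imp (h x y hxy) (h' x y hxy)

lemma Loc.measurable {s : Set ι} {A : Set (ι → Bool)} (h : Loc s A) (hs : s.Finite) :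
    MeasurableSet A := by
  have := hs.to_subtype
  have hA : A = (fun (x : ι → Bool) (i : s) => x i) ⁻¹'
      ((fun (x : ι → Bool) (i : s) => x i) '' A) := by
    ext x
    constructor
    · intro hx; exact ⟨x, hx, rfl⟩
    · rintro ⟨y, hy, hyx⟩
      exact h y x (fun i hi => congrFun hyx ⟨i, hi⟩) hy
  rw [hA]
  refine measurableSet_preimage ?_ (Set.toFinite _).measurableSet
  exact measurable_pi_lambda _ fun i => measurable_pi_apply _

open Classical in
/-- take `x` on `s` and `y` off `s` -/
noncomputable def spl (s : Set ι) (x y : ι → Bool) : ι → Bool := fun i => if i ∈ s then x i else y i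

lemma spl_mem {s : Set ι} {x y : ι → Bool} {i : ι} (h : i ∈ s) : spl s x y i = x i := by simp [spl, h]
lemma spl_not_mem {s : Set ι} {x y : ι → Bool} {i : ι} (h : i ∉ s) : spl s x y i = y i := by
  simp [spl, h]

lemma measurable_spl (s : Set ι) :
    Measurable (fun z : (ι → Bool) × (ι → Bool) => spl s z.1 z.2) := by
  refine measurable_pi_lambda _ fun i => ?_
  by_cases h : i ∈ s
  · simp only [spl_mem h]; exact (measurable_pi_apply i).comp measurable_fst
  · simp only [spl_not_mem h]; exact (measurable_pi_apply i).comp measurable_snd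

lemma map_spl (r : ι → unitInterval) (s : Set ι) :
    ((PM r).prod (PM r)).map (fun z => spl s z.1 z.2) = PM r := by
  classical
  unfold PM
  refine Measure.eq_infinitePi _ fun S t ht => ?_
  rw [Measure.map_apply (measurable_spl s) (MeasurableSet.pi S.countable_toSet fun i _ => ht i)]
  have : (fun z : (ι → Bool) × (ι → Bool) => spl s z.1 z.2) ⁻¹' (Set.pi S t) =
      (Set.pi (S.filter (· ∈ s) : Finset ι) t) ×ˢ (Set.pi (S.filter (· ∉ s) : Finset ι) t) := by
    ext ⟨x, y⟩
    simp only [Set.mem_preimage, Set.mem_pi, Finset.mem_coe, Set.mem_prod, Finset.mem_filter]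
    constructor
    · intro h
      exact ⟨fun i hi => by simpa [spl, hi.2] using h i hi.1,
        fun i hi => by simpa [spl, hi.2] using h i hi.1⟩
    · rintro ⟨h1, h2⟩ i hi
      by_cases his : i ∈ s
      · rw [spl_mem his]; exact h1 i ⟨hi, his⟩
      · rw [spl_not_mem his]; exact h2 i ⟨hi, his⟩
  rw [this, Measure.prod_prod, Measure.infinitePi_pi _ (fun i _ => ht i),
    Measure.infinitePi_pi _ (fun i _ => ht i), Finset.prod_filter_mul_prod_filter_not]

lemma cf_eq (r : ι → unitInterval) (s : Set ι) {A : Set (ι → Bool)} (hA : MeasurableSet A) :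
    PM r A = ∫⁻ x, PM r {y | spl s x y ∈ A} ∂(PM r) := by
  conv_lhs => rw [← map_spl r s]
  rw [Measure.map_apply (measurable_spl s) hA, Measure.prod_apply (measurable_spl s hA)]
  rfl

lemma cf_le (r : ι → unitInterval) (s : Set ι) {A B : Set (ι → Bool)} (hA : MeasurableSet A)
    (hB : MeasurableSet B) (hBs : Loc s B) (τ : ℝ≥0∞)
    (h : ∀ x ∈ B, PM r {y | spl s x y ∈ A} ≤ τ) : PM r (A ∩ B) ≤ τ * PM r B := by
  rw [cf_eq r s (hA.inter hB)]
  calc _ ≤ ∫⁻ x, B.indicator (fun _ => τ) x ∂(PM r) := by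
        refine lintegral_mono fun x => ?_
        by_cases hx : x ∈ B
        · rw [Set.indicator_of_mem hx]
          exact (measure_mono fun y hy => hy.1).trans (h x hx)
        · have : {y | spl s x y ∈ A ∩ B} = ∅ := by
            ext y
            simp only [Set.mem_ofPred_eq, Set.mem_empty_iff_false, iff_false]
            intro hy
            exact hx (hBs _ _ (fun i hi => spl_mem hi) hy.2)
          rw [this]; simp
    _ = _ := by rw [lintegral_indicator hB]; simp

lemma ind_eq (r : ι → unitInterval) {s t : Set ι} {A B : Set (ι → Bool)} (hA : MeasurableSet A)
    (hB : MeasurableSet B) (hBs : Loc s B) (hAt : Loc t A) (hst : Disjoint s t) :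
    PM r (A ∩ B) = PM r A * PM r B := by
  rw [cf_eq r s (hA.inter hB)]
  have : ∀ x, PM r {y | spl s x y ∈ A ∩ B} = B.indicator (fun _ => PM r A) x := by
    intro x
    have h1 : ∀ y, spl s x y ∈ A ↔ y ∈ A := fun y => hAt.iff fun i hi =>
      spl_not_mem fun h => Set.disjoint_left.1 hst h hi
    have h2 : ∀ y, spl s x y ∈ B ↔ x ∈ B := fun y => hBs.iff fun i hi => spl_mem hi
    by_cases hx : x ∈ B
    · rw [Set.indicator_of_mem hx]
      congr 1; ext y; simp [h1, h2, hx]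
    · rw [Set.indicator_of_notMem hx]
      have : {y | spl s x y ∈ A ∩ B} = ∅ := by ext y; simp [h2, hx]
      rw [this]; simp
  simp only [this]
  rw [lintegral_indicator hB]; simp

lemma ind_prod (r : ι → unitInterval) {κ : Type*} (T : Finset κ) (s : κ → Set ι)
    (A : κ → Set (ι → Bool)) (hA : ∀ k ∈ T, MeasurableSet (A k)) (hAs : ∀ k ∈ T, Loc (s k) (A k))
    (hd : ∀ k ∈ T, ∀ l ∈ T, k ≠ l → Disjoint (s k) (s l)) :
    PM r {ω | ∀ k ∈ T, ω ∈ A k} = ∏ k ∈ T, PM r (A k) := by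
  classical
  induction T using Finset.induction_on with
  | empty => simp
  | insert k T hk ih =>
    have e : {ω | ∀ l ∈ insert k T, ω ∈ A l} = {ω | ∀ l ∈ T, ω ∈ A l} ∩ A k := by
      ext ω; simp [and_comm]
    have hm : MeasurableSet {ω | ∀ l ∈ T, ω ∈ A l} := by
      have : {ω | ∀ l ∈ T, ω ∈ A l} = ⋂ l ∈ T, A l := by ext; simp
      rw [this]
      exact Finset.measurableSet_biInter _ fun l hl => hA l (Finset.mem_insert_of_mem hl)
    rw [e, ind_eq r hm (hA k (Finset.mem_insert_self _ _)) (hAs k (Finset.mem_insert_self _ _))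
      (t := ⋃ l ∈ T, s l), ih (fun l hl => hA l (Finset.mem_insert_of_mem hl))
        (fun l hl => hAs l (Finset.mem_insert_of_mem hl))
        (fun l hl m hm => hd l (Finset.mem_insert_of_mem hl) m (Finset.mem_insert_of_mem hm)),
      Finset.prod_insert hk, mul_comm]
    · intro x y hxy hx l hl
      exact hAs l (Finset.mem_insert_of_mem hl) x y
        (fun i hi => hxy i (Set.mem_iUnion₂.2 ⟨l, hl, hi⟩)) (hx l hl)
    · rw [Set.disjoint_iUnion₂_right]
      intro l hl
      exact hd k (Finset.mem_insert_self _ _) l (Finset.mem_insert_of_mem hl)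
        (by rintro rfl; exact hk hl)

lemma ind_prod_le (r : ι → unitInterval) {κ : Type*} (T : Finset κ) (s : κ → Set ι)
    (A : κ → Set (ι → Bool)) (hA : ∀ k ∈ T, MeasurableSet (A k)) (hAs : ∀ k ∈ T, Loc (s k) (A k))
    (hd : ∀ k ∈ T, ∀ l ∈ T, k ≠ l → Disjoint (s k) (s l)) (τ : ℝ≥0∞)
    (hτ : ∀ k ∈ T, PM r (A k) ≤ τ) :
    PM r {ω | ∀ k ∈ T, ω ∈ A k} ≤ τ ^ T.card := by
  rw [ind_prod r T s A hA hAs hd]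
  exact Finset.prod_le_pow_card _ _ _ hτ

lemma PM_cyl (r : ι → unitInterval) (s : Finset ι) (f : ι → Bool) :
    PM r {ω | ∀ e ∈ s, ω e = f e} = ∏ e ∈ s, bern (r e) {f e} := by
  have : {ω : ι → Bool | ∀ e ∈ s, ω e = f e} = Set.pi s (fun e => {f e}) := by
    ext; simp [Set.mem_pi]
  rw [this]; unfold PM
  exact Measure.infinitePi_pi _ (fun i _ => measurableSet_singleton _)

lemma PM_coord (r : ι → unitInterval) (i : ι) (v : Bool) :
    PM r {ω | ω i = v} = bern (r i) {v} := by
  have := PM_cyl r {i} (fun _ => v)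
  simpa using this

lemma PM_char (r : ι → unitInterval) (μ : Measure (ι → Bool)) [IsProbabilityMeasure μ]
    (h : ∀ (s : Finset ι) (f : ι → Bool),
      μ {ω | ∀ e ∈ s, ω e = f e} = ∏ e ∈ s, bern (r e) {f e}) : μ = PM r := by
  classical
  unfold PM
  refine Measure.eq_infinitePi _ fun S t ht => ?_
  by_cases hemp : ∃ i ∈ S, t i = ∅
  · obtain ⟨i, hi, hti⟩ := hemp
    have : Set.pi (S : Set ι) t = ∅ := Set.pi_eq_empty (i := i) hi hti
    rw [this, Finset.prod_eq_zero hi (by rw [hti]; simp)]; simp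
  push Not at hemp
  let f : ι → Bool := fun i => if true ∈ t i then true else false
  have hf : ∀ i ∈ S, t i ≠ Set.univ → t i = {f i} := by
    intro i hi hne
    obtain ⟨v, hv⟩ := hemp i hi
    have : ∃ w, w ∉ t i := by
      by_contra hc; push Not at hc; exact hne (Set.eq_univ_of_forall hc)
    obtain ⟨w, hw⟩ := this
    ext b
    simp only [f]
    cases v <;> cases w <;> cases b <;> simp_all
  have e : Set.pi (S : Set ι) t = {ω | ∀ e ∈ S.filter (fun i => t i ≠ Set.univ), ω e = f e} := by
    ext ω
    simp only [Set.mem_pi, Finset.mem_coe, Finset.mem_filter, Set.mem_ofPred_eq]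
    constructor
    · rintro h i ⟨hi, hne⟩
      have := h i hi; rw [hf i hi hne] at this; exact this
    · intro h i hi
      by_cases hne : t i = Set.univ
      · rw [hne]; trivial
      · rw [hf i hi hne]; exact h i ⟨hi, hne⟩
  rw [e, h, Finset.prod_filter]
  refine Finset.prod_congr rfl fun i hi => ?_
  split_ifs with hne
  · rw [← hf i hi hne]
  · rw [not_ne_iff.1 hne, measure_univ]

lemma BernoulliFamily.eq_PM (F : BernoulliFamily d) (p : unitInterval) :
    F.P p = PM (fun _ => p) := by
  have := F.prob p
  refine PM_char _ _ fun s f => ?_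
  rw [F.iid p p.2.1 p.2.2 s f]
  refine Finset.prod_congr rfl fun e _ => ?_
  cases h : f e
  · simp [bern_false]
  · simp [bern_true]

/-! ### translations -/

lemma sym2dist1_map (y : V d) (e : Sym2 (V d)) : sym2dist1 (Sym2.map (· + y) e) = sym2dist1 e := by
  induction e using Sym2.ind with
  | _ a b => exact dist1_add a b y

/-- translate an edge -/
def tE (y : V d) (e : Edge d) : Edge d := ⟨Sym2.map (· + y) e.1, by rw [sym2dist1_map]; exact e.2⟩

lemma tE_neg (y : V d) (e : Edge d) : tE (-y) (tE y e) = e := by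
  apply Subtype.ext
  show Sym2.map (· + -y) (Sym2.map (· + y) e.1) = e.1
  rw [Sym2.map_map]
  have : ((fun x : V d => x + -y) ∘ fun x => x + y) = id := by ext x; simp
  rw [this]; simp

lemma tE_inj (y : V d) : Function.Injective (tE y) := fun a b h => by
  rw [← tE_neg y a, h, tE_neg]

/-- translate a configuration -/
def shift (y : V d) (ω : Config d) : Config d := fun e => ω (tE y e)

lemma shift_mp (p : unitInterval) (y : V d) :
    MeasurePreserving (shift y) (PM (fun _ : Edge d => p)) (PM (fun _ : Edge d => p)) := by
  classical
  have hm : Measurable (shift y) := measurable_pi_lambda _ fun e => measurable_pi_apply _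
  refine ⟨hm, ?_⟩
  have : IsProbabilityMeasure ((PM (fun _ : Edge d => p)).map (shift y)) :=
    Measure.isProbabilityMeasure_map hm.aemeasurable
  refine PM_char _ _ fun s f => ?_
  have hms : MeasurableSet {ω : Config d | ∀ e ∈ s, ω e = f e} := by
    refine Loc.measurable (s := (s : Set (Edge d))) (fun a b hab ha e he => ?_) s.finite_toSet
    rw [← hab e he]; exact ha e he
  rw [Measure.map_apply hm hms]
  have e1 : shift y ⁻¹' {ω : Config d | ∀ e ∈ s, ω e = f e} =
      {ω | ∀ e ∈ s.image (tE y), ω e = f (tE (-y) e)} := by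
    ext ω; simp [shift, tE_neg]
  rw [e1, PM_cyl, Finset.prod_image (fun a _ b _ h => tE_inj y h)]
  simp [tE_neg]

lemma edgeOpen_shift (y : V d) (ω : Config d) (a b : V d) :
    edgeOpen (shift y ω) a b ↔ edgeOpen ω (a + y) (b + y) := by
  unfold edgeOpen openE
  constructor
  · rintro ⟨h1, h2⟩
    exact ⟨by have := sym2dist1_map y s(a, b); rw [h1] at this; exact this, h2⟩
  · rintro ⟨h1, h2⟩
    exact ⟨by have := sym2dist1_map y s(a, b); rw [← this]; exact h1, h2⟩

lemma conn_shift_aux (y : V d) (ω : Config d) (S : Set (V d)) {a b : V d}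
    (h : Conn (shift y ω) S a b) : Conn ω ((· - y) ⁻¹' S) (a + y) (b + y) := by
  refine Relation.ReflTransGen.lift (· + y) ?_ _ _ h
  rintro u v ⟨h1, h2, h3⟩
  exact ⟨(edgeOpen_shift y ω u v).1 h1, by simpa using h2, by simpa using h3⟩

lemma shift_neg (y : V d) (ω : Config d) : shift (-y) (shift y ω) = ω := by
  ext e; unfold shift
  have := tE_neg (-y) e
  rw [neg_neg] at this; rw [this]

lemma conn_shift (y : V d) (ω : Config d) (c : V d) (r : ℤ) (a b : V d) :
    Conn (shift y ω) (cb c r) a b ↔ Conn ω (cb (c + y) r) (a + y) (b + y) := by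
  have e : ∀ (c y : V d), (fun x => x - y) ⁻¹' (cb c r) = cb (c + y) r := by
    intro c y; ext x; simp only [Set.mem_preimage, mem_cb, Pi.sub_apply, Pi.add_apply]
    refine forall_congr' fun k => ?_
    rw [show x k - y k - c k = x k - (c k + y k) by ring]
  constructor
  · intro h; have := conn_shift_aux y ω _ h; rwa [e] at this
  · intro h
    have := conn_shift_aux (-y) (shift y ω) (cb (c + y) r) (a := a + y) (b := b + y)
      (by rwa [shift_neg])
    rw [e] at this; simpa using this

lemma connected_shift (y : V d) (ω : Config d) (a b : V d) :
    Connected (shift y ω) a b ↔ Connected ω (a + y) (b + y) := by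
  rw [connected_iff_cb, connected_iff_cb]
  exact exists_congr fun n => conn_shift y ω a n a b

lemma inf_shift (y : V d) (ω : Config d) (a : V d) :
    InInfiniteCluster (shift y ω) a ↔ InInfiniteCluster ω (a + y) := by
  rw [inf_iff, inf_iff]
  refine forall_congr' fun r => ?_
  have e : ∀ x : V d, x ∈ cb a r ↔ x + y ∈ cb (a + y) r := by
    intro x; simp [mem_cb]
  constructor
  · rintro ⟨x, h1, h2⟩
    exact ⟨x + y, (connected_shift y ω a x).1 h1, fun h => h2 ((e x).2 h)⟩
  · rintro ⟨x, h1, h2⟩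
    refine ⟨x - y, (connected_shift y ω a _).2 (by simpa using h1), fun h => h2 ?_⟩
    have := (e _).1 h; simpa using this

/-! ### measurability -/

lemma loc_conn (S : Set (V d)) (x y : V d) : Loc (EdgesIn S) {ω : Config d | Conn ω S x y} :=
  fun _ _ hab h => Conn.congr_le h fun e he => (hab e he).le

lemma meas_conn (c : V d) (r : ℤ) (x y : V d) : MeasurableSet {ω : Config d | Conn ω (cb c r) x y} :=
  (loc_conn _ x y).measurable (EdgesIn_finite (cb_finite _ _))

lemma meas_connected (x y : V d) : MeasurableSet {ω : Config d | Connected ω x y} := by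
  have : {ω : Config d | Connected ω x y} = ⋃ n : ℕ, {ω | Conn ω (cb x n) x y} := by
    ext ω; simp [connected_iff_cb]
  rw [this]; exact MeasurableSet.iUnion fun n => meas_conn _ _ _ _

lemma meas_inf (x : V d) : MeasurableSet {ω : Config d | InInfiniteCluster ω x} := by
  have : {ω : Config d | InInfiniteCluster ω x} =
      ⋂ r : ℕ, ⋃ y : V d, {ω | Connected ω x y ∧ y ∉ cb x r} := by
    ext ω; simp [inf_iff]
  rw [this]
  refine MeasurableSet.iInter fun r => MeasurableSet.iUnion fun y => ?_
  by_cases h : y ∈ cb x r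
  · simp [h]
  · simpa [h] using meas_connected x y

end

section
variable {d : ℕ}

lemma ev {Ω : Type*} [MeasurableSpace Ω] {P : Measure Ω} [IsProbabilityMeasure P] {A : ℕ → Set Ω}
    (h : ∀ᵐ ω ∂P, ∀ᶠ n in atTop, ω ∈ A n) {δ : ℝ≥0∞} (hδ : 0 < δ) :
    ∃ n0, ∀ n ≥ n0, ∀ U W, MeasurableSet U → A n ⊆ U ∪ W → P Uᶜ ≤ δ + P W := by
  let C : ℕ → Set Ω := fun n => {ω | ∀ m ≥ n, ω ∈ A m}
  have hC : Monotone C := fun a b hab ω hω m hm => hω m (le_trans hab hm)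
  have h1 : P (⋃ n, C n) = 1 := by
    rw [← measure_univ (μ := P)]
    refine measure_congr ?_
    filter_upwards [h] with ω hω
    obtain ⟨n, hn⟩ := eventually_atTop.1 hω
    refine eq_iff_iff.2 ⟨fun _ => trivial, fun _ => Set.mem_iUnion.2 ⟨n, hn⟩⟩
  have h2 := tendsto_measure_iUnion_atTop (μ := P) hC
  rw [h1] at h2
  have h3 : ∃ n0, 1 ≤ P (C n0) + δ := by
    have h2' := h2.add_const δ
    have : ∀ᶠ n in atTop, 1 < P (C n) + δ :=
      h2'.eventually (lt_mem_nhds (ENNReal.lt_add_right ENNReal.one_ne_top hδ.ne'))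
    obtain ⟨n, hn⟩ := this.exists
    exact ⟨n, hn.le⟩
  obtain ⟨n0, hn0⟩ := h3
  refine ⟨n0, fun n hn U W hU hUW => ?_⟩
  have h4 : P (C n0) ≤ P U + P W :=
    (measure_mono (show C n0 ⊆ U ∪ W from fun ω hω => hUW (hω n hn))).trans (measure_union_le _ _)
  rw [prob_compl_eq_one_sub hU]
  rw [tsub_le_iff_right]
  calc 1 ≤ P (C n0) + δ := hn0
    _ ≤ P U + P W + δ := by gcongr
    _ = _ := by ring

lemma reg_exists {ω : Config d} (h : ∃ y, InInfiniteCluster ω y) (x : V d) :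
    ∃ y : V d, InInfiniteCluster ω y ∧ ∀ z : V d, InInfiniteCluster ω z → dist1 x y ≤ dist1 x z := by
  classical
  have hex : ∃ n, ∃ y, InInfiniteCluster ω y ∧ dist1 x y = n := by
    obtain ⟨y, hy⟩ := h; exact ⟨_, y, hy, rfl⟩
  obtain ⟨y, hy, hn⟩ := Nat.find_spec hex
  exact ⟨y, hy, fun z hz => by rw [hn]; exact Nat.find_min' hex ⟨z, hz, rfl⟩⟩

lemma regPoint_spec {ω : Config d} (h : ∃ y, InInfiniteCluster ω y) (x : V d) :
    InInfiniteCluster ω (regPoint ω x) ∧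
      ∀ z : V d, InInfiniteCluster ω z → dist1 x (regPoint ω x) ≤ dist1 x z := by
  unfold regPoint
  rw [dif_pos (reg_exists h x)]
  exact (reg_exists h x).choose_spec

lemma dist1_self (x : V d) : dist1 x x = 0 := by simp [dist1]

lemma dist1_eq_zero {x y : V d} (h : dist1 x y = 0) : x = y := by
  ext k
  have := cb_of_dist1 (le_of_eq h) k
  simp at this; omega

lemma regPoint_self {ω : Config d} {x : V d} (h : InInfiniteCluster ω x) : regPoint ω x = x := by
  have h1 := (regPoint_spec ⟨x, h⟩ x).2 x h
  rw [dist1_self] at h1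
  exact (dist1_eq_zero (Nat.le_zero.1 h1)).symm

lemma regPoint_cb {ω : Config d} {x y : V d} {R : ℕ} (h : InInfiniteCluster ω y) (hy : y ∈ cb x R) :
    regPoint ω x ∈ cb x (d * R : ℕ) := by
  have h1 := (regPoint_spec ⟨y, h⟩ x).2 y h
  rw [dist1_comm, dist1_comm x] at h1
  exact cb_of_dist1 (h1.trans (dist1_of_cb hy))

lemma regPoint_none {ω : Config d} (h : ¬ ∃ y, InInfiniteCluster ω y) (x : V d) :
    regPoint ω x = x := by
  unfold regPoint
  rw [dif_neg]
  rintro ⟨y, hy, -⟩; exact h ⟨y, hy⟩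

/-- standing assumption on one parameter -/
structure TC (p : unitInterval) (t : V d → ℝ) : Prop where
  pos : ∀ x, x ≠ 0 → 0 < t x
  nonneg : ∀ x, 0 ≤ t x
  conv : ASTimeConstant (PM (fun _ : Edge d => p)) t

lemma smul_inj_aux {x : V d} (hx : x ≠ 0) {m n : ℕ} (h : m • x = n • x) : m = n := by
  obtain ⟨k, hk⟩ := Function.ne_iff.1 hx
  have := congrFun h k
  simp only [Pi.smul_apply, nsmul_eq_mul] at this
  have := mul_right_cancel₀ hk this
  exact_mod_cast this

lemma ae_exists_inf (hd : 1 ≤ d) {p : unitInterval} {t : V d → ℝ} (H : TC p t) :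
    ∀ᵐ ω ∂(PM (fun _ : Edge d => p)), ∃ y, InInfiniteCluster ω y := by
  let x : V d := fun _ => 1
  have hx : x ≠ 0 := by
    intro h; have := congrFun h ⟨0, hd⟩; simp [x] at this
  filter_upwards [H.conv x] with ω hω
  by_contra hc
  have hfin : (cluster ω 0).Finite := by
    by_contra h; exact hc ⟨0, h⟩
  have h0 : ∀ᶠ n : ℕ in atTop, DReg ω ω 0 (n • x) / n = 0 := by
    have h1 : {n : ℕ | n • x ∈ cluster ω 0}.Finite :=
      hfin.preimage (fun a _ b _ h => smul_inj_aux hx h)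
    have h2 := h1.compl_mem_cofinite
    rw [Nat.cofinite_eq_atTop] at h2
    filter_upwards [h2] with n hn
    have : chemDist ω 0 (n • x) = ⊤ := by
      by_contra h; exact hn h
    rw [DReg, regPoint_none hc, regPoint_none hc, this]; simp
  have h1 := tendsto_nhds_unique (hω.congr' h0) tendsto_const_nhds
  exact (H.pos x hx).ne' h1

lemma shift_iterate (x : V d) (n : ℕ) (ω : Config d) : (shift x)^[n] ω = shift (n • x) ω := by
  induction n with
  | zero =>
    ext e
    show ω e = ω (tE (0 • x) e)
    congr 1
    apply Subtype.ext
    show e.1 = Sym2.map (· + 0 • x) e.1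
    simp
  | succ n ih =>
    rw [Function.iterate_succ', Function.comp, ih]
    ext e
    show ω (tE _ (tE _ e)) = ω (tE _ e)
    congr 1
    apply Subtype.ext
    show Sym2.map (· + n • x) (Sym2.map (· + x) e.1) = Sym2.map (· + (n + 1) • x) e.1
    rw [Sym2.map_map]
    congr 1
    ext y k
    simp [add_mul]; ring

lemma ae_recur {p : unitInterval} (a x : V d) :
    ∀ᵐ ω ∂(PM (fun _ : Edge d => p)), InInfiniteCluster ω a →
      ∃ᶠ n : ℕ in atTop, InInfiniteCluster ω (a + n • x) := by
  have h := ((shift_mp (d := d) p x).conservative).ae_mem_imp_frequently_image_mem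
    (meas_inf a).nullMeasurableSet
  filter_upwards [h] with ω hω ha
  refine (hω ha).mono fun n hn => ?_
  rw [shift_iterate] at hn
  exact (inf_shift _ _ _).1 hn

lemma ae_conn_along {p : unitInterval} {t : V d → ℝ} (H : TC p t) (a x : V d) (hx : x ≠ 0) :
    ∀ᵐ ω ∂(PM (fun _ : Edge d => p)), InInfiniteCluster ω a →
      ∀ᶠ n : ℕ in atTop, InInfiniteCluster ω (a + n • x) → Connected ω a (a + n • x) := by
  have h := (shift_mp (d := d) p a).quasiMeasurePreserving.ae (H.conv x)
  filter_upwards [h] with ω hω ha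
  have h1 := hω.eventually (lt_mem_nhds (H.pos x hx))
  filter_upwards [h1] with n hn hin
  have r0 : regPoint (shift a ω) 0 = 0 := regPoint_self ((inf_shift _ _ _).2 (by simpa using ha))
  have r1 : regPoint (shift a ω) (n • x) = n • x :=
    regPoint_self ((inf_shift _ _ _).2 (by rwa [add_comm]))
  rw [DReg, r0, r1] at hn
  have : Connected (shift a ω) 0 (n • x) := by
    intro h; rw [h] at hn; simp at hn
  have := (connected_shift _ _ _ _).1 this
  rwa [zero_add, add_comm] at this

lemma ae_unique {p : unitInterval} {t : V d → ℝ} (H : TC p t) :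
    ∀ᵐ ω ∂(PM (fun _ : Edge d => p)), ∀ a b, InInfiniteCluster ω a → InInfiniteCluster ω b →
      Connected ω a b := by
  rw [ae_all_iff]; intro a
  rw [ae_all_iff]; intro b
  by_cases hab : a = b
  · subst hab
    exact Eventually.of_forall fun ω _ _ => connected_iff.2 (Conn.refl _)
  have hx : b - a ≠ 0 := sub_ne_zero.2 (Ne.symm hab)
  filter_upwards [ae_recur (p := p) a (b - a), ae_conn_along H a _ hx, ae_conn_along H b _ hx]
    with ω h1 h2 h3 ha hb
  have h3' : ∀ᶠ n : ℕ in atTop, InInfiniteCluster ω (b + (n - 1 : ℕ) • (b - a)) →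
      Connected ω b (b + (n - 1 : ℕ) • (b - a)) := (tendsto_sub_atTop_nat 1).eventually (h3 hb)
  obtain ⟨n, hn, ⟨h2, h3⟩, hn1⟩ :=
    ((h1 ha).and_eventually (((h2 ha).and h3').and (eventually_ge_atTop 1))).exists
  have e : b + (n - 1 : ℕ) • (b - a) = a + n • (b - a) := by
    obtain ⟨m, rfl⟩ : ∃ m, n = m + 1 := ⟨n - 1, by omega⟩
    simp only [Nat.add_sub_cancel, succ_nsmul]; abel
  rw [e] at h3
  exact (h2 hn).trans' (h3 hn).symm'

lemma tight1 (hd : 1 ≤ d) {p : unitInterval} {t : V d → ℝ} (H : TC p t) {δ : ℝ≥0∞} (hδ : 0 < δ) :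
    ∃ R : ℕ, ∀ y : V d, PM (fun _ : Edge d => p) {ω | ∀ v ∈ cb y R, ¬ InInfiniteCluster ω v} ≤ δ := by
  have h1 : ∀ᵐ ω ∂(PM (fun _ : Edge d => p)), ∀ᶠ n : ℕ in atTop,
      ω ∈ {ω : Config d | ∃ v ∈ cb (0 : V d) n, InInfiniteCluster ω v} := by
    filter_upwards [ae_exists_inf hd H] with ω hω
    obtain ⟨y, hy⟩ := hω
    filter_upwards [eventually_ge_atTop (dist1 y 0)] with n hn
    exact ⟨y, cb_of_dist1 hn, hy⟩
  obtain ⟨n, hn⟩ := ev h1 hδ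
  have hm : ∀ y : V d, MeasurableSet {ω : Config d | ∃ v ∈ cb y n, InInfiniteCluster ω v} := by
    intro y
    have : {ω : Config d | ∃ v ∈ cb y n, InInfiniteCluster ω v} =
      ⋃ v ∈ cb y n, {ω : Config d | InInfiniteCluster ω v} := by ext; simp
    rw [this]
    exact MeasurableSet.biUnion (Set.to_countable _) fun v _ => meas_inf v
  have h2 := hn n le_rfl _ ∅ (hm 0) (by simp)
  refine ⟨n, fun y => ?_⟩
  rw [← (shift_mp p y).measure_preimage (hm 0).compl.nullMeasurableSet] at h2
  refine (measure_mono ?_).trans (h2.trans (by simp))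
  intro ω hω
  simp only [Set.mem_preimage, Set.mem_compl_iff]
  rintro ⟨v, hv, hvi⟩
  refine hω (v + y) ?_ ((inf_shift _ _ _).1 hvi)
  intro k; simpa using hv k

lemma meas_pair (y : V d) (R ρ : ℕ) : MeasurableSet {ω : Config d | ∃ v ∈ cb y R, ∃ v' ∈ cb y R,
    InInfiniteCluster ω v ∧ InInfiniteCluster ω v' ∧ ¬ Conn ω (cb y ρ) v v'} := by
  have : {ω : Config d | ∃ v ∈ cb y R, ∃ v' ∈ cb y R,
    InInfiniteCluster ω v ∧ InInfiniteCluster ω v' ∧ ¬ Conn ω (cb y ρ) v v'} =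
    ⋃ v ∈ cb y R, ⋃ v' ∈ cb y R, ({ω | InInfiniteCluster ω v} ∩ ({ω | InInfiniteCluster ω v'} ∩
      {ω | Conn ω (cb y ρ) v v'}ᶜ)) := by
    ext; simp only [Set.mem_ofPred_eq, Set.mem_iUnion, Set.mem_inter_iff, Set.mem_compl_iff, exists_prop]
  rw [this]
  exact MeasurableSet.biUnion (Set.to_countable _) fun v _ =>
    MeasurableSet.biUnion (Set.to_countable _) fun v' _ =>
      (meas_inf v).inter ((meas_inf v').inter (meas_conn _ _ _ _).compl)

lemma cb_subset_cb {x y : V d} {r s : ℤ} (h : ∀ k, |x k - y k| + r ≤ s) : cb x r ⊆ cb y s := by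
  intro z hz k
  have h1 := h k; have h2 := hz k
  calc |z k - y k| = |(z k - x k) + (x k - y k)| := by ring_nf
    _ ≤ _ := abs_add_le _ _
    _ ≤ s := by linarith

lemma tight2 {p : unitInterval} {t : V d → ℝ} (H : TC p t) (R : ℕ) {δ : ℝ≥0∞} (hδ : 0 < δ) :
    ∃ ρ : ℕ, R ≤ ρ ∧ ∀ y : V d, PM (fun _ : Edge d => p) {ω | ∃ v ∈ cb y R, ∃ v' ∈ cb y R,
      InInfiniteCluster ω v ∧ InInfiniteCluster ω v' ∧ ¬ Conn ω (cb y ρ) v v'} ≤ δ := by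
  have h1 : ∀ᵐ ω ∂(PM (fun _ : Edge d => p)), ∀ᶠ n : ℕ in atTop,
      ω ∈ {ω : Config d | ∃ v ∈ cb (0 : V d) R, ∃ v' ∈ cb (0 : V d) R,
      InInfiniteCluster ω v ∧ InInfiniteCluster ω v' ∧ ¬ Conn ω (cb 0 n) v v'}ᶜ := by
    filter_upwards [ae_unique H] with ω hω
    have h2 : ∀ v ∈ cb (0 : V d) R, ∀ v' ∈ cb (0 : V d) R, ∀ᶠ n : ℕ in atTop,
        InInfiniteCluster ω v → InInfiniteCluster ω v' → Conn ω (cb 0 n) v v' := by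
      intro v hv v' hv'
      by_cases hi : InInfiniteCluster ω v
      · by_cases hi' : InInfiniteCluster ω v'
        · obtain ⟨m, hm⟩ := connected_iff_cb.1 (hω v v' hi hi')
          filter_upwards [eventually_ge_atTop (m + R)] with n hn _ _
          refine hm.mono le_rfl (cb_subset_cb fun k => ?_)
          have := hv k
          have : (m + R : ℤ) ≤ n := by exact_mod_cast hn
          linarith
        · exact Eventually.of_forall fun n _ h => absurd h hi'
      · exact Eventually.of_forall fun n h => absurd h hi
    have h3 := (Filter.eventually_all_finite (cb_finite (0 : V d) R)).2 fun v hv =>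
      (Filter.eventually_all_finite (cb_finite (0 : V d) R)).2 fun v' hv' => h2 v hv v' hv'
    filter_upwards [h3] with n hn
    rintro ⟨v, hv, v', hv', hi, hi', hc⟩
    exact hc (hn v hv v' hv' hi hi')
  obtain ⟨n, hn⟩ := ev h1 hδ
  have h2 := hn (max n R) (le_max_left _ _) _ ∅ (meas_pair 0 R (max n R)).compl (by simp)
  rw [compl_compl] at h2
  refine ⟨max n R, le_max_right _ _, fun y => ?_⟩
  rw [← (shift_mp p y).measure_preimage (meas_pair 0 R _).nullMeasurableSet] at h2
  refine (measure_mono ?_).trans (h2.trans (by simp))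
  rintro ω ⟨v, hv, v', hv', hi, hi', hc⟩
  refine ⟨v - y, fun k => by simpa using hv k, v' - y, fun k => by simpa using hv' k,
    (inf_shift _ _ _).2 (by simpa), (inf_shift _ _ _).2 (by simpa), fun h => hc ?_⟩
  have := (conn_shift _ _ _ _ _ _).1 h
  simpa using this

/-- existence of a pair of infinite-cluster points close to the endpoints, at distance `≤ L` -/
def Pair (x : V d) (ρ : ℕ) (L : ℝ≥0∞) : Set (Config d) :=
  {ω | ∃ v ∈ cb (0 : V d) ρ, ∃ v' ∈ cb x ρ, InInfiniteCluster ω v ∧ InInfiniteCluster ω v' ∧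
    chemDist ω v v' ≤ L}

lemma meas_chem (x y : V d) (L : ℝ≥0∞) : MeasurableSet {ω : Config d | chemDist ω x y ≤ L} := by
  have key : ∀ n : ℕ, MeasurableSet {ω : Config d | chemDist ω x y ≤ n} := by
    intro n
    refine Loc.measurable (s := EdgesIn (cb x n)) ?_ (EdgesIn_finite (cb_finite _ _))
    intro ω ω' hω h
    obtain ⟨m, f, h1, rfl, rfl, h4⟩ := exists_path (ne_top_of_le_ne_top (ENNReal.natCast_ne_top n) h)
    refine le_trans (chemDist_le_path (fun i hi => ?_)) (h4 ▸ h)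
    have hmn : m ≤ n := by
      have : chemDist ω (f 0) (f m) ≤ n := h
      rw [h4] at this; exact_mod_cast this
    obtain ⟨e1, e2⟩ := h1 i hi
    refine ⟨e1, ?_⟩
    refine (hω ⟨_, e1⟩ ?_).symm.trans e2
    intro v hv
    rcases Sym2.mem_iff.1 hv with rfl | rfl
    · exact cb_mono (path_cb h1 hi.le) (by exact_mod_cast hi.le.trans hmn)
    · exact cb_mono (path_cb h1 hi) (by exact_mod_cast (Nat.succ_le_of_lt hi).trans hmn)
  by_cases hL : L = ⊤
  · simp [hL]
  have : {ω : Config d | chemDist ω x y ≤ L} = {ω | chemDist ω x y ≤ ⌊L.toReal⌋₊} := by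
    ext ω
    constructor
    · intro h
      obtain ⟨m, f, h1, h2, h3, h4⟩ := exists_path (ne_top_of_le_ne_top hL h)
      have h : chemDist ω x y ≤ L := h
      show chemDist ω x y ≤ _
      rw [h4] at h ⊢
      have h5 : (m : ℝ) ≤ L.toReal := by
        have := ENNReal.toReal_mono hL h
        simpa using this
      exact_mod_cast Nat.le_floor h5
    · intro h
      refine le_trans (show chemDist ω x y ≤ _ from h) ?_
      rw [← ENNReal.ofReal_toReal hL, ← ENNReal.ofReal_natCast]
      apply ENNReal.ofReal_le_ofReal
      rw [ENNReal.toReal_ofReal ENNReal.toReal_nonneg]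
      exact Nat.floor_le ENNReal.toReal_nonneg
  rw [this]; exact key _

lemma meas_Pair (x : V d) (ρ : ℕ) (L : ℝ≥0∞) : MeasurableSet (Pair x ρ L) := by
  have : Pair x ρ L = ⋃ v ∈ cb (0 : V d) ρ, ⋃ v' ∈ cb x ρ, ({ω | InInfiniteCluster ω v} ∩
      ({ω | InInfiniteCluster ω v'} ∩ {ω | chemDist ω v v' ≤ L})) := by
    ext; simp only [Pair, Set.mem_ofPred_eq, Set.mem_iUnion, Set.mem_inter_iff, exists_prop]
  rw [this]
  exact MeasurableSet.biUnion (Set.to_countable _) fun v _ =>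
    MeasurableSet.biUnion (Set.to_countable _) fun v' _ =>
      (meas_inf v).inter ((meas_inf v').inter (meas_chem _ _ _))

lemma up (hd : 1 ≤ d) {p : unitInterval} {t : V d → ℝ} (H : TC p t) (x : V d) {s : ℝ} (hs : t x < s)
    {δ : ℝ≥0∞} (hδ : 0 < δ) : ∃ ρ n0 : ℕ, ∀ n ≥ n0,
      PM (fun _ : Edge d => p) (Pair (n • x) ρ (ENNReal.ofReal (s * n)))ᶜ ≤ δ := by
  have hδ4 : 0 < δ / 4 := ENNReal.div_pos hδ.ne' (by simp)
  obtain ⟨R, hR⟩ := tight1 hd H hδ4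
  have h1 : ∀ᵐ ω ∂(PM (fun _ : Edge d => p)), ∀ᶠ n : ℕ in atTop,
      ω ∈ {ω : Config d | DReg ω ω 0 (n • x) ≤ s * n} := by
    filter_upwards [H.conv x] with ω hω
    filter_upwards [hω.eventually (gt_mem_nhds hs), eventually_gt_atTop 0] with n hn hn0
    have : (0 : ℝ) < n := by exact_mod_cast hn0
    rw [div_lt_iff₀ this] at hn
    exact hn.le
  obtain ⟨n0, hn0⟩ := ev h1 hδ4
  refine ⟨d * R, n0, fun n hn => ?_⟩
  let N : Set (Config d) := {ω | ¬ ∀ a b, InInfiniteCluster ω a → InInfiniteCluster ω b →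
      Connected ω a b}
  have hN : PM (fun _ : Edge d => p) N = 0 := ae_iff.1 (ae_unique H)
  have := hn0 n hn (Pair (n • x) (d * R) (ENNReal.ofReal (s * n)))
    ({ω | ∀ v ∈ cb (0 : V d) R, ¬ InInfiniteCluster ω v} ∪
      {ω | ∀ v ∈ cb (n • x) R, ¬ InInfiniteCluster ω v} ∪ N) (meas_Pair _ _ _) ?_
  · refine this.trans ?_
    calc _ ≤ δ / 4 + (δ / 4 + δ / 4 + 0) := by
          gcongr
          refine (measure_union_le _ _).trans ?_
          gcongr
          · exact (measure_union_le _ _).trans (add_le_add (hR _) (hR _))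
          · exact hN.le
      _ ≤ δ / 4 + (δ / 4 + δ / 4 + δ / 4) := by gcongr
      _ = 4 * (δ / 4) := by ring
      _ = δ := by rw [mul_comm]; exact ENNReal.div_mul_cancel (by simp) (by simp)
  · intro ω hω
    by_contra hc
    simp only [Set.mem_union, not_or] at hc
    obtain ⟨hc1, ⟨hc2, hc3⟩, hc4⟩ := hc
    simp only [Set.mem_ofPred_eq, not_forall, not_not] at hc2 hc3
    have hc4 := not_not.1 hc4
    obtain ⟨v, hv, hvi⟩ := hc2
    obtain ⟨v', hv', hvi'⟩ := hc3
    have r1 := (regPoint_spec ⟨v, hvi⟩ (0 : V d)).1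
    have r2 := (regPoint_spec ⟨v, hvi⟩ (n • x)).1
    refine hc1 ⟨regPoint ω 0, regPoint_cb hvi hv, regPoint ω (n • x), regPoint_cb hvi' hv', r1, r2, ?_⟩
    exact (ENNReal.le_ofReal_iff_toReal_le (hc4 _ _ r1 r2) (by
      have := (H.nonneg x).trans_lt hs
      positivity)).2 hω

lemma low (hd : 1 ≤ d) {p : unitInterval} {t : V d → ℝ} (H : TC p t) (x : V d) {s : ℝ} (hs0 : 0 ≤ s)
    (hs : s < t x) {δ : ℝ≥0∞} (hδ : 0 < δ) (ρ : ℕ) : ∃ n0 : ℕ, ∀ n ≥ n0,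
      PM (fun _ : Edge d => p) (Pair (n • x) ρ (ENNReal.ofReal (s * n))) ≤ δ := by
  have hδ4 : 0 < δ / 5 := ENNReal.div_pos hδ.ne' (by simp)
  obtain ⟨R, hR⟩ := tight1 hd H hδ4
  obtain ⟨R', hR', hRR⟩ := tight2 H (max ρ (d * R)) hδ4
  obtain ⟨s', hs1, hs2⟩ := exists_between hs
  have h1 : ∀ᵐ ω ∂(PM (fun _ : Edge d => p)), ∀ᶠ n : ℕ in atTop,
      ω ∈ {ω : Config d | s' * n ≤ DReg ω ω 0 (n • x)} := by
    filter_upwards [H.conv x] with ω hω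
    filter_upwards [hω.eventually (lt_mem_nhds hs2), eventually_gt_atTop 0] with n hn hn0
    have : (0 : ℝ) < n := by exact_mod_cast hn0
    rw [lt_div_iff₀ this] at hn
    exact hn.le
  obtain ⟨n0, hn0⟩ := ev h1 hδ4
  let K : ℕ := (2 * R' + 1) ^ d
  obtain ⟨n1, hn1⟩ := exists_nat_gt (2 * K / (s' - s))
  refine ⟨max n0 n1, fun n hn => ?_⟩
  have := hn0 n (le_trans (le_max_left _ _) hn) (Pair (n • x) ρ (ENNReal.ofReal (s * n)))ᶜ
    ({ω | ∀ v ∈ cb (0 : V d) R, ¬ InInfiniteCluster ω v} ∪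
      {ω | ∀ v ∈ cb (n • x) R, ¬ InInfiniteCluster ω v} ∪
      ({ω | ∃ v ∈ cb (0 : V d) (max ρ (d * R) : ℕ), ∃ v' ∈ cb (0 : V d) (max ρ (d * R) : ℕ),
        InInfiniteCluster ω v ∧ InInfiniteCluster ω v' ∧ ¬ Conn ω (cb (0 : V d) R') v v'} ∪
      {ω | ∃ v ∈ cb (n • x) (max ρ (d * R) : ℕ), ∃ v' ∈ cb (n • x) (max ρ (d * R) : ℕ),
        InInfiniteCluster ω v ∧ InInfiniteCluster ω v' ∧ ¬ Conn ω (cb (n • x) R') v v'}))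
      (meas_Pair _ _ _).compl ?_
  · rw [compl_compl] at this
    refine this.trans ?_
    calc _ ≤ δ / 5 + (δ / 5 + δ / 5 + (δ / 5 + δ / 5)) := by
          gcongr
          refine (measure_union_le _ _).trans (add_le_add ?_ ?_)
          · exact (measure_union_le _ _).trans (add_le_add (hR _) (hR _))
          · exact (measure_union_le _ _).trans (add_le_add (hRR _) (hRR _))
      _ = 5 * (δ / 5) := by ring
      _ = δ := by rw [mul_comm]; exact ENNReal.div_mul_cancel (by simp) (by simp)
  · intro ω hω
    by_contra hc
    simp only [Set.mem_union, not_or, Set.mem_compl_iff, not_not] at hc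
    obtain ⟨hc1, ⟨hc2, hc3⟩, hc4, hc5⟩ := hc
    simp only [Set.mem_ofPred_eq, not_forall, not_not] at hc2 hc3
    obtain ⟨v, hv, hvi⟩ := hc2
    obtain ⟨v', hv', hvi'⟩ := hc3
    obtain ⟨w, hw, w', hw', hwi, hwi', hww⟩ := hc1
    have r1 := (regPoint_spec ⟨v, hvi⟩ (0 : V d)).1
    have r2 := (regPoint_spec ⟨v, hvi⟩ (n • x)).1
    have q1 := regPoint_cb hvi hv
    have q2 := regPoint_cb hvi' hv'
    have key : ∀ (y a b : V d), a ∈ cb y (max ρ (d * R) : ℕ) → Conn ω (cb y R') a b →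
        chemDist ω a b ≤ K := by
      intro y a b ha hab
      have e : (cb y R' : Set (V d)) = ↑(cbF y R') := by ext; simp [mem_cbF]
      rw [e] at hab
      have := chemDist_le_card hab (mem_cbF.2 (cb_mono ha (by exact_mod_cast hR')))
      rwa [card_cbF] at this
    have c1 : Conn ω (cb (0 : V d) R') (regPoint ω 0) w := by
      by_contra h
      exact hc4 ⟨_, cb_mono q1 (by exact_mod_cast le_max_right _ _), w,
        cb_mono hw (by exact_mod_cast le_max_left _ _), r1, hwi, h⟩
    have c2 : Conn ω (cb (n • x) R') (regPoint ω (n • x)) w' := by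
      by_contra h
      exact hc5 ⟨_, cb_mono q2 (by exact_mod_cast le_max_right _ _), w',
        cb_mono hw' (by exact_mod_cast le_max_left _ _), r2, hwi', h⟩
    have k1 := key _ _ _ (cb_mono q1 (by exact_mod_cast le_max_right _ _)) c1
    have k2 := key _ _ _ (cb_mono q2 (by exact_mod_cast le_max_right _ _)) c2
    have tot : chemDist ω (regPoint ω 0) (regPoint ω (n • x)) ≤
        ENNReal.ofReal (2 * K + s * n) := by
      calc _ ≤ chemDist ω (regPoint ω 0) w + chemDist ω w (regPoint ω (n • x)) :=
            chemDist_triangle _ _ _ _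
        _ ≤ chemDist ω (regPoint ω 0) w + (chemDist ω w w' + chemDist ω w' (regPoint ω (n • x))) := by
            gcongr; exact chemDist_triangle _ _ _ _
        _ ≤ K + (ENNReal.ofReal (s * n) + K) := by
            rw [chemDist_comm ω w' _]; gcongr
        _ = _ := by
            rw [ENNReal.ofReal_add (by positivity) (mul_nonneg hs0 (Nat.cast_nonneg _)),
              ENNReal.ofReal_mul (p := 2) (by norm_num), ENNReal.ofReal_natCast K]
            rw [show ENNReal.ofReal 2 = 2 by simp]; ring
    have h2 : DReg ω ω 0 (n • x) ≤ 2 * K + s * n := by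
      refine ENNReal.toReal_le_of_le_ofReal (add_nonneg (by positivity) (mul_nonneg hs0 (Nat.cast_nonneg _))) tot
    have h3 : s' * n ≤ DReg ω ω 0 (n • x) := hω
    have h4 : (n1 : ℝ) ≤ n := by exact_mod_cast le_trans (le_max_right _ _) hn
    rw [div_lt_iff₀ (by linarith)] at hn1
    have : 2 * (K : ℝ) < n * (s' - s) := hn1.trans_le (by gcongr)
    nlinarith

end

section
variable {d : ℕ}

/-- nearest-neighbour connection inside `X` -/
def NC (X : Set (V d)) (u v : V d) : Prop := Conn (fun _ => true) X u v

lemma NC.one {X : Set (V d)} {u v : V d} (h : dist1 u v = 1) (hu : u ∈ X) (hv : v ∈ X) : NC X u v :=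
  Relation.ReflTransGen.single ⟨⟨h, rfl⟩, hu, hv⟩

lemma NC.mono {X Y : Set (V d)} {u v : V d} (h : NC X u v) (hX : X ⊆ Y) : NC Y u v :=
  Conn.mono h le_rfl hX

lemma nc_uIcc : ∀ (n : ℕ) (u v : V d), dist1 u v = n → ∀ X : Set (V d),
    (∀ x : V d, (∀ k, min (u k) (v k) ≤ x k ∧ x k ≤ max (u k) (v k)) → x ∈ X) → NC X u v := by
  intro n
  induction n using Nat.strong_induction_on with
  | _ n ih =>
    intro u v huv X hX
    by_cases h : u = v
    · subst h; exact Conn.refl _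
    obtain ⟨k, hk⟩ := Function.ne_iff.1 h
    let ε : ℤ := if u k < v k then 1 else -1
    let u' : V d := Function.update u k (u k + ε)
    have hu'k : u' k = u k + ε := by simp [u']
    have hu'j : ∀ j, j ≠ k → u' j = u j := fun j hj => by simp [u', hj]
    have hε : (u k < v k ∧ ε = 1) ∨ (v k < u k ∧ ε = -1) := by
      rcases lt_or_gt_of_ne hk with h | h
      · left; exact ⟨h, by simp [ε, h]⟩
      · right; exact ⟨h, by simp [ε, not_lt.2 h.le]⟩
    have d1 : dist1 u u' = 1 := by
      unfold dist1
      rw [Finset.sum_eq_single k]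
      · rw [hu'k]; rcases hε with ⟨_, e⟩ | ⟨_, e⟩ <;> rw [e] <;> omega
      · intro j _ hj; rw [hu'j j hj]; simp
      · simp
    have d2 : dist1 u' v < n := by
      rw [← huv]; unfold dist1
      refine Finset.sum_lt_sum (fun j _ => ?_) ⟨k, Finset.mem_univ _, ?_⟩
      · by_cases hj : j = k
        · subst hj; rw [hu'k]; rcases hε with ⟨_, e⟩ | ⟨_, e⟩ <;> omega
        · rw [hu'j j hj]
      · rw [hu'k]; rcases hε with ⟨_, e⟩ | ⟨_, e⟩ <;> omega
    have hin : ∀ j, min (u j) (v j) ≤ u' j ∧ u' j ≤ max (u j) (v j) := by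
      intro j
      by_cases hj : j = k
      · subst hj; rw [hu'k]; rcases hε with ⟨_, e⟩ | ⟨_, e⟩ <;> omega
      · rw [hu'j j hj]; omega
    have s1 : NC X u u' := NC.one d1 (hX u fun j => ⟨min_le_left _ _, le_max_left _ _⟩) (hX u' hin)
    refine Conn.trans s1 (ih _ d2 u' v rfl X fun x hx => hX x fun j => ?_)
    have h1 := hin j; have h2 := hx j
    omega

lemma nc_cb {q u v : V d} {r : ℤ} (hu : u ∈ cb q r) (hv : v ∈ cb q r) : NC (cb q r) u v := by
  refine nc_uIcc _ u v rfl _ fun x hx k => ?_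
  have h1 := abs_le.1 (hu k); have h2 := abs_le.1 (hv k); have h3 := hx k
  rw [abs_le]; omega

lemma geo (hd : 2 ≤ d) {q b u v : V d} {r s : ℤ} (hrs : s < r) (hu : u ∈ cb q r) (hub : u ∉ cb b s)
    (hv : v ∈ cb q r) (hvb : v ∉ cb b s) : NC (cb q r \ cb b s) u v := by
  let t : V d := fun i => if q i ≤ b i then q i - r else q i + r
  have ht : ∀ i, s < |t i - b i| := by
    intro i; simp only [t]; rw [lt_abs]; split_ifs <;> omega
  have key : ∀ u : V d, u ∈ cb q r → u ∉ cb b s → NC (cb q r \ cb b s) u t := by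
    intro u hu hub
    have hr : 0 ≤ r := le_trans (abs_nonneg _) (hu ⟨0, by omega⟩)
    have htq : ∀ i, |t i - q i| ≤ r := by
      intro i; simp only [t]; rw [abs_le]; split_ifs <;> omega
    simp only [mem_cb, not_forall, not_le] at hub
    obtain ⟨j, hj⟩ := hub
    let m : V d := Function.update t j (u j)
    have hmj : m j = u j := by simp [m]
    have hmi : ∀ i, i ≠ j → m i = t i := fun i hi => by simp [m, hi]
    have hbet : ∀ (a c : V d), (∀ i, |a i - q i| ≤ r) → (∀ i, |c i - q i| ≤ r) → ∀ x : V d,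
        (∀ k, min (a k) (c k) ≤ x k ∧ x k ≤ max (a k) (c k)) → x ∈ cb q r := by
      intro a c ha hc x hx k
      have h1 := abs_le.1 (ha k); have h2 := abs_le.1 (hc k); have h3 := hx k
      rw [abs_le]; omega
    have hmq : ∀ i, |m i - q i| ≤ r := by
      intro i
      by_cases hi : i = j
      · subst hi; rw [hmj]; exact hu i
      · rw [hmi i hi]; exact htq i
    have p1 : NC (cb q r \ cb b s) u m := by
      refine nc_uIcc _ u m rfl _ fun x hx => ⟨hbet u m hu hmq x hx, fun hb => ?_⟩
      have h1 := hx j; have h2 := hb j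
      rw [hmj] at h1
      have : x j = u j := by omega
      rw [this] at h2; omega
    have p2 : NC (cb q r \ cb b s) m t := by
      obtain ⟨i, hi⟩ : ∃ i : Fin d, i ≠ j := by
        by_cases h0 : j = ⟨0, by omega⟩
        · exact ⟨⟨1, by omega⟩, by rw [h0]; simp⟩
        · exact ⟨_, Ne.symm h0⟩
      refine nc_uIcc _ m t rfl _ fun x hx => ⟨hbet m t hmq htq x hx, fun hb => ?_⟩
      have h1 := hx i; have h2 := hb i
      rw [hmi i hi] at h1
      have : x i = t i := by omega
      rw [this] at h2; have := ht i; omega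
    exact Conn.trans p1 p2
  exact Conn.trans (key u hu hub) (Conn.symm (key v hv hvb))

/-- scaling -/
def sc (A : ℤ) (z : V d) : V d := fun k => A * z k

def Good (A s : ℤ) (gd : V d → Prop) : ℕ → V d → Prop
  | 0, z => gd z
  | k + 1, z => ∀ u ∈ cb (sc A z) (3 * A), ∀ v ∈ cb (sc A z) (3 * A),
      ¬ Good A s gd k u → ¬ Good A s gd k v → u ∈ cb v s

def cln (A s : ℤ) (gd : V d → Prop) (k : ℕ) (z u : V d) : Prop :=
  ∀ v ∈ cb (sc A z) (3 * A), ¬ Good A s gd k v → v ∉ cb u s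

def Acc (A s : ℤ) (gd : V d → Prop) : ℕ → V d → Set (V d)
  | 0, z => {z}
  | k + 1, z => {i | ∃ u ∈ cb (sc A z) (3 * A), cln A s gd k z u ∧ i ∈ Acc A s gd k u}

section
variable {A s : ℤ} {gd : V d → Prop}

lemma cln.good {k : ℕ} {z u : V d} (hs : 0 ≤ s) (h : cln A s gd k z u) (hu : u ∈ cb (sc A z) (3 * A)) :
    Good A s gd k u := by
  by_contra hc; exact h u hu hc (cb_self hs)

lemma Acc_good (hs : 0 ≤ s) : ∀ {k : ℕ} {z i : V d}, Good A s gd k z → i ∈ Acc A s gd k z → gd i := by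
  intro k
  induction k with
  | zero => intro z i hz hi; rw [Set.mem_singleton_iff.1 hi]; exact hz
  | succ k ih =>
    rintro z i hz ⟨u, hu, hc, hi⟩
    exact ih (hc.good hs hu) hi

lemma sc_sc (B : ℤ) (z : V d) : sc B (sc A z) = sc (B * A) z := by
  funext k; simp [sc, mul_assoc]

lemma sc_cb {B r : ℤ} (hB : 0 ≤ B) {x y : V d} (h : x ∈ cb y r) : sc B x ∈ cb (sc B y) (B * r) := by
  intro k
  simp only [sc]
  rw [← mul_sub, abs_mul, abs_of_nonneg hB]
  exact mul_le_mul_of_nonneg_left (h k) hB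

lemma Acc_cb (hA : 4 ≤ A) : ∀ {k : ℕ} {z i : V d}, i ∈ Acc A s gd k z →
    i ∈ cb (sc (A ^ k) z) (4 * A ^ k) := by
  intro k
  induction k with
  | zero => intro z i hi; rw [Set.mem_singleton_iff.1 hi]; intro j; simp [sc]
  | succ k ih =>
    rintro z i ⟨u, hu, hc, hi⟩
    have hB : 0 < A ^ k := by positivity
    have h1 := cb_trans (ih hi) (sc_cb hB.le hu)
    rw [sc_sc, ← pow_succ] at h1
    refine cb_mono h1 ?_
    rw [pow_succ]; nlinarith

lemma uncl2 {k : ℕ} {z u u' : V d} (hz : Good A s gd (k + 1) z) (hu : ¬ cln A s gd k z u)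
    (hu' : ¬ cln A s gd k z u') : u ∈ cb u' (3 * s) := by
  simp only [cln, not_forall, not_not] at hu hu'
  obtain ⟨v, hv, hvb, hvu⟩ := hu
  obtain ⟨v', hv', hvb', hvu'⟩ := hu'
  have := cb_trans (cb_trans (cb_symm hvu) (hz v hv v' hv' hvb hvb')) hvu'
  exact cb_mono this (by linarith)

/-- candidates -/
def cand (A G : ℤ) (z : V d) (t : ℤ) : V d := fun k => A * z k + t * G

lemma cand_far (hd : 2 ≤ d) {G : ℤ} {z : V d} {t t' : ℤ} {r : ℤ} (hG : r < G) (hG0 : 0 < G) (htt : t ≠ t') :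
    cand A G z t ∉ cb (cand A G z t') r := by
  intro h
  have := h ⟨0, by omega⟩
  simp only [cand] at this
  have e : A * z ⟨0, by omega⟩ + t * G - (A * z ⟨0, by omega⟩ + t' * G) = (t - t') * G := by ring
  rw [e, abs_mul, abs_of_pos hG0] at this
  have h1 : 1 ≤ |t - t'| := Int.one_le_abs (sub_ne_zero.2 htt)
  nlinarith

lemma cand_cb {G : ℤ} (hG0 : 0 < G) (hG : G ≤ A) {z : V d} {t : ℤ} (h0 : 0 ≤ t) (h2 : t ≤ 2) :
    cand A G z t ∈ cb (sc A z) (2 * A) := by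
  intro k
  simp only [cand, sc, add_sub_cancel_left]
  rw [abs_of_nonneg (by positivity)]
  nlinarith

lemma common (hd : 2 ≤ d) (hs : 0 ≤ s) (hA : 2 * (3 * s + 9) + 5 ≤ A) {k : ℕ} {z z' : V d} (hz : Good A s gd (k + 1) z)
    (hz' : Good A s gd (k + 1) z') (h : z ∈ cb z' 1) :
    ∃ u, u ∈ cb (sc A z) (3 * A) ∧ u ∈ cb (sc A z') (3 * A) ∧ cln A s gd k z u ∧ cln A s gd k z' u := by
  have hA0 : 0 ≤ A := by linarith
  let c := cand A (3 * s + 9) z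
  have hc : ∀ t, 0 ≤ t → t ≤ 2 → c t ∈ cb (sc A z) (3 * A) ∧ c t ∈ cb (sc A z') (3 * A) := by
    intro t h0 h2
    have h1 := cand_cb (A := A) (G := 3 * s + 9) (z := z) (by linarith) (by linarith) h0 h2
    refine ⟨cb_mono h1 (by linarith), cb_mono (cb_trans h1 (sc_cb hA0 h)) (by linarith)⟩
  have f1 : ∀ t t', t ≠ t' → cln A s gd k z (c t) ∨ cln A s gd k z (c t') := by
    intro t t' htt
    by_contra hn
    push Not at hn
    exact cand_far hd (r := 3 * s) (by linarith) (by linarith) htt (uncl2 hz hn.1 hn.2)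
  have f2 : ∀ t t', t ≠ t' → cln A s gd k z' (c t) ∨ cln A s gd k z' (c t') := by
    intro t t' htt
    by_contra hn
    push Not at hn
    exact cand_far hd (r := 3 * s) (by linarith) (by linarith) htt (uncl2 hz' hn.1 hn.2)
  have a01 := f1 0 1 (by norm_num); have a02 := f1 0 2 (by norm_num); have a12 := f1 1 2 (by norm_num)
  have b01 := f2 0 1 (by norm_num); have b02 := f2 0 2 (by norm_num); have b12 := f2 1 2 (by norm_num)
  have : ∃ t : ℤ, 0 ≤ t ∧ t ≤ 2 ∧ cln A s gd k z (c t) ∧ cln A s gd k z' (c t) := by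
    by_cases x0 : cln A s gd k z (c 0)
    · by_cases y0 : cln A s gd k z' (c 0)
      · exact ⟨0, by norm_num, by norm_num, x0, y0⟩
      · have y1 := b01.resolve_left y0
        have y2 := b02.resolve_left y0
        rcases a12 with x | x
        · exact ⟨1, by norm_num, by norm_num, x, y1⟩
        · exact ⟨2, by norm_num, by norm_num, x, y2⟩
    · have x1 := a01.resolve_left x0
      have x2 := a02.resolve_left x0
      rcases b12 with y | y
      · exact ⟨1, by norm_num, by norm_num, x1, y⟩
      · exact ⟨2, by norm_num, by norm_num, x2, y⟩
  obtain ⟨t, h0, h2, h3, h4⟩ := this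
  exact ⟨c t, (hc t h0 h2).1, (hc t h0 h2).2, h3, h4⟩

lemma Acc_nonempty (hd : 2 ≤ d) (hs : 0 ≤ s) (hA : 2 * (3 * s + 9) + 5 ≤ A) : ∀ {k : ℕ} {z : V d}, Good A s gd k z → (Acc A s gd k z).Nonempty := by
  intro k
  induction k with
  | zero => intro z _; exact ⟨z, rfl⟩
  | succ k ih =>
    intro z hz
    obtain ⟨u, hu, -, hc, -⟩ := common hd hs hA hz hz (cb_self (by norm_num))
    obtain ⟨i, hi⟩ := ih (hc.good hs hu)
    exact ⟨i, u, hu, hc, hi⟩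

lemma path_in_Q (hd : 2 ≤ d) (hs : 0 ≤ s) (hA : 2 * (3 * s + 9) + 5 ≤ A) {k : ℕ} {z u u' : V d}
    (hz : Good A s gd (k + 1) z) (hu : u ∈ cb (sc A z) (3 * A)) (hc : cln A s gd k z u)
    (hu' : u' ∈ cb (sc A z) (3 * A)) (hc' : cln A s gd k z u') :
    NC ({x | Good A s gd k x} ∩ cb (sc A z) (3 * A)) u u' := by
  by_cases hb : ∃ b ∈ cb (sc A z) (3 * A), ¬ Good A s gd k b
  · obtain ⟨b, hb, hbb⟩ := hb
    refine (geo hd (b := b) (s := s) (by linarith) hu (fun h => hc b hb hbb (cb_symm h)) hu'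
      (fun h => hc' b hb hbb (cb_symm h))).mono ?_
    rintro x ⟨hx, hxb⟩
    refine ⟨?_, hx⟩
    by_contra hn
    exact hxb (hz x hx b hb hn hbb)
  · push Not at hb
    exact (nc_cb hu hu').mono fun x hx => ⟨hb x hx, hx⟩

/-- the link property at level `k` -/
def Lk (A s : ℤ) (gd : V d → Prop) (k : ℕ) : Prop :=
  ∀ z z', Good A s gd k z → Good A s gd k z' → (z = z' ∨ dist1 z z' = 1) →
    ∀ i ∈ Acc A s gd k z, ∀ i' ∈ Acc A s gd k z',
      NC ({x | gd x} ∩ cb (sc (A ^ k) z) (5 * A ^ k)) i i'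

lemma chain (hd : 2 ≤ d) (hs : 0 ≤ s) (hA : 2 * (3 * s + 9) + 5 ≤ A) {k : ℕ} (hL : Lk A s gd k)
    {Y X : Set (V d)} {u u' : V d} (h : NC ({x | Good A s gd k x} ∩ Y) u u') (hu : Good A s gd k u)
    (huY : u ∈ Y) (hX : ∀ y ∈ Y, cb (sc (A ^ k) y) (5 * A ^ k) ⊆ X) :
    ∀ i ∈ Acc A s gd k u, ∀ i' ∈ Acc A s gd k u', NC ({x | gd x} ∩ X) i i' := by
  intro i hi
  unfold NC Conn at h
  induction h with
  | refl =>
    intro i' hi'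
    exact (hL u u hu hu (Or.inl rfl) i hi i' hi').mono (Set.inter_subset_inter_right _ (hX u huY))
  | tail h1 h2 ih =>
    intro i' hi'
    obtain ⟨⟨h3, -⟩, ⟨hb, hbY⟩, ⟨hc, hcY⟩⟩ := h2
    obtain ⟨j, hj⟩ := Acc_nonempty hd hs hA hb
    exact Conn.trans (ih j hj) ((hL _ _ hb hc (Or.inr h3) j hj i' hi').mono
      (Set.inter_subset_inter_right _ (hX _ hbY)))

lemma link (hd : 2 ≤ d) (hs : 0 ≤ s) (hA : 2 * (3 * s + 9) + 5 ≤ A) : ∀ k, Lk A s gd k := by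
  intro k
  induction k with
  | zero =>
    intro z z' hz hz' h i hi i' hi'
    rw [Set.mem_singleton_iff.1 hi, Set.mem_singleton_iff.1 hi']
    rcases h with rfl | h
    · exact Conn.refl _
    · refine NC.one h ⟨hz, fun k => by simp [sc]⟩ ⟨hz', fun k => ?_⟩
      have := cb_symm (cb_of_dist1 h.le) k
      simp only [sc, pow_zero, one_mul, mul_one]
      push_cast at this; linarith
  | succ k ih =>
    rintro z z' hz hz' h i ⟨u, hu, hc, hi⟩ i' ⟨u', hu', hc', hi'⟩
    have hzz : z' ∈ cb z 1 := by
      rcases h with rfl | h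
      · exact cb_self (by norm_num)
      · exact cb_symm (by exact_mod_cast cb_of_dist1 h.le)
    have hA1 : 0 < A := by linarith
    have hA0 : 0 ≤ A := by linarith
    have hB : 0 < A ^ k := by positivity
    obtain ⟨w, hw, hw', hcw, hcw'⟩ := common hd hs hA hz hz' (cb_symm hzz)
    have p1 := path_in_Q hd hs hA hz hu hc hw hcw
    have p2 := path_in_Q hd hs hA hz' hw' hcw' hu' hc'
    have s1 : cb (sc A z) (3 * A) ⊆ cb (sc A z) (4 * A) := fun x hx => cb_mono hx (by linarith)
    have s2 : cb (sc A z') (3 * A) ⊆ cb (sc A z) (4 * A) := fun x hx =>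
      cb_mono (cb_trans hx (sc_cb hA0 hzz)) (by linarith)
    have p : NC ({x | Good A s gd k x} ∩ cb (sc A z) (4 * A)) u u' :=
      Conn.trans (p1.mono (Set.inter_subset_inter_right _ s1))
        (p2.mono (Set.inter_subset_inter_right _ s2))
    refine chain hd hs hA ih p (hc.good hs hu) (s1 hu) (fun y hy x hx => ?_) i hi i' hi'
    have := cb_trans hx (sc_cb hB.le hy)
    rw [sc_sc, ← pow_succ] at this
    refine cb_mono this ?_
    rw [pow_succ]; nlinarith

lemma nest {k : ℕ} {z Z : V d} (hZ : z ∈ cb (sc A Z) (3 * A))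
    (h : ∀ u ∈ cb (sc A Z) (3 * A), Good A s gd k u) :
    Acc A s gd k z ⊆ Acc A s gd (k + 1) Z ∧ Good A s gd (k + 1) Z :=
  ⟨fun _ hi => ⟨z, hZ, fun v hv hvb => absurd (h v hv) hvb, hi⟩,
    fun u hu _ _ hub _ => absurd (h u hu) hub⟩

end

end

section
variable {d : ℕ}

/-- parent index (nearest multiple of the odd number `A`) -/
def par (A : ℤ) (z : V d) : V d := fun k => (z k + A / 2) / A

lemma par_spec {A : ℤ} (hA : 0 < A) (hodd : A % 2 = 1) (z : V d) (k : Fin d) :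
    2 * |z k - A * par A z k| ≤ A - 1 := by
  have h1 := Int.emod_add_mul_ediv (z k + A / 2) A
  have h2 := Int.emod_nonneg (z k + A / 2) hA.ne'
  have h3 := Int.emod_lt_of_pos (z k + A / 2) hA
  have e : z k - A * par A z k = (z k + A / 2) % A - A / 2 := by
    simp only [par]; linarith
  rw [e]
  have h4 : 2 * (A / 2) = A - 1 := by omega
  have : |(z k + A / 2) % A - A / 2| ≤ A / 2 := by rw [abs_le]; omega
  linarith

/-- level-`k` index -/
def tl (A : ℤ) : ℕ → V d → V d
  | 0, i => i
  | k + 1, i => par A (tl A k i)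

lemma tl_spec {A : ℤ} (hA : 0 < A) (hodd : A % 2 = 1) (n : ℕ) (i : V d) (k : Fin d) :
    2 * |i k - A ^ n * tl A n i k| ≤ A ^ n - 1 := by
  induction n with
  | zero => simp [tl]
  | succ n ih =>
    have h1 := par_spec hA hodd (tl A n i) k
    have hB : 0 < A ^ n := by positivity
    have e : i k - A ^ (n + 1) * tl A (n + 1) i k =
      (i k - A ^ n * tl A n i k) + A ^ n * (tl A n i k - A * par A (tl A n i) k) := by
      simp only [tl]; ring
    rw [e]
    have h2 := abs_add_le (i k - A ^ n * tl A n i k) (A ^ n * (tl A n i k - A * par A (tl A n i) k))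
    rw [abs_mul, abs_of_pos hB] at h2
    have h3 := mul_le_mul_of_nonneg_left h1 hB.le
    rw [pow_succ]; linarith

lemma tl_cb {A : ℤ} (hA : 0 < A) (hodd : A % 2 = 1) (n : ℕ) (i : V d) :
    i ∈ cb (sc (A ^ n) (tl A n i)) (A ^ n) := by
  intro k
  have := tl_spec hA hodd n i k
  have h2 := abs_nonneg (i k - A ^ n * tl A n i k)
  simp only [sc]; linarith

lemma mul_abs_lt {B x m : ℤ} (hB : 0 < B) (h : B * |x| < B * (m + 1)) : |x| ≤ m := by
  have := lt_of_mul_lt_mul_left h hB.le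
  omega

/-- if the indices are `r`-close then level-`n` indices are close -/
lemma tl_close {A : ℤ} (hA : 0 < A) (hodd : A % 2 = 1) (n : ℕ) {i j : V d} {r m : ℤ}
    (h : i ∈ cb j r) (hr : r ≤ A ^ n * m) : tl A n i ∈ cb (tl A n j) m := by
  intro k
  have h1 := tl_spec hA hodd n i k
  have h2 := tl_spec hA hodd n j k
  have h3 := h k
  have hB : 0 < A ^ n := by positivity
  refine mul_abs_lt hB ?_
  rw [← abs_of_pos hB, ← abs_mul, abs_of_pos hB]
  have e : A ^ n * (tl A n i k - tl A n j k) =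
    -(i k - A ^ n * tl A n i k) + (j k - A ^ n * tl A n j k) + (i k - j k) := by ring
  rw [e]
  have h4 := abs_add_le (-(i k - A ^ n * tl A n i k) + (j k - A ^ n * tl A n j k)) (i k - j k)
  have h5 := abs_add_le (-(i k - A ^ n * tl A n i k)) (j k - A ^ n * tl A n j k)
  rw [abs_neg] at h5
  linarith

/-- converse: closeness to the level-`n` centre -/
lemma tl_close' {A : ℤ} (hA : 0 < A) (hodd : A % 2 = 1) (n : ℕ) {i z : V d} {m : ℤ}
    (h : i ∈ cb (sc (A ^ n) z) (A ^ n * m)) : tl A n i ∈ cb z m := by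
  intro k
  have h1 := tl_spec hA hodd n i k
  have h3 := h k
  have hB : 0 < A ^ n := by positivity
  refine mul_abs_lt hB ?_
  rw [← abs_of_pos hB, ← abs_mul, abs_of_pos hB]
  have e : A ^ n * (tl A n i k - z k) =
    -(i k - A ^ n * tl A n i k) + (i k - sc (A ^ n) z k) := by simp only [sc]; ring
  rw [e]
  have h4 := abs_add_le (-(i k - A ^ n * tl A n i k)) (i k - sc (A ^ n) z k)
  rw [abs_neg] at h4
  linarith

lemma tl_sc {A : ℤ} (hA : 0 < A) (hodd : A % 2 = 1) (n : ℕ) (z : V d) : tl A n (sc (A ^ n) z) = z := by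
  have := tl_close' hA hodd n (i := sc (A ^ n) z) (z := z) (m := 0) (by intro k; simp)
  funext k
  have := this k
  have := abs_nonpos_iff.1 this
  omega

lemma tl_near {A : ℤ} (hA : 0 < A) (hodd : A % 2 = 1) (n : ℕ) {i z : V d} {m : ℤ}
    (h : tl A n i ∈ cb z m) : i ∈ cb (sc (A ^ n) z) (A ^ n * (m + 1)) := by
  have hB : 0 < A ^ n := by positivity
  exact cb_mono (cb_trans (tl_cb hA hodd n i) (sc_cb hB.le h)) (by linarith)

section
variable {A s : ℤ} {gd : V d → Prop}

lemma crossing (hd : 2 ≤ d) (hs : 0 ≤ s) (hA : 2 * (3 * s + 9) + 5 ≤ A) (hodd : A % 2 = 1) :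
    ∀ (k : ℕ) (f : ℕ → V d) (z : V d) (t0 t1 : ℕ), Good A s gd k z → t0 ≤ t1 →
      (∀ t, t0 ≤ t → t < t1 → f (t + 1) ∈ cb (f t) 1) →
      tl A k (f t0) = z → f t1 ∉ cb (sc (A ^ k) z) (2 * A ^ k) →
      ∃ T : Finset (V d), 2 ^ k ≤ T.card ∧ (∀ i ∈ T, i ∈ Acc A s gd k z) ∧
        ∀ i ∈ T, ∃ t, t0 ≤ t ∧ t ≤ t1 ∧ f t = i := by
  classical
  have hA0 : 0 < A := by linarith
  intro k
  induction k with
  | zero =>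
    intro f z t0 t1 hz h01 hstep hz0 hf
    exact ⟨{z}, by simp, by simp [Acc], fun i hi => ⟨t0, le_rfl, h01, by
      rw [Finset.mem_singleton.1 hi]; exact hz0⟩⟩
  | succ k ih =>
    intro f z t0 t1 hz h01 hstep hz0 hf
    have hB : 0 < A ^ k := by positivity
    let F : ℕ → V d := fun t => tl A k (f t)
    have hFstep : ∀ t, t0 ≤ t → t < t1 → F (t + 1) ∈ cb (F t) 1 := fun t h1 h2 =>
      tl_close hA0 hodd k (hstep t h1 h2) (by linarith [Int.add_one_le_iff.2 hB])
    have hF0 : F t0 ∈ cb (sc A z) (A - 1) := by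
      intro j
      have := par_spec hA0 hodd (F t0) j
      have e : par A (F t0) = z := hz0
      rw [e] at this
      simp only [sc]
      have h2 := abs_nonneg (F t0 j - A * z j)
      linarith
    have hF1 : F t1 ∉ cb (sc A z) (2 * A - 1) := by
      intro h
      refine hf ?_
      have := tl_near hA0 hodd k h
      rw [sc_sc, ← pow_succ] at this
      exact cb_mono this (by rw [pow_succ]; linarith)
    -- first exit points
    have ex : ∀ ρ : ℤ, A ≤ ρ → ρ ≤ 2 * A - 5 → ∃ t, t0 ≤ t ∧ t ≤ t1 ∧ F t ∈ cb (sc A z) ρ ∧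
        F t ∉ cb (sc A z) (ρ - 1) := by
      intro ρ h1 h2
      have hex : ∃ t, t0 ≤ t ∧ F t ∉ cb (sc A z) (ρ - 1) :=
        ⟨t1, h01, fun h => hF1 (cb_mono h (by linarith))⟩
      obtain ⟨a1, a2⟩ := Nat.find_spec hex
      have a3 : Nat.find hex ≤ t1 := Nat.find_min' hex ⟨h01, fun h => hF1 (cb_mono h (by linarith))⟩
      refine ⟨Nat.find hex, a1, a3, ?_, a2⟩
      have a4 : t0 < Nat.find hex := by
        refine lt_of_le_of_ne a1 fun h => a2 ?_
        rw [← h]; exact cb_mono hF0 (by linarith)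
      obtain ⟨m, hm⟩ : ∃ m, Nat.find hex = m + 1 := ⟨Nat.find hex - 1, by omega⟩
      rw [hm]
      have a5 : F m ∈ cb (sc A z) (ρ - 1) := by
        by_contra h
        exact Nat.find_min hex (m := m) (by omega) ⟨by omega, h⟩
      exact cb_mono (cb_trans (hFstep m (by omega) (by omega)) a5) (by linarith)
    have sub : ∀ t, t0 ≤ t → t ≤ t1 → F t ∈ cb (sc A z) (2 * A - 5) → cln A s gd k z (F t) →
        ∃ T : Finset (V d), 2 ^ k ≤ T.card ∧ (∀ i ∈ T, i ∈ Acc A s gd k (F t)) ∧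
        ∀ i ∈ T, ∃ t, t0 ≤ t ∧ t ≤ t1 ∧ f t = i := by
      intro t h0 h1 h2 h3
      have h2' : F t ∈ cb (sc A z) (3 * A) := cb_mono h2 (by linarith)
      obtain ⟨T, c1, c2, c3⟩ := ih f (F t) t t1 (h3.good hs h2') h1
        (fun t' h h' => hstep t' (h0.trans h) h') rfl (by
          intro h
          have := tl_close' hA0 hodd k (m := 2) (by rwa [mul_comm] at h)
          exact hF1 (cb_mono (cb_trans this h2) (by linarith)))
      exact ⟨T, c1, c2, fun i hi => by
        obtain ⟨t', x, y, w⟩ := c3 i hi; exact ⟨t', h0.trans x, y, w⟩⟩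
    -- two clean points at distance `> 8`
    have two : ∃ t t', (t0 ≤ t ∧ t ≤ t1) ∧ (t0 ≤ t' ∧ t' ≤ t1) ∧ F t ∈ cb (sc A z) (2 * A - 5) ∧
        F t' ∈ cb (sc A z) (2 * A - 5) ∧ cln A s gd k z (F t) ∧ cln A s gd k z (F t') ∧
        F t' ∉ cb (F t) 8 := by
      obtain ⟨t, a1, a2, a3, a4⟩ := ex A le_rfl (by linarith)
      obtain ⟨u, b1, b2, b3, b4⟩ := ex (A + (3 * s + 9)) (by linarith) (by linarith)
      obtain ⟨v, c1, c2, c3, c4⟩ := ex (A + 2 * (3 * s + 9)) (by linarith) (by linarith)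
      have d1 : F u ∉ cb (F t) (3 * s + 8) := fun h => b4 (cb_mono (cb_trans h a3) (by linarith))
      have d2 : F v ∉ cb (F t) (3 * s + 8) := fun h => c4 (cb_mono (cb_trans h a3) (by linarith))
      have d3 : F v ∉ cb (F u) (3 * s + 8) := fun h => c4 (cb_mono (cb_trans h b3) (by linarith))
      have e1 : F t ∈ cb (sc A z) (2 * A - 5) := cb_mono a3 (by linarith)
      have e2 : F u ∈ cb (sc A z) (2 * A - 5) := cb_mono b3 (by linarith)
      have e3 : F v ∈ cb (sc A z) (2 * A - 5) := cb_mono c3 (by linarith)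
      by_cases x : cln A s gd k z (F t)
      · by_cases y : cln A s gd k z (F u)
        · exact ⟨t, u, ⟨a1, a2⟩, ⟨b1, b2⟩, e1, e2, x, y, fun h => d1 (cb_mono h (by linarith))⟩
        · by_cases w : cln A s gd k z (F v)
          · exact ⟨t, v, ⟨a1, a2⟩, ⟨c1, c2⟩, e1, e3, x, w, fun h => d2 (cb_mono h (by linarith))⟩
          · exact absurd (cb_mono (uncl2 hz w y) (by linarith)) d3
      · by_cases y : cln A s gd k z (F u)
        · by_cases w : cln A s gd k z (F v)
          · exact ⟨u, v, ⟨b1, b2⟩, ⟨c1, c2⟩, e2, e3, y, w, fun h => d3 (cb_mono h (by linarith))⟩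
          · exact absurd (cb_mono (uncl2 hz w x) (by linarith)) d2
        · exact absurd (cb_mono (uncl2 hz y x) (by linarith)) d1
    obtain ⟨t, t', ht, ht', m1, m2, n1, n2, far⟩ := two
    obtain ⟨T, p1, p2, p3⟩ := sub t ht.1 ht.2 m1 n1
    obtain ⟨T', p1', p2', p3'⟩ := sub t' ht'.1 ht'.2 m2 n2
    have disj : Disjoint T T' := by
      rw [Finset.disjoint_left]
      intro i hi hi'
      have h1 := Acc_cb (by linarith) (p2 i hi)
      have h2 := Acc_cb (by linarith) (p2' i hi')
      have h3 := cb_trans (cb_symm h2) h1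
      refine far ?_
      have := tl_close' hA0 hodd k (i := sc (A ^ k) (F t')) (z := F t) (m := 8)
        (cb_mono h3 (by linarith))
      rwa [tl_sc hA0 hodd] at this
    refine ⟨T ∪ T', ?_, ?_, ?_⟩
    · rw [Finset.card_union_of_disjoint disj, pow_succ]; omega
    · intro i hi
      rcases Finset.mem_union.1 hi with h | h
      · exact ⟨_, cb_mono m1 (by linarith), n1, p2 i h⟩
      · exact ⟨_, cb_mono m2 (by linarith), n2, p2' i h⟩
    · intro i hi
      rcases Finset.mem_union.1 hi with h | h
      · exact p3 i h
      · exact p3' i h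

lemma Acc_card (hd : 2 ≤ d) (hs : 0 ≤ s) (hA : 2 * (3 * s + 9) + 5 ≤ A) (hodd : A % 2 = 1)
    {k : ℕ} {z : V d} (hz : Good A s gd k z) :
    ∃ T : Finset (V d), 2 ^ k ≤ T.card ∧ (∀ i ∈ T, i ∈ Acc A s gd k z) := by
  have hA0 : 0 < A := by linarith
  have hB : 0 < A ^ k := by positivity
  obtain ⟨T, h1, h2, -⟩ := crossing hd hs hA hodd k (fun t j => A ^ k * z j + t) z 0
    (2 * A ^ k + 1).toNat hz (Nat.zero_le _) (fun t _ _ j => by push_cast; simp)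
    (by convert tl_sc hA0 hodd k z using 2; simp; rfl) (by
      intro h
      have := h ⟨0, by omega⟩
      simp only [sc, add_sub_cancel_left] at this
      rw [Int.toNat_of_nonneg (by positivity), abs_of_pos (by positivity)] at this
      linarith)
  exact ⟨T, h1, h2⟩

end

end

section
variable {d : ℕ}

/-- `v` is connected to sup-distance `M` -/
def IM (a : Config d) (M : ℕ) (v : V d) : Prop :=
  ∃ y, y ∉ cb v ((M : ℤ) - 1) ∧ Conn a (cb v M) v y

def SS (a : Config d) (M R : ℕ) (i : V d) : Set (V d) := {v | v ∈ cb (sc M i) R ∧ IM a M v}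

def gdB (M R c : ℕ) (a : Config d) (i : V d) : Prop :=
  (SS a M R i).Nonempty ∧ ∀ i' ∈ cb i 1, ∀ v ∈ SS a M R i, ∀ v' ∈ SS a M R i',
    Conn a (cb (sc M i) ((c : ℤ) * M)) v v'

lemma IM_of_inf {a : Config d} {v : V d} (h : InInfiniteCluster a v) (M : ℕ) : IM a M v := by
  obtain ⟨y, hy, hyM⟩ := inf_iff.1 h M
  obtain ⟨n, f, hf, h0, hn, -⟩ := exists_path hy
  classical
  have hex : ∃ t, f t ∉ cb v ((M : ℤ) - 1) := ⟨n, fun h => hyM (by rw [hn] at h; exact cb_mono h (by linarith))⟩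
  have hle : Nat.find hex ≤ n := Nat.find_min' hex fun h => hyM (by rw [hn] at h; exact cb_mono h (by linarith))
  refine ⟨f (Nat.find hex), Nat.find_spec hex, ?_⟩
  suffices hh : Conn a (cb v M) (f 0) (f (Nat.find hex)) by rwa [h0] at hh
  refine conn_of_path (fun i hi => hf i (by omega)) fun i hi => ?_
  rcases hi.lt_or_eq with h | h
  · exact cb_mono (not_not.1 (Nat.find_min hex h)) (by linarith)
  · rcases Nat.eq_zero_or_pos i with h' | h'
    · rw [h', h0]; exact cb_self (by positivity)
    · obtain ⟨m, rfl⟩ : ∃ m, i = m + 1 := ⟨i - 1, by omega⟩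
      have h1 := not_not.1 (Nat.find_min hex (m := m) (by omega))
      exact cb_mono (cb_trans (edgeOpen_cb (hf m (by omega))) h1) (by linarith)

lemma IM_congr {a a' : Config d} {M : ℕ} {v : V d} (h : ∀ e ∈ EdgesIn (cb v M), a e = a' e)
    (hI : IM a M v) : IM a' M v := by
  obtain ⟨y, h1, h2⟩ := hI
  exact ⟨y, h1, h2.congr_le fun e he => (h e he).le⟩

lemma sc_near {M : ℕ} {i i' : V d} {r : ℤ} (h : i' ∈ cb i r) : sc M i' ∈ cb (sc M i) (M * r) :=
  sc_cb (by positivity) h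

lemma SS_congr {M R c : ℕ} (hc : 3 ≤ c) (hR : R ≤ M) {i : V d} {a a' : Config d}
    (h : ∀ e ∈ EdgesIn (cb (sc M i) ((c : ℤ) * M)), a e = a' e) {i' : V d} (hi : i' ∈ cb i 1) :
    SS a M R i' ⊆ SS a' M R i' := by
  rintro v ⟨h1, h2⟩
  refine ⟨h1, IM_congr (fun e he => h e (EdgesIn_mono (fun x hx => ?_) he)) h2⟩
  refine cb_mono (cb_trans (cb_trans hx h1) (sc_near hi)) ?_
  have : (R : ℤ) ≤ M := by exact_mod_cast hR
  have : (3 : ℤ) ≤ c := by exact_mod_cast hc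
  nlinarith

lemma gdB_congr {M R c : ℕ} (hc : 3 ≤ c) (hR : R ≤ M) {i : V d} {a a' : Config d}
    (h : ∀ e ∈ EdgesIn (cb (sc M i) ((c : ℤ) * M)), a e = a' e) (hg : gdB M R c a i) :
    gdB M R c a' i := by
  have h' : ∀ e ∈ EdgesIn (cb (sc M i) ((c : ℤ) * M)), a' e = a e := fun e he => (h e he).symm
  refine ⟨hg.1.mono (SS_congr hc hR h (cb_self (by norm_num))), fun i' hi v hv v' hv' => ?_⟩
  exact (hg.2 i' hi v (SS_congr hc hR h' (cb_self (by norm_num)) hv) v'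
    (SS_congr hc hR h' hi hv')).congr_le fun e he => (h e he).le

lemma loc_IM (M : ℕ) (v : V d) : Loc (EdgesIn (cb v M)) {a : Config d | IM a M v} :=
  fun _ _ h hI => IM_congr h hI

lemma meas_IM (M : ℕ) (v : V d) : MeasurableSet {a : Config d | IM a M v} :=
  (loc_IM M v).measurable (EdgesIn_finite (cb_finite _ _))

lemma meas_gdB {M R c : ℕ} (hc : 3 ≤ c) (hR : R ≤ M) (i : V d) :
    MeasurableSet {a : Config d | gdB M R c a i} :=
  Loc.measurable (s := EdgesIn (cb (sc M i) ((c : ℤ) * M))) (fun _ _ h hI => gdB_congr hc hR h hI)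
    (EdgesIn_finite (cb_finite _ _))

lemma mem_cb_add {x y c : V d} {r : ℤ} : x + y ∈ cb (c + y) r ↔ x ∈ cb c r := by
  simp [mem_cb]

lemma IM_shift (y : V d) (a : Config d) (M : ℕ) (v : V d) : IM (shift y a) M v ↔ IM a M (v + y) := by
  constructor
  · rintro ⟨x, h1, h2⟩
    exact ⟨x + y, by rwa [mem_cb_add], (conn_shift _ _ _ _ _ _).1 h2⟩
  · rintro ⟨x, h1, h2⟩
    have e : x = (x - y) + y := by abel
    rw [e] at h1 h2
    exact ⟨x - y, by rwa [mem_cb_add] at h1, (conn_shift _ _ _ _ _ _).2 h2⟩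

lemma gdB_shift {M R c : ℕ} {i : V d} {a : Config d} (h : gdB M R c (shift (sc M i) a) 0) :
    gdB M R c a i := by
  have e0 : ∀ j : V d, sc (M : ℤ) j = sc M (j - i) + sc M i := by
    intro j; funext k; simp [sc]; ring
  have hS : ∀ j v, v ∈ SS (shift (sc M i) a) M R (j - i) ↔ v + sc M i ∈ SS a M R j := by
    intro j v
    simp only [SS, Set.mem_ofPred_eq, IM_shift]
    rw [e0 j, mem_cb_add]
  have hS' : ∀ j v, v ∈ SS a M R j → v - sc M i ∈ SS (shift (sc M i) a) M R (j - i) := by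
    intro j v hv
    rw [hS, sub_add_cancel]; exact hv
  refine ⟨?_, fun i' hi' v hv v' hv' => ?_⟩
  · obtain ⟨v, hv⟩ := h.1
    rw [← sub_self i, hS] at hv
    exact ⟨_, hv⟩
  · have h1 := hS' i v hv
    rw [sub_self] at h1
    have := h.2 (i' - i) (by intro k; have := hi' k; simpa using this) _ h1 _ (hS' i' v' hv')
    rw [conn_shift, sub_add_cancel, sub_add_cancel] at this
    have e : sc (M : ℤ) (0 : V d) + sc M i = sc M i := by funext k; simp [sc]
    rwa [e] at this

lemma sc_nat (n : ℕ) (x : V d) : sc (n : ℤ) x = n • x := by funext k; simp [sc]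

lemma base (hd : 2 ≤ d) {p : unitInterval} {t : V d → ℝ} (H : TC p t) (c0 : ℕ)
    (hc0 : ∀ x ∈ cb (0 : V d) 1, t x < c0) {η : ℝ≥0∞} (hη : 0 < η) :
    ∃ R h : ℕ, R ≤ h ∧ 1 ≤ h ∧ ∀ i, PM (fun _ : Edge d => p) {a | ¬ gdB (2 * h + 1) R (c0 + 2) a i} ≤ η := by
  classical
  have hd1 : 1 ≤ d := by omega
  let n3 : ℕ := (cbF (0 : V d) 1).card
  let δ : ℝ≥0∞ := η / (3 + n3 * 3 : ℕ)
  have hδ : 0 < δ := ENNReal.div_pos hη.ne' (ENNReal.natCast_ne_top _)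
  have hc1 : 1 ≤ c0 := by
    have := (H.nonneg 0).trans_lt (hc0 0 (cb_self (by norm_num)))
    exact_mod_cast this
  obtain ⟨R, hR⟩ := tight1 hd1 H hδ
  have hup : ∀ x : V d, ∃ ρ n0 : ℕ, x ∈ cb (0 : V d) 1 → ∀ n ≥ n0,
      PM (fun _ : Edge d => p) (Pair (n • x) ρ (ENNReal.ofReal (c0 * n)))ᶜ ≤ δ := by
    intro x
    by_cases hx : x ∈ cb (0 : V d) 1
    · obtain ⟨ρ, n0, h⟩ := up hd1 H x (hc0 x hx) hδ
      exact ⟨ρ, n0, fun _ => h⟩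
    · exact ⟨0, 0, fun h => absurd h hx⟩
  choose ρ0 n0 hup using hup
  let ρ1 := (cbF (0 : V d) 1).sup ρ0
  let n1 := (cbF (0 : V d) 1).sup n0
  obtain ⟨ρ, hρR, hρ⟩ := tight2 H (max R ρ1) hδ
  have hev : ∀ᵐ ω ∂(PM (fun _ : Edge d => p)), ∀ᶠ n : ℕ in atTop,
      ω ∈ {ω : Config d | ∀ v ∈ cb (0 : V d) R, IM ω n v → InInfiniteCluster ω v} := by
    refine Eventually.of_forall fun ω => ?_
    refine (Filter.eventually_all_finite (cb_finite (0 : V d) R)).2 fun v hv => ?_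
    by_cases hi : InInfiniteCluster ω v
    · exact Eventually.of_forall fun _ _ => hi
    rw [inf_iff] at hi
    push Not at hi
    obtain ⟨r, hr⟩ := hi
    filter_upwards [eventually_gt_atTop r] with n hn
    rintro ⟨y, h1, h2⟩
    exact absurd (cb_mono (hr y h2.connected) (by omega)) h1
  obtain ⟨n2, hn2⟩ := ev hev hδ
  let h : ℕ := max (max R ρ) (max n1 n2) + 1
  have hRh : R ≤ h := le_trans (le_trans (le_max_left _ _) (le_max_left _ _)) (Nat.le_succ _)
  have hρh : ρ ≤ h := le_trans (le_trans (le_max_right _ _) (le_max_left _ _)) (Nat.le_succ _)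
  have hn1h : n1 ≤ h := le_trans (le_trans (le_max_left _ _) (le_max_right _ _)) (Nat.le_succ _)
  have hn2h : n2 ≤ h := le_trans (le_trans (le_max_right _ _) (le_max_right _ _)) (Nat.le_succ _)
  refine ⟨R, h, hRh, Nat.le_add_left _ _, fun i => ?_⟩
  set M : ℕ := 2 * h + 1 with hM
  have hRM : R ≤ M := by omega
  have hm := meas_gdB (d := d) (M := M) (R := R) (c := c0 + 2) (by omega) hRM 0
  have h1 : PM (fun _ : Edge d => p) {a | ¬ gdB M R (c0 + 2) a i} ≤
      PM (fun _ : Edge d => p) {a | ¬ gdB M R (c0 + 2) a 0} := by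
    rw [← (shift_mp p (sc M i)).measure_preimage (s := {a | ¬ gdB M R (c0 + 2) a 0})
      hm.compl.nullMeasurableSet]
    exact measure_mono fun a ha hc => ha (gdB_shift hc)
  refine h1.trans ?_
  let E2 : Set (Config d) := {ω : Config d | ∀ v ∈ cb (0 : V d) R, IM ω M v → InInfiniteCluster ω v}
  have hE2m : MeasurableSet E2 := by
    have : E2 = ⋂ v ∈ cb (0 : V d) R, ({ω | IM ω M v}ᶜ ∪ {ω | InInfiniteCluster ω v}) := by
      ext ω
      simp only [E2, Set.mem_ofPred_eq, Set.mem_iInter, Set.mem_union, Set.mem_compl_iff]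
      exact forall₂_congr fun v _ => imp_iff_not_or
    rw [this]
    exact MeasurableSet.biInter (Set.to_countable _) fun v _ => (meas_IM _ _).compl.union (meas_inf v)
  have hE2 : PM (fun _ : Edge d => p) E2ᶜ ≤ δ := by
    have := hn2 M (by omega) E2 ∅ hE2m (by simp [E2])
    simpa using this
  let E1 : Set (Config d) := {ω | ∀ v ∈ cb (0 : V d) R, ¬ InInfiniteCluster ω v}
  let T2 : V d → Set (Config d) := fun y => {ω | ∃ v ∈ cb y (max R ρ1 : ℕ), ∃ v' ∈ cb y (max R ρ1 : ℕ),
      InInfiniteCluster ω v ∧ InInfiniteCluster ω v' ∧ ¬ Conn ω (cb y ρ) v v'}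
  let PC : V d → Set (Config d) := fun x => (Pair (M • x) (ρ0 x) (ENNReal.ofReal (c0 * M)))ᶜ
  let E3 : V d → Set (Config d) := fun x => {ω | ∃ v ∈ cb (M • x) R, IM ω M v ∧ ¬ InInfiniteCluster ω v}
  have hE3 : ∀ x, PM (fun _ : Edge d => p) (E3 x) ≤ δ := by
    intro x
    refine le_trans ?_ hE2
    rw [← (shift_mp p (M • x)).measure_preimage (s := E2ᶜ) hE2m.compl.nullMeasurableSet]
    refine measure_mono ?_
    rintro a ⟨v, h1, h2, h3⟩ hc
    have hc' : ∀ v ∈ cb (0 : V d) R, IM (shift (M • x) a) M v → InInfiniteCluster (shift (M • x) a) v := hc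
    have h4 := hc' (v - M • x) (by rw [← mem_cb_add (y := M • x), sub_add_cancel, zero_add]; exact h1)
    rw [IM_shift, inf_shift, sub_add_cancel] at h4
    exact h3 (h4 h2)
  have cover : {a | ¬ gdB M R (c0 + 2) a 0} ⊆ (E1 ∪ E2ᶜ ∪ T2 0) ∪
      ⋃ x ∈ cbF (0 : V d) 1, (PC x ∪ (T2 (M • x) ∪ E3 x)) := by
    intro a ha
    by_contra hcon
    apply ha
    rw [Set.mem_union, not_or] at hcon
    obtain ⟨hA, hB⟩ := hcon
    rw [Set.mem_union, Set.mem_union, not_or, not_or] at hA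
    obtain ⟨⟨hE1, hE2'⟩, hT0⟩ := hA
    have hE2' : ∀ v ∈ cb (0 : V d) R, IM a M v → InInfiniteCluster a v := not_not.1 hE2'
    have hz : sc (M : ℤ) (0 : V d) = 0 := by funext k; simp [sc]
    have hT : ∀ y, a ∉ T2 y → ∀ v ∈ cb y (max R ρ1 : ℕ), ∀ v' ∈ cb y (max R ρ1 : ℕ),
      InInfiniteCluster a v → InInfiniteCluster a v' → Conn a (cb y ρ) v v' := by
      intro y hy v hv v' hv' h1 h2
      by_contra h3
      exact hy ⟨v, hv, v', hv', h1, h2, h3⟩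
    refine ⟨?_, ?_⟩
    · have : ¬ ∀ v ∈ cb (0 : V d) R, ¬ InInfiniteCluster a v := hE1
      push Not at this
      obtain ⟨v, h1, h2⟩ := this
      exact ⟨v, by rw [hz]; exact h1, IM_of_inf h2 M⟩
    · intro x hx v hv v' hv'
      have hxF : x ∈ cbF (0 : V d) 1 := mem_cbF.2 hx
      have hx3 : a ∉ PC x ∪ (T2 (M • x) ∪ E3 x) := fun h =>
        hB (Set.mem_biUnion (t := fun x => PC x ∪ (T2 (M • x) ∪ E3 x)) hxF h)
      rw [Set.mem_union, Set.mem_union, not_or, not_or] at hx3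
      obtain ⟨hP, hTx, hE3x⟩ := hx3
      obtain ⟨u, hu, u', hu', hui, hui', hD⟩ := not_not.1 hP
      have hvi : InInfiniteCluster a v := hE2' v (by rw [← hz]; exact hv.1) hv.2
      have hv1 : v' ∈ cb (M • x) R := by rw [← sc_nat]; exact hv'.1
      have hvi' : InInfiniteCluster a v' := by
        by_contra h
        exact hE3x ⟨v', hv1, hv'.2, h⟩
      have hρx : ρ0 x ≤ ρ1 := Finset.le_sup (f := ρ0) hxF
      have e1 : ((max R ρ1 : ℕ) : ℤ) ≤ ρ := by exact_mod_cast hρR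
      have e2 : (ρ : ℤ) ≤ h := by exact_mod_cast hρh
      have e3 : (R : ℤ) ≤ (max R ρ1 : ℕ) := by exact_mod_cast le_max_left _ _
      have e4 : (ρ0 x : ℤ) ≤ (max R ρ1 : ℕ) := by exact_mod_cast hρx.trans (le_max_right _ _)
      have c1 := hT 0 hT0 v (cb_mono (by rw [← hz]; exact hv.1) e3) u (cb_mono hu e4) hvi hui
      have c3 := hT _ hTx u' (cb_mono hu' e4) v' (cb_mono hv1 e3) hui' hvi'
      have hD' : chemDist a u u' ≤ ((c0 * M : ℕ) : ℝ≥0∞) := by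
        refine hD.trans (le_of_eq ?_)
        rw [← ENNReal.ofReal_natCast]; push_cast; rfl
      have c2 := conn_cb_of_chemDist hD'
      have eM : (M : ℤ) = 2 * h + 1 := by rw [hM]; push_cast; ring
      have ec : (1 : ℤ) ≤ c0 := by exact_mod_cast hc1
      rw [hz]
      refine ((c1.mono le_rfl ?_).trans (c2.mono le_rfl ?_)).trans (c3.mono le_rfl ?_)
      · intro y hy
        refine cb_mono hy ?_
        push_cast; nlinarith
      · intro y hy
        refine cb_mono (cb_trans hy hu) ?_
        push_cast; nlinarith
      · intro y hy
        have hMx : M • x ∈ cb (0 : V d) (M * 1) := by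
          have := sc_near (M := M) hx
          rwa [hz, sc_nat] at this
        refine cb_mono (cb_trans hy hMx) ?_
        push_cast; nlinarith
  refine (measure_mono cover).trans ?_
  have hPC : ∀ x ∈ cbF (0 : V d) 1, PM (fun _ : Edge d => p) (PC x) ≤ δ := fun x hx =>
    hup x (mem_cbF.1 hx) M (by have : n0 x ≤ n1 := Finset.le_sup (f := n0) hx
                               omega)
  calc _ ≤ PM (fun _ : Edge d => p) (E1 ∪ E2ᶜ ∪ T2 0) + PM (fun _ : Edge d => p)
        (⋃ x ∈ cbF (0 : V d) 1, (PC x ∪ (T2 (M • x) ∪ E3 x))) := measure_union_le _ _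
    _ ≤ (δ + δ + δ) + ∑ x ∈ cbF (0 : V d) 1, (δ + (δ + δ)) := by
      refine add_le_add ?_ ?_
      · refine (measure_union_le _ _).trans (add_le_add ((measure_union_le _ _).trans
          (add_le_add (hR 0) hE2)) (hρ 0))
      · refine (measure_biUnion_finset_le _ _).trans (Finset.sum_le_sum fun x hx => ?_)
        refine (measure_union_le _ _).trans (add_le_add (hPC x hx) ((measure_union_le _ _).trans
          (add_le_add (hρ _) (hE3 x))))
    _ = δ * (3 + n3 * 3 : ℕ) := by
      rw [Finset.sum_const, nsmul_eq_mul]; push_cast; ring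
    _ ≤ η := (mul_comm _ _).trans_le ENNReal.mul_div_le

end

section
variable {d : ℕ}

/-- parameters of the renormalisation -/
structure Pr (d : ℕ) where
  h : ℕ
  R : ℕ
  c : ℕ
  A : ℕ
  hd : 2 ≤ d
  hh : 1 ≤ h
  hR : R ≤ h
  hc : 3 ≤ c
  hA : 2 * (3 * (2 * (4 + c)) + 9) + 5 ≤ A
  hodd : A % 2 = 1

namespace Pr
variable (P : Pr d)

def M : ℕ := 2 * P.h + 1
def s : ℤ := 2 * (4 + P.c)
def Gd (a : Config d) (k : ℕ) (z : V d) : Prop := Good P.A P.s (gdB P.M P.R P.c a) k z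
def Ac (a : Config d) (k : ℕ) (z : V d) : Set (V d) := Acc P.A P.s (gdB P.M P.R P.c a) k z
def idx (w : V d) : V d := par P.M w
def z (k : ℕ) (w : V d) : V d := tl P.A k (P.idx w)
def U (k : ℕ) : ℤ := P.M * (P.A : ℤ) ^ k
def Lam (k : ℕ) (w : V d) : Set (V d) := cb (sc (P.U k) (P.z k w)) (5 * P.U k)
def BB (a : Config d) (k : ℕ) (w : V d) : Set (V d) :=
  {v | ∃ i ∈ P.Ac a k (P.z k w), v ∈ SS a P.M P.R i}
def F1 (a : Config d) (k : ℕ) (w : V d) : Prop := ∀ u ∈ cb (P.z k w) (5 * P.A), P.Gd a k u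
def F2 (a x : Config d) (k : ℕ) (w : V d) : Prop :=
  ∀ v ∈ P.Lam k w, P.idx v ∉ cb (sc ((P.A : ℤ) ^ k) (P.z k w)) (2 * (P.A : ℤ) ^ k) →
    Conn x (P.Lam k w) w v → ∃ u ∈ P.BB a k w, Conn x (P.Lam k w) w u
def Bad (a x : Config d) (k : ℕ) (w : V d) : Prop := ¬ (P.F1 a k w ∧ P.F2 a x k w)
def NN (k : ℕ) : ℕ := (2 * (P.M * (8 + P.c) * P.A ^ k) + 1) ^ d

lemma s0 : 0 ≤ P.s := by unfold s; positivity
lemma hA' : 2 * (3 * P.s + 9) + 5 ≤ (P.A : ℤ) := by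
  unfold s; have := P.hA; zify at this; linarith
lemma hodd' : (P.A : ℤ) % 2 = 1 := by have := P.hodd; omega
lemma A0 : 0 < (P.A : ℤ) := by have := P.hA'; have := P.s0; linarith
lemma A100 : 100 ≤ (P.A : ℤ) := by have := P.hA; have := P.hc; zify at *; linarith
lemma Ak (k : ℕ) : 1 ≤ (P.A : ℤ) ^ k := one_le_pow₀ (by have := P.A0; linarith)
lemma M3 : 3 ≤ P.M := by have := P.hh; unfold M; omega
lemma M0 : (0 : ℤ) < P.M := by have := P.M3; omega
lemma Modd : (P.M : ℤ) % 2 = 1 := by unfold M; omega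
lemma eM : (P.M : ℤ) = 2 * P.h + 1 := by unfold M; push_cast; ring
lemma U0 (k : ℕ) : 0 < P.U k := mul_pos P.M0 (by have := P.Ak k; linarith)
lemma U_eq (k : ℕ) : P.U k = P.M * (P.A : ℤ) ^ k := rfl
lemma MU (k : ℕ) : (P.M : ℤ) ≤ P.U k := by
  have := P.Ak k; have := P.M0; unfold U; nlinarith
lemma hRM : P.R ≤ P.M := by have := P.hR; unfold M; omega

lemma NN_mono {j k : ℕ} (h : j ≤ k) : P.NN j ≤ P.NN k := by
  unfold NN
  have : P.A ^ j ≤ P.A ^ k := Nat.pow_le_pow_right (by have := P.A0; omega) h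
  gcongr

lemma idx_cb (w : V d) : w ∈ cb (sc P.M (P.idx w)) P.h := by
  intro k
  have := par_spec P.M0 P.Modd w k
  have := P.eM
  simp only [sc, idx]; omega

lemma idx_eq {w i : V d} (h : w ∈ cb (sc P.M i) P.h) : P.idx w = i := by
  funext k
  have h1 := abs_le.1 (P.idx_cb w k)
  have h2 := abs_le.1 (h k)
  simp only [sc] at h1 h2
  have e := P.eM
  have hM := P.M0
  by_contra hne
  rcases lt_or_gt_of_ne hne with h | h
  · have : P.idx w k + 1 ≤ i k := h
    have : (P.M : ℤ) * (P.idx w k + 1) ≤ P.M * i k := by gcongr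
    linarith
  · have : i k + 1 ≤ P.idx w k := h
    have : (P.M : ℤ) * (i k + 1) ≤ P.M * P.idx w k := by gcongr
    linarith

lemma idx_step {v w : V d} {r : ℤ} (hr : r ≤ P.M) (h : v ∈ cb w r) : P.idx v ∈ cb (P.idx w) 1 := by
  have h1 := tl_close (A := P.M) P.M0 P.Modd 1 (i := v) (j := w) (r := r) (m := 1) h (by linarith)
  exact h1

lemma vert_cb {v z : V d} {k : ℕ} {r : ℤ} (h : P.idx v ∈ cb (sc ((P.A : ℤ) ^ k) z) r) :
    v ∈ cb (sc (P.U k) z) (P.M * r + P.M) := by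
  have h1 := cb_trans (P.idx_cb v) (sc_cb P.M0.le h)
  rw [sc_sc] at h1
  exact cb_mono h1 (by have := P.eM; have := P.M0; linarith)

lemma z_cb (k : ℕ) (w : V d) : P.idx w ∈ cb (sc ((P.A : ℤ) ^ k) (P.z k w)) ((P.A : ℤ) ^ k) :=
  tl_cb P.A0 P.hodd' k _

lemma w_cb (k : ℕ) (w : V d) : w ∈ cb (sc (P.U k) (P.z k w)) (2 * P.U k) :=
  cb_mono (P.vert_cb (P.z_cb k w)) (by have := P.MU k; rw [← U_eq]; linarith)

lemma w_Lam (k : ℕ) (w : V d) : w ∈ P.Lam k w :=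
  cb_mono (P.w_cb k w) (by have := P.U0 k; linarith)

lemma z_step {v w : V d} (k : ℕ) (h : v ∈ cb w 1) : P.z k v ∈ cb (P.z k w) 1 :=
  tl_close P.A0 P.hodd' k (P.idx_step (r := 1) (by have := P.M0; linarith) h) (by have := P.Ak k; linarith)

lemma z_succ (k : ℕ) (w : V d) : P.z k w ∈ cb (sc P.A (P.z (k + 1) w)) P.A := by
  intro j
  have := par_spec P.A0 P.hodd' (P.z k w) j
  have h2 := abs_nonneg ((P.z k w) j - P.A * par P.A (P.z k w) j)
  show |(P.z k w) j - P.A * par P.A (P.z k w) j| ≤ _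
  linarith

variable {P}

lemma nest1 {a : Config d} {k : ℕ} {w : V d} (h : P.F1 a k w) : P.BB a k w ⊆ P.BB a (k + 1) w := by
  rintro v ⟨i, hi, hv⟩
  refine ⟨i, ?_, hv⟩
  have hz := P.z_succ k w
  refine (nest (cb_mono hz (by have := P.A0; linarith)) fun u hu => h u ?_).1 hi
  exact cb_mono (cb_trans hu (cb_symm hz)) (by have := P.A0; linarith)

lemma nestl {a : Config d} {k l : ℕ} {w : V d} (h : ∀ j ≥ k, P.F1 a j w) (hl : k ≤ l) :
    P.BB a k w ⊆ P.BB a l w := by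
  induction l, hl using Nat.le_induction with
  | base => exact le_rfl
  | succ l hl ih => exact ih.trans (nest1 (h l hl))

lemma gdpath {M R c : ℕ} {a : Config d} {X Y : Set (V d)} {i i' : V d}
    (h : NC ({x | gdB M R c a x} ∩ X) i i') (hi : gdB M R c a i) (hiX : i ∈ X)
    (hXY : ∀ j ∈ X, cb (sc M j) ((c : ℤ) * M) ⊆ Y) :
    ∀ v ∈ SS a M R i, ∀ v' ∈ SS a M R i', Conn a Y v v' := by
  intro v hv
  unfold NC Conn at h
  induction h with
  | refl =>
    intro v' hv'
    exact (hi.2 i (cb_self (by norm_num)) v hv v' hv').mono le_rfl (hXY i hiX)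
  | tail _ h ih =>
    intro v' hv'
    obtain ⟨h1, ⟨h2, h2X⟩, -⟩ := h
    obtain ⟨u, hu⟩ := h2.1
    exact (ih u hu).trans ((h2.2 _ (edgeOpen_cb h1) u hu v' hv').mono le_rfl (hXY _ h2X))

lemma F1_self {a : Config d} {k : ℕ} {w : V d} (h : P.F1 a k w) : P.Gd a k (P.z k w) :=
  h _ (cb_self (by have := P.A0; linarith))

lemma SS_cb {a : Config d} {k : ℕ} {z v i : V d} {r : ℤ} (hi : i ∈ cb (sc ((P.A : ℤ) ^ k) z) r)
    (hv : v ∈ SS a P.M P.R i) : v ∈ cb (sc (P.U k) z) (P.M * r + P.h) := by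
  have h1 := cb_trans hv.1 (sc_cb P.M0.le hi)
  rw [sc_sc] at h1
  exact cb_mono h1 (by have : (P.R : ℤ) ≤ P.h := by exact_mod_cast P.hR
                       linarith)

lemma BB_cb {a : Config d} {k : ℕ} {w v : V d} (hv : v ∈ P.BB a k w) : v ∈ P.Lam k w := by
  obtain ⟨i, hi, hv⟩ := hv
  have h1 := Acc_cb (by have := P.A100; linarith) hi
  refine cb_mono (SS_cb h1 hv) ?_
  have := P.MU k; have := P.eM; have := P.M0; rw [U_eq] at *; nlinarith

/-- big box -/
def Big (P : Pr d) (k : ℕ) (w : V d) : Set (V d) := cb (sc (P.U k) (P.z k w)) ((8 + P.c) * P.U k)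

lemma Lam_Big (k : ℕ) (w : V d) : P.Lam k w ⊆ P.Big k w := fun v hv =>
  cb_mono hv (by have := P.U0 k; nlinarith)

lemma D1 {a : Config d} {l : ℕ} {w w' : V d} (h : P.F1 a l w) (hz : P.z l w' ∈ cb (P.z l w) 3)
    {v v' : V d} (hv : v ∈ P.BB a l w) (hv' : v' ∈ P.BB a l w') : Conn a (P.Big l w) v v' := by
  obtain ⟨i, hi, hv⟩ := hv
  obtain ⟨i', hi', hv'⟩ := hv'
  have h35 : (3 : ℤ) ≤ 5 * P.A := by have := P.A100; linarith
  have hn : NC ({x | P.Gd a l x} ∩ cb (P.z l w) 3) (P.z l w) (P.z l w') :=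
    (nc_cb (cb_self (by norm_num)) hz).mono fun u hu => ⟨h u (cb_mono hu h35), hu⟩
  have h1 := chain (X := cb (sc ((P.A : ℤ) ^ l) (P.z l w)) (8 * (P.A : ℤ) ^ l)) P.hd P.s0 P.hA'
    (link P.hd P.s0 P.hA' l) hn (F1_self h) (cb_self (by norm_num)) (by
      intro y hy x hx
      exact cb_mono (cb_trans hx (sc_cb (by have := P.Ak l; linarith) hy)) (by linarith)) i hi i' hi'
  refine gdpath h1 (Acc_good P.s0 (F1_self h) hi) ?_ ?_ v hv v' hv'
  · exact cb_mono (Acc_cb (by have := P.A100; linarith) hi) (by have := P.Ak l; linarith)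
  · intro j hj x hx
    have h2 := cb_trans hx (sc_cb P.M0.le hj)
    rw [sc_sc] at h2
    refine cb_mono h2 ?_
    have := P.MU l
    rw [U_eq] at *
    have hc : (0 : ℤ) ≤ P.c := by positivity
    nlinarith

lemma chem_Big {x : Config d} {l : ℕ} {w u v : V d} (h : Conn x (P.Big l w) u v) (hu : u ∈ P.Big l w) :
    chemDist x u v ≤ P.NN l := by
  have e : P.Big l w = ↑(cbF (sc (P.U l) (P.z l w)) ((P.M * (8 + P.c) * P.A ^ l : ℕ) : ℤ)) := by
    ext y
    rw [Finset.mem_coe, mem_cbF, Big]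
    have : (8 + (P.c : ℤ)) * P.U l = ((P.M * (8 + P.c) * P.A ^ l : ℕ) : ℤ) := by
      rw [U_eq]; push_cast; ring
    rw [this]
  rw [e] at h hu
  refine (chemDist_le_card h (Finset.mem_coe.1 hu)).trans ?_
  rw [card_cbF, NN]

/-- all levels `≥ k` are fine at `w` -/
def FF (P : Pr d) (a x : Config d) (k : ℕ) (w : V d) : Prop := ∀ j ≥ k, ¬ P.Bad a x j w

lemma FF.f1 {a x : Config d} {k : ℕ} {w : V d} (h : P.FF a x k w) : ∀ j ≥ k, P.F1 a j w :=
  fun j hj => (not_not.1 (h j hj)).1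

lemma FF.f2 {a x : Config d} {k : ℕ} {w : V d} (h : P.FF a x k w) : ∀ j ≥ k, P.F2 a x j w :=
  fun j hj => (not_not.1 (h j hj)).2

lemma BB_nonempty {a : Config d} {k : ℕ} {w : V d} (h : P.F1 a k w) : (P.BB a k w).Nonempty := by
  obtain ⟨i, hi⟩ := Acc_nonempty P.hd P.s0 P.hA' (F1_self h)
  obtain ⟨v, hv⟩ := (Acc_good P.s0 (F1_self h) hi).1
  exact ⟨v, i, hi, hv⟩

lemma D1' {a x : Config d} (hax : a ≤ x) {k k' l : ℕ} {w w' : V d} (h : P.FF a x k w) (h' : P.FF a x k' w')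
    (hk : k ≤ l) (hk' : k' ≤ l) (hz : P.z l w' ∈ cb (P.z l w) 3)
    {v v' : V d} (hv : v ∈ P.BB a k w) (hv' : v' ∈ P.BB a k' w') : chemDist x v v' ≤ P.NN l := by
  have hv1 := nestl h.f1 hk hv
  have h1 := D1 (h.f1 l hk) hz hv1 (nestl h'.f1 hk' hv')
  exact chem_Big (h1.mono hax le_rfl) (Lam_Big _ _ (BB_cb hv1))

lemma D2 {a x : Config d} (hax : a ≤ x) {k l : ℕ} {w : V d} (h : P.FF a x k w)
    (hk : k ≤ l) {n : ℕ} {f : ℕ → V d} (hf : IsOpenPath x n f) (h0 : f 0 = w)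
    (hn : P.z l (f n) ∉ cb (P.z l w) 3)
    {v : V d} (hv : v ∈ P.BB a k w) : chemDist x w v ≤ P.NN l := by
  classical
  let Y := cb (sc ((P.A : ℤ) ^ l) (P.z l w)) (2 * (P.A : ℤ) ^ l)
  have hY : P.idx (f n) ∉ Y := fun hc => hn (tl_close' P.A0 P.hodd' l
    (cb_mono hc (by have := P.Ak l; linarith)))
  have hex : ∃ t, P.idx (f t) ∉ Y := ⟨n, hY⟩
  obtain ⟨t, ht, htn, hmin⟩ : ∃ t, P.idx (f t) ∉ Y ∧ t ≤ n ∧ ∀ j < t, P.idx (f j) ∈ Y :=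
    ⟨Nat.find hex, Nat.find_spec hex, Nat.find_min' hex hY, fun j hj => not_not.1 (Nat.find_min hex hj)⟩
  have hmem : ∀ j ≤ t, f j ∈ P.Lam l w := by
    intro j hj
    have h1 : P.idx (f j) ∈ cb (sc ((P.A : ℤ) ^ l) (P.z l w)) (3 * (P.A : ℤ) ^ l) := by
      rcases hj.lt_or_eq with h | h
      · exact cb_mono (hmin j h) (by have := P.Ak l; linarith)
      · rcases Nat.eq_zero_or_pos j with h' | h'
        · rw [h', h0]; exact cb_mono (P.z_cb l w) (by have := P.Ak l; linarith)
        · obtain ⟨m, rfl⟩ : ∃ m, j = m + 1 := ⟨j - 1, by omega⟩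
          have h2 := hmin m (by omega)
          have h3 := P.idx_step (r := 1) (by have := P.M0; linarith) (edgeOpen_cb (hf m (by omega)))
          exact cb_mono (cb_trans h3 h2) (by have := P.Ak l; linarith)
    refine cb_mono (P.vert_cb h1) ?_
    have := P.MU l; rw [U_eq] at *; linarith
  have hc : Conn x (P.Lam l w) w (f t) := by
    rw [← h0]
    rw [← h0] at hmem
    exact conn_of_path (fun i hi => hf i (by omega)) hmem
  obtain ⟨u, hu, hwu⟩ := h.f2 l hk (f t) (hmem t le_rfl) ht hc
  have h2 := D1 (h.f1 l hk) (cb_self (by norm_num)) hu (nestl h.f1 hk hv)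
  exact chem_Big ((hwu.mono le_rfl (Lam_Big l w)).trans (h2.mono hax le_rfl)) (Lam_Big _ _ (P.w_Lam l w))

end Pr
end

section
variable {d : ℕ}
namespace Pr
variable {P : Pr d}

lemma path_rev {x : Config d} {n : ℕ} {f : ℕ → V d} (hf : IsOpenPath x n f) :
    IsOpenPath x n (fun t => f (n - t)) := by
  intro i hi
  have := hf (n - (i + 1)) (by omega)
  have e : n - (i + 1) + 1 = n - i := by omega
  rw [e] at this
  exact edgeOpen_symm this

section
variable {a x : Config d} {κ : V d → ℕ} {hub : V d → V d}

lemma run (hax : a ≤ x) (hκ : ∀ w, P.FF a x (κ w) w) (hh : ∀ w, hub w ∈ P.BB a (κ w) w)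
    {m : ℕ} {f : ℕ → V d} (hf : IsOpenPath x m f) :
    chemDist x (hub (f 0)) (hub (f m)) ≤ m + 2 * ((P.NN (κ (f 0)) : ℝ≥0∞) + P.NN (κ (f m))) := by
  set l := max (κ (f 0)) (κ (f m)) with hl
  have hN : (P.NN l : ℝ≥0∞) ≤ (P.NN (κ (f 0)) : ℝ≥0∞) + P.NN (κ (f m)) := by
    rcases le_total (κ (f 0)) (κ (f m)) with h | h
    · rw [hl, max_eq_right h]; exact le_add_self
    · rw [hl, max_eq_left h]; exact le_self_add
  by_cases hz : P.z l (f m) ∈ cb (P.z l (f 0)) 3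
  · refine (D1' hax (hκ _) (hκ _) (le_max_left _ _) (le_max_right _ _) hz (hh _) (hh _)).trans
      (hN.trans ?_)
    refine le_trans ?_ le_add_self
    exact le_mul_of_one_le_left' (by norm_num)
  · have h1 := D2 hax (hκ (f 0)) (le_max_left _ (κ (f m))) hf rfl hz (hh _)
    have h2 := D2 hax (hκ (f m)) (le_max_right (κ (f 0)) _) (path_rev hf) (by simp)
      (by simp only [Nat.sub_self]; exact fun h => hz (cb_symm h)) (hh _)
    calc chemDist x (hub (f 0)) (hub (f m)) ≤ chemDist x (hub (f 0)) (f 0) + chemDist x (f 0) (hub (f m)) :=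
          chemDist_triangle _ _ _ _
      _ ≤ chemDist x (hub (f 0)) (f 0) + (chemDist x (f 0) (f m) + chemDist x (f m) (hub (f m))) := by
          gcongr; exact chemDist_triangle _ _ _ _
      _ ≤ P.NN l + (m + P.NN l) := by
          gcongr
          · rw [chemDist_comm]; exact h1
          · exact chemDist_le_path hf
      _ = m + 2 * P.NN l := by ring
      _ ≤ _ := by gcongr

open Classical in
/-- cost of the closed steps -/
noncomputable def clc (P : Pr d) (x : Config d) (κ : V d → ℕ) (f : ℕ → V d) (t : ℕ) : ℝ≥0∞ :=
  if edgeOpen x (f t) (f (t + 1)) then 0 else 3 * ((P.NN (κ (f t)) : ℝ≥0∞) + P.NN (κ (f (t + 1))))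

lemma path_lemma (hax : a ≤ x) (hκ : ∀ w, P.FF a x (κ w) w) (hh : ∀ w, hub w ∈ P.BB a (κ w) w)
    {n : ℕ} {f : ℕ → V d} (hf : ∀ t < n, f (t + 1) ∈ cb (f t) 1) :
    chemDist x (hub (f 0)) (hub (f n)) ≤ n + ∑ t ∈ Finset.range n, P.clc x κ f t +
      2 * P.NN (κ (f 0)) + 2 * P.NN (κ (f n)) := by
  have hrun : ∀ s m, s ≤ m → (∀ t, s ≤ t → t < m → edgeOpen x (f t) (f (t + 1))) →
      chemDist x (hub (f s)) (hub (f m)) ≤ (m - s : ℕ) + 2 * ((P.NN (κ (f s)) : ℝ≥0∞) + P.NN (κ (f m))) := by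
    intro s m hsm ho
    have := run (P := P) hax hκ hh (m := m - s) (f := fun t => f (s + t)) (fun i hi => ho (s + i) (by omega) (by omega))
    simp only [Nat.add_zero, Nat.add_sub_cancel' hsm] at this
    exact this
  have key : ∀ m ≤ n, ∃ s ≤ m, (∀ t, s ≤ t → t < m → edgeOpen x (f t) (f (t + 1))) ∧
      chemDist x (hub (f 0)) (hub (f s)) + 2 * P.NN (κ (f s)) ≤
        s + 2 * P.NN (κ (f 0)) + ∑ t ∈ Finset.range m, P.clc x κ f t := by
    intro m
    induction m with
    | zero => intro _; exact ⟨0, le_rfl, fun t _ h => by omega, by simp [chemDist_self]⟩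
    | succ m ih =>
      intro hm
      obtain ⟨s, hs, ho, hb⟩ := ih (by omega)
      by_cases hopen : edgeOpen x (f m) (f (m + 1))
      · refine ⟨s, by omega, fun t h1 h2 => ?_, hb.trans ?_⟩
        · rcases (Nat.lt_succ_iff.1 h2).lt_or_eq with h | h
          · exact ho t h1 h
          · rw [h]; exact hopen
        · rw [Finset.sum_range_succ]; gcongr; exact le_self_add
      · refine ⟨m + 1, le_rfl, fun t h1 h2 => by omega, ?_⟩
        have h1 := hrun s m hs ho
        set l := max (κ (f m)) (κ (f (m + 1))) with hl
        have hN : (P.NN l : ℝ≥0∞) ≤ (P.NN (κ (f m)) : ℝ≥0∞) + P.NN (κ (f (m + 1))) := by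
          rcases le_total (κ (f m)) (κ (f (m + 1))) with h | h
          · rw [hl, max_eq_right h]; exact le_add_self
          · rw [hl, max_eq_left h]; exact le_self_add
        have h2 := (D1' hax (hκ (f m)) (hκ (f (m + 1))) (le_max_left _ _) (le_max_right _ _)
          (cb_mono (P.z_step l (hf m (by omega))) (by norm_num)) (hh _) (hh _)).trans hN
        have h3 : chemDist x (hub (f 0)) (hub (f (m + 1))) ≤ chemDist x (hub (f 0)) (hub (f s)) +
            (chemDist x (hub (f s)) (hub (f m)) + chemDist x (hub (f m)) (hub (f (m + 1)))) :=
          (chemDist_triangle _ _ _ _).trans (by gcongr; exact chemDist_triangle _ _ _ _)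
        have hms : ((m - s : ℕ) : ℝ≥0∞) + s = m := by
          rw [← Nat.cast_add, Nat.sub_add_cancel hs]
        rw [Finset.sum_range_succ]
        have hc : P.clc x κ f m = 3 * ((P.NN (κ (f m)) : ℝ≥0∞) + P.NN (κ (f (m + 1)))) := by
          rw [clc, if_neg hopen]
        rw [hc]
        calc _ ≤ chemDist x (hub (f 0)) (hub (f s)) +
            (((m - s : ℕ) + 2 * ((P.NN (κ (f s)) : ℝ≥0∞) + P.NN (κ (f m)))) +
              ((P.NN (κ (f m)) : ℝ≥0∞) + P.NN (κ (f (m + 1))))) + 2 * P.NN (κ (f (m + 1))) := by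
              gcongr; exact h3.trans (by gcongr)
          _ = (chemDist x (hub (f 0)) (hub (f s)) + 2 * P.NN (κ (f s))) + (m - s : ℕ) +
              3 * ((P.NN (κ (f m)) : ℝ≥0∞) + P.NN (κ (f (m + 1)))) := by ring
          _ ≤ (s + 2 * P.NN (κ (f 0)) + ∑ t ∈ Finset.range m, P.clc x κ f t) + (m - s : ℕ) +
              3 * ((P.NN (κ (f m)) : ℝ≥0∞) + P.NN (κ (f (m + 1)))) := by gcongr
          _ = (((m - s : ℕ) : ℝ≥0∞) + s) + 2 * P.NN (κ (f 0)) + (∑ t ∈ Finset.range m, P.clc x κ f t +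
              3 * ((P.NN (κ (f m)) : ℝ≥0∞) + P.NN (κ (f (m + 1))))) := by ring
          _ ≤ _ := by rw [hms]; gcongr; omega
  obtain ⟨s, hs, ho, hb⟩ := key n le_rfl
  have h1 := hrun s n hs ho
  have hms : ((n - s : ℕ) : ℝ≥0∞) + s = n := by
    rw [← Nat.cast_add, Nat.sub_add_cancel hs]
  calc _ ≤ chemDist x (hub (f 0)) (hub (f s)) + chemDist x (hub (f s)) (hub (f n)) := chemDist_triangle _ _ _ _
    _ ≤ chemDist x (hub (f 0)) (hub (f s)) + ((n - s : ℕ) + 2 * ((P.NN (κ (f s)) : ℝ≥0∞) + P.NN (κ (f n)))) := by gcongr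
    _ = (chemDist x (hub (f 0)) (hub (f s)) + 2 * P.NN (κ (f s))) + (n - s : ℕ) + 2 * P.NN (κ (f n)) := by ring
    _ ≤ (s + 2 * P.NN (κ (f 0)) + ∑ t ∈ Finset.range n, P.clc x κ f t) + (n - s : ℕ) + 2 * P.NN (κ (f n)) := by gcongr
    _ = (((n - s : ℕ) : ℝ≥0∞) + s) + ∑ t ∈ Finset.range n, P.clc x κ f t + 2 * P.NN (κ (f 0)) + 2 * P.NN (κ (f n)) := by ring
    _ = _ := by rw [hms]

end

lemma BB_inf {a x : Config d} (hax : a ≤ x) {k : ℕ} {w v : V d} (h : P.FF a x k w) (hv : v ∈ P.BB a k w) :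
    InInfiniteCluster x v := by
  classical
  intro hfin
  obtain ⟨l, hl⟩ : ∃ l : ℕ, hfin.toFinset.card < 2 ^ l := ⟨_, Nat.lt_two_pow_self⟩
  let L := max k l
  obtain ⟨T, hT, hTA⟩ := Acc_card P.hd P.s0 P.hA' P.hodd' (F1_self (h.f1 L (le_max_left _ _)))
  have hne : ∀ i, ∃ u, i ∈ T → u ∈ SS a P.M P.R i := by
    intro i
    by_cases hi : i ∈ T
    · obtain ⟨u, hu⟩ := (Acc_good P.s0 (F1_self (h.f1 L (le_max_left _ _))) (hTA i hi)).1
      exact ⟨u, fun _ => hu⟩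
    · exact ⟨0, fun h => absurd h hi⟩
  choose u hu using hne
  have h1 : (T.image u) ⊆ hfin.toFinset := by
    intro y hy
    obtain ⟨i, hi, rfl⟩ := Finset.mem_image.1 hy
    rw [Set.Finite.mem_toFinset]
    have := D1 (h.f1 L (le_max_left _ _)) (cb_self (by norm_num)) (nestl h.f1 (le_max_left _ _) hv)
      (⟨i, hTA i hi, hu i hi⟩ : u i ∈ P.BB a L w)
    exact (this.mono hax le_rfl).connected
  have h2 : (T.image u).card = T.card := by
    refine Finset.card_image_of_injOn fun i hi j hj hij => ?_
    have hR : (P.R : ℤ) ≤ P.h := by exact_mod_cast P.hR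
    rw [← P.idx_eq (cb_mono (hu i hi).1 hR), hij, P.idx_eq (cb_mono (hu j hj).1 hR)]
  have h3 := Finset.card_le_card h1
  have h4 : 2 ^ l ≤ 2 ^ L := Nat.pow_le_pow_right (by norm_num) (le_max_right _ _)
  omega

lemma BB_near {a : Config d} {k : ℕ} {w v : V d} (hv : v ∈ P.BB a k w) : v ∈ cb w (7 * P.U k) :=
  cb_mono (cb_trans (BB_cb hv) (cb_symm (P.w_cb k w))) (by have := P.U0 k; linarith)

open Classical in
lemma exists_kappa {a x : Config d} {w : V d} (h : ∃ k, P.FF a x k w) :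
    ∃ k, P.FF a x k w ∧ (∀ k', P.FF a x k' w → k ≤ k') ∧ (P.NN k : ℝ≥0∞) ≤ P.NN 0 + ∑' j, (P.NN (j + 1) : ℝ≥0∞) *
      (if P.Bad a x j w then 1 else 0) := by
  refine ⟨Nat.find h, Nat.find_spec h, fun k' hk' => Nat.find_min' h hk', ?_⟩
  rcases Nat.eq_zero_or_pos (Nat.find h) with h0 | h0
  · rw [h0]; exact le_self_add
  · obtain ⟨j, hj⟩ : ∃ j, Nat.find h = j + 1 := ⟨Nat.find h - 1, by omega⟩
    have hb : P.Bad a x j w := by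
      by_contra hc
      refine Nat.find_min h (m := j) (by omega) fun i hi => ?_
      rcases hi.lt_or_eq with h1 | h1
      · exact Nat.find_spec h i (by omega)
      · rw [← h1]; exact hc
    refine le_trans ?_ le_add_self
    refine le_trans ?_ (ENNReal.le_tsum j)
    rw [if_pos hb, hj, mul_one]

end Pr
end

section
variable {d : ℕ}
namespace Pr
variable {P : Pr d}

/-- domain of dependence of `Gd a k z` -/
def Dm (P : Pr d) (k : ℕ) (z : V d) : Set (V d) := cb (sc (P.U k) z) ((4 + P.c) * P.U k)

lemma Dm_sub {k : ℕ} {u z : V d} (hu : u ∈ cb (sc P.A z) (3 * P.A)) : P.Dm k u ⊆ P.Dm (k + 1) z := by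
  intro x hx
  have h1 := cb_trans hx (sc_cb (P.U0 k).le hu)
  rw [sc_sc] at h1
  have e : P.U k * P.A = P.U (k + 1) := by rw [U_eq, U_eq]; ring
  rw [e] at h1
  refine cb_mono h1 ?_
  rw [← e]
  have hU := P.U0 k
  have hA := P.A100
  have hc : (0 : ℤ) ≤ P.c := by positivity
  have h2 : (0 : ℤ) ≤ (P.U k * P.c) * (P.A - 1) := mul_nonneg (mul_nonneg hU.le hc) (by linarith)
  have h3 : (0 : ℤ) ≤ P.U k * (P.A - 100) := mul_nonneg hU.le (by linarith)
  nlinarith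

lemma Dm_zero (z : V d) : P.Dm 0 z = cb (sc P.M z) ((4 + P.c) * P.M) := by
  simp [Dm, U]

lemma Gd_congr {a a' : Config d} : ∀ {k : ℕ} {z : V d}, (∀ e ∈ EdgesIn (P.Dm k z), a e = a' e) →
    (P.Gd a k z ↔ P.Gd a' k z) := by
  intro k
  induction k with
  | zero =>
    intro z h
    have hs : cb (sc P.M z) ((P.c : ℤ) * P.M) ⊆ P.Dm 0 z := by
      rw [Dm_zero]; exact fun x hx => cb_mono hx (by have := P.M0; nlinarith)
    exact ⟨gdB_congr P.hc P.hRM fun e he => h e (EdgesIn_mono hs he),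
      gdB_congr P.hc P.hRM fun e he => (h e (EdgesIn_mono hs he)).symm⟩
  | succ k ih =>
    intro z h
    have h' : ∀ u ∈ cb (sc P.A z) (3 * P.A), (P.Gd a k u ↔ P.Gd a' k u) := fun u hu =>
      ih fun e he => h e (EdgesIn_mono (Dm_sub hu) he)
    show (∀ u ∈ cb (sc P.A z) (3 * P.A), ∀ v ∈ cb (sc P.A z) (3 * P.A), ¬ P.Gd a k u → ¬ P.Gd a k v → _) ↔
      (∀ u ∈ cb (sc P.A z) (3 * P.A), ∀ v ∈ cb (sc P.A z) (3 * P.A), ¬ P.Gd a' k u → ¬ P.Gd a' k v → _)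
    refine forall₂_congr fun u hu => forall₂_congr fun v hv => ?_
    rw [h' u hu, h' v hv]

lemma Ac_congr {a a' : Config d} : ∀ {k : ℕ} {z : V d}, (∀ e ∈ EdgesIn (P.Dm k z), a e = a' e) →
    P.Ac a k z = P.Ac a' k z := by
  intro k
  induction k with
  | zero => intro z h; rfl
  | succ k ih =>
    intro z h
    have h' : ∀ u ∈ cb (sc P.A z) (3 * P.A), (∀ e ∈ EdgesIn (P.Dm k u), a e = a' e) := fun u hu =>
      fun e he => h e (EdgesIn_mono (Dm_sub hu) he)
    ext i
    show (∃ u ∈ cb (sc P.A z) (3 * P.A), (∀ v ∈ cb (sc P.A z) (3 * P.A), ¬ P.Gd a k v → _) ∧ i ∈ P.Ac a k u) ↔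
      (∃ u ∈ cb (sc P.A z) (3 * P.A), (∀ v ∈ cb (sc P.A z) (3 * P.A), ¬ P.Gd a' k v → _) ∧ i ∈ P.Ac a' k u)
    refine exists_congr fun u => and_congr_right fun hu => ?_
    rw [ih (h' u hu)]
    refine and_congr_left fun _ => forall₂_congr fun v hv => ?_
    rw [Gd_congr (h' v hv)]

lemma SS_eq {a a' : Config d} {i : V d} {Y : Set (V d)} (hY : cb (sc P.M i) (2 * P.M) ⊆ Y)
    (h : ∀ e ∈ EdgesIn Y, a e = a' e) : SS a P.M P.R i = SS a' P.M P.R i := by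
  have hs : ∀ v ∈ cb (sc P.M i) P.R, cb v P.M ⊆ Y := fun v hv x hx =>
    hY (cb_mono (cb_trans hx hv) (by have : (P.R : ℤ) ≤ P.M := by exact_mod_cast P.hRM
                                     linarith))
  ext v
  refine and_congr_right fun hv => ⟨IM_congr fun e he => h e (EdgesIn_mono (hs v hv) he),
    IM_congr fun e he => (h e (EdgesIn_mono (hs v hv) he)).symm⟩

/-- range of dependence of `Bad` -/
def r (P : Pr d) (k : ℕ) : ℕ := (5 * P.A + P.c + 8) * (P.M * P.A ^ k)

lemma r_eq (k : ℕ) : (P.r k : ℤ) = (5 * P.A + P.c + 8) * P.U k := by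
  unfold r U; push_cast; ring

lemma Bad_congr {a a' x x' : Config d} {k : ℕ} {w : V d} (ha : ∀ e ∈ EdgesIn (cb w (P.r k)), a e = a' e)
    (hx : ∀ e ∈ EdgesIn (cb w (P.r k)), x e = x' e) : P.Bad a x k w ↔ P.Bad a' x' k w := by
  have hU := P.U0 k
  have hw := P.w_cb k w
  have hA := P.A100
  have hc : (0 : ℤ) ≤ P.c := by positivity
  have hDm : ∀ u ∈ cb (P.z k w) (5 * P.A), P.Dm k u ⊆ cb w (P.r k) := by
    intro u hu y hy
    refine cb_mono (cb_trans (cb_trans hy (sc_cb hU.le hu)) (cb_symm hw)) ?_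
    rw [r_eq]; nlinarith
  have h1 : P.F1 a k w ↔ P.F1 a' k w := forall₂_congr fun u hu =>
    Gd_congr fun e he => ha e (EdgesIn_mono (hDm u hu) he)
  have hL : P.Lam k w ⊆ cb w (P.r k) := fun y hy =>
    cb_mono (cb_trans hy (cb_symm hw)) (by rw [r_eq]; nlinarith)
  have hC : ∀ v, Conn x (P.Lam k w) w v ↔ Conn x' (P.Lam k w) w v := fun v =>
    ⟨fun h => h.congr_le fun e he => (hx e (EdgesIn_mono hL he)).le,
     fun h => h.congr_le fun e he => (hx e (EdgesIn_mono hL he)).ge⟩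
  have hB : P.BB a k w = P.BB a' k w := by
    have hAc : P.Ac a k (P.z k w) = P.Ac a' k (P.z k w) := Ac_congr fun e he => ha e
      (EdgesIn_mono (hDm _ (cb_self (by linarith))) he)
    ext v
    unfold BB
    rw [hAc]
    refine exists_congr fun i => and_congr_right fun hi => ?_
    rw [SS_eq (Y := cb w (P.r k)) ?_ ha]
    intro y hy
    have h2 := cb_trans hy (sc_cb P.M0.le (Acc_cb (by linarith) hi))
    rw [sc_sc] at h2
    refine cb_mono (cb_trans h2 (cb_symm hw)) ?_
    have := P.MU k
    rw [r_eq]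
    rw [U_eq] at *
    nlinarith
  unfold Bad F2
  rw [h1, hB]
  simp only [hC]

/-- remove the edge `s(w,w')` -/
def delc (w w' : V d) (x : Config d) : Config d := by
  classical exact fun e => if e.1 = s(w, w') then false else x e

lemma delc_le (w w' : V d) (x : Config d) : delc w w' x ≤ x := by
  intro e; unfold delc; split_ifs
  · exact Bool.false_le _
  · exact le_rfl

lemma delc_ne {w w' : V d} {x : Config d} {e : Edge d} (h : e.1 ≠ s(w, w')) : delc w w' x e = x e := by
  unfold delc; rw [if_neg h]

lemma delc_congr {w w' : V d} {x x' : Config d} {e : Edge d} (h : x e = x' e) :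
    delc w w' x e = delc w w' x' e := by
  unfold delc; rw [h]

lemma delc_self {w w' : V d} {x : Config d} (h : ¬ edgeOpen x w w') : delc w w' x = x := by
  funext e; unfold delc; split_ifs with he
  · by_contra hc
    apply h
    refine ⟨he ▸ e.2, ?_⟩
    have e1 : (⟨s(w, w'), he ▸ e.2⟩ : Edge d) = e := Subtype.ext he.symm
    rw [e1]
    cases hx : x e <;> simp_all
  · rfl

lemma delc_mono {w w' : V d} {x y : Config d} (h : x ≤ y) : delc w w' x ≤ delc w w' y := by
  intro e; unfold delc; split_ifs
  · exact le_rfl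
  · exact h e

lemma measurable_delc (w w' : V d) : Measurable (delc w w' : Config d → Config d) := by
  classical
  refine measurable_pi_lambda _ fun e => ?_
  by_cases h : e.1 = s(w, w')
  · have : (fun x : Config d => delc w w' x e) = fun _ => false := by
      funext x; unfold delc; rw [if_pos h]
    rw [this]; exact measurable_const
  · have : (fun x : Config d => delc w w' x e) = fun x => x e := by
      funext x; exact delc_ne h
    rw [this]; exact measurable_pi_apply e

lemma loc_Gd (k : ℕ) (z : V d) : Loc (EdgesIn (P.Dm k z)) {a | P.Gd a k z} :=
  fun _ _ h hI => (Gd_congr h).1 hI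

lemma Dm_fin (k : ℕ) (z : V d) : (EdgesIn (P.Dm k z)).Finite := EdgesIn_finite (cb_finite _ _)

lemma meas_Gd (k : ℕ) (z : V d) : MeasurableSet {a | P.Gd a k z} := (loc_Gd k z).measurable (Dm_fin k z)

lemma EdgesIn_disj {S T : Set (V d)} (h : Disjoint S T) : Disjoint (EdgesIn S) (EdgesIn T) := by
  rw [Set.disjoint_left]
  rintro ⟨e, he⟩ h1 h2
  induction e using Sym2.ind with
  | _ a b => exact Set.disjoint_left.1 h (h1 a (by simp)) (h2 a (by simp))

lemma Dm_disj {k : ℕ} {u v : V d} (h : u ∉ cb v P.s) : Disjoint (P.Dm k u) (P.Dm k v) := by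
  rw [Set.disjoint_left]
  intro y h1 h2
  apply h
  intro j
  have h3 := cb_trans (cb_symm h1) h2 j
  simp only [sc] at h3
  rw [← mul_sub, abs_mul, abs_of_pos (P.U0 k)] at h3
  unfold s
  have : P.U k * |u j - v j| ≤ P.U k * (2 * (4 + P.c)) := by linarith
  exact le_of_mul_le_mul_left this (P.U0 k)

/-- number of pairs -/
def KK (P : Pr d) : ℕ := ((2 * (3 * P.A) + 1) ^ d) ^ 2

lemma Gd_tail {p : unitInterval} {η : ℝ≥0∞}
    (hη : ∀ i, PM (fun _ : Edge d => p) {a | ¬ gdB P.M P.R P.c a i} ≤ η) :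
    ∀ (k : ℕ) (z : V d), P.KK * PM (fun _ : Edge d => p) {a | ¬ P.Gd a k z} ≤ (P.KK * η) ^ 2 ^ k := by
  intro k
  induction k with
  | zero => intro z; simp only [pow_zero, pow_one]; gcongr; exact hη z
  | succ k ih =>
    intro z
    classical
    set B := cbF (sc (P.A : ℤ) z) ((3 * P.A : ℕ) : ℤ) with hB
    have hBm : ∀ u, u ∈ B ↔ u ∈ cb (sc (P.A : ℤ) z) (3 * P.A) := by
      intro u; rw [hB, mem_cbF]; push_cast; rfl
    have hsub : {a | ¬ P.Gd a (k + 1) z} ⊆ ⋃ q ∈ (B ×ˢ B).filter (fun q => q.1 ∉ cb q.2 P.s),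
        ({a | ¬ P.Gd a k q.1} ∩ {a | ¬ P.Gd a k q.2}) := by
      intro a ha
      have ha : ¬ (∀ u ∈ cb (sc P.A z) (3 * P.A), ∀ v ∈ cb (sc P.A z) (3 * P.A), ¬ P.Gd a k u →
        ¬ P.Gd a k v → u ∈ cb v P.s) := ha
      push Not at ha
      obtain ⟨u, hu, v, hv, h1, h2, h3⟩ := ha
      simp only [Set.mem_iUnion, Finset.mem_filter, Finset.mem_product]
      exact ⟨(u, v), ⟨⟨(hBm u).2 hu, (hBm v).2 hv⟩, h3⟩, h1, h2⟩
    have hq : ∀ q ∈ (B ×ˢ B).filter (fun q => q.1 ∉ cb q.2 P.s),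
        (P.KK : ℝ≥0∞) ^ 2 * PM (fun _ : Edge d => p) ({a | ¬ P.Gd a k q.1} ∩ {a | ¬ P.Gd a k q.2}) ≤
          (P.KK * η) ^ 2 ^ (k + 1) := by
      intro q hq
      have h1 : PM (fun _ : Edge d => p) ({a | ¬ P.Gd a k q.1} ∩ {a | ¬ P.Gd a k q.2}) =
          PM (fun _ : Edge d => p) {a | ¬ P.Gd a k q.1} * PM (fun _ : Edge d => p) {a | ¬ P.Gd a k q.2} :=
        ind_eq (fun _ => p) (s := EdgesIn (P.Dm k q.2)) (t := EdgesIn (P.Dm k q.1)) (meas_Gd k q.1).compl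
        (meas_Gd k q.2).compl (loc_Gd k q.2).compl (loc_Gd k q.1).compl
        (EdgesIn_disj (Dm_disj (Finset.mem_filter.1 hq).2)).symm
      rw [h1]
      calc _ = (P.KK * PM (fun _ : Edge d => p) {a | ¬ P.Gd a k q.1}) *
            (P.KK * PM (fun _ : Edge d => p) {a | ¬ P.Gd a k q.2}) := by ring
        _ ≤ (P.KK * η) ^ 2 ^ k * (P.KK * η) ^ 2 ^ k := mul_le_mul' (ih _) (ih _)
        _ = _ := by rw [pow_succ, pow_mul, sq]
    have hcard : (((B ×ˢ B).filter (fun q => q.1 ∉ cb q.2 P.s)).card : ℝ≥0∞) ≤ P.KK := by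
      have : ((B ×ˢ B).filter (fun q => q.1 ∉ cb q.2 P.s)).card ≤ P.KK := by
        refine (Finset.card_filter_le _ _).trans ?_
        rw [Finset.card_product, hB, card_cbF, KK, sq]
      exact_mod_cast this
    have hK0 : (P.KK : ℝ≥0∞) ≠ 0 := by
      have : 0 < P.KK := by unfold KK; positivity
      exact_mod_cast this.ne'
    have hKt : (P.KK : ℝ≥0∞) ≠ ⊤ := ENNReal.natCast_ne_top _
    rw [← ENNReal.mul_le_mul_iff_right hK0 hKt]
    calc _ ≤ (P.KK : ℝ≥0∞) * (P.KK * ∑ q ∈ (B ×ˢ B).filter (fun q => q.1 ∉ cb q.2 P.s),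
          PM (fun _ : Edge d => p) ({a | ¬ P.Gd a k q.1} ∩ {a | ¬ P.Gd a k q.2})) := by
          gcongr
          exact (measure_mono hsub).trans (measure_biUnion_finset_le _ _)
      _ = ∑ q ∈ (B ×ˢ B).filter (fun q => q.1 ∉ cb q.2 P.s), (P.KK : ℝ≥0∞) ^ 2 *
          PM (fun _ : Edge d => p) ({a | ¬ P.Gd a k q.1} ∩ {a | ¬ P.Gd a k q.2}) := by
          rw [Finset.mul_sum, Finset.mul_sum]; refine Finset.sum_congr rfl fun _ _ => by ring
      _ ≤ ∑ q ∈ (B ×ˢ B).filter (fun q => q.1 ∉ cb q.2 P.s), (P.KK * η) ^ 2 ^ (k + 1) := Finset.sum_le_sum hq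
      _ ≤ _ := by rw [Finset.sum_const, nsmul_eq_mul]; gcongr

lemma Gd_del {p : unitInterval} (k : ℕ) (z w w' : V d) :
    ENNReal.ofReal (1 - p) * PM (fun _ : Edge d => p) {a | ¬ P.Gd (delc w w' a) k z} ≤
      PM (fun _ : Edge d => p) {a | ¬ P.Gd a k z} := by
  by_cases he : sym2dist1 s(w, w') = 1
  · let e : Edge d := ⟨s(w, w'), he⟩
    have hm : MeasurableSet {a | ¬ P.Gd (delc w w' a) k z} := measurable_delc w w' (meas_Gd k z).compl
    have hL : Loc {e}ᶜ {a | ¬ P.Gd (delc w w' a) k z} := by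
      intro a a' h ha
      have : delc w w' a = delc w w' a' := by
        funext f
        by_cases hf : f.1 = s(w, w')
        · unfold delc; rw [if_pos hf, if_pos hf]
        · rw [delc_ne hf, delc_ne hf]
          exact h f fun hc => hf (by rw [Set.mem_singleton_iff.1 hc])
      rw [Set.mem_ofPred_eq, ← this]; exact ha
    have hLe : Loc {e} {a : Config d | a e = false} := fun a a' h ha => (h e rfl).symm.trans ha
    have h1 := ind_eq (fun _ => p) hm (hLe.measurable (Set.finite_singleton e)) hLe hL
      (Set.disjoint_compl_right_iff_subset.2 le_rfl)
    rw [PM_coord, bern_false] at h1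
    rw [mul_comm, ← h1]
    refine measure_mono ?_
    rintro a ⟨h1, h2⟩
    have h1 : ¬ P.Gd (delc w w' a) k z := h1
    rwa [delc_self] at h1
    rintro ⟨h3, h4⟩
    have h2 : a e = false := h2
    exact absurd (h2.symm.trans h4) (by simp)
  · have : ∀ a : Config d, delc w w' a = a := fun a => delc_self fun h => he h.1
    simp only [this]
    calc _ ≤ 1 * PM (fun _ : Edge d => p) {a | ¬ P.Gd a k z} := by
          gcongr
          rw [ENNReal.ofReal_le_one]; have := p.2.1; linarith
      _ = _ := one_mul _

end Pr
end

section
variable {d : ℕ}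

section spr
variable {ι : Type*}

lemma Loc.forallT {κ : Type*} {T : Finset κ} {s : κ → Set ι} {A : κ → Set (ι → Bool)}
    (h : ∀ k ∈ T, Loc (s k) (A k)) : Loc (⋃ k ∈ T, s k) {ω | ∀ k ∈ T, ω ∈ A k} := by
  intro x y hxy hx k hk
  exact h k hk x y (fun i hi => hxy i (Set.mem_iUnion₂.2 ⟨k, hk, hi⟩)) (hx k hk)

lemma meas_forallT {κ : Type*} {T : Finset κ} {A : κ → Set (ι → Bool)}
    (h : ∀ k ∈ T, MeasurableSet (A k)) : MeasurableSet {ω | ∀ k ∈ T, ω ∈ A k} := by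
  have : {ω | ∀ k ∈ T, ω ∈ A k} = ⋂ k ∈ T, A k := by ext; simp
  rw [this]; exact Finset.measurableSet_biInter T h

/-- sprinkling: each touched block fails independently -/
lemma spr (r : ι → unitInterval) {κ : Type*} [DecidableEq κ] (R : Finset κ) (s : κ → Set ι)
    (nf : κ → Set (ι → Bool)) (hm : ∀ i ∈ R, MeasurableSet (nf i)) (hl : ∀ i ∈ R, Loc (s i) (nf i))
    (hd : ∀ k ∈ R, ∀ l ∈ R, k ≠ l → Disjoint (s k) (s l)) (θ : ℝ≥0∞) (hθ : ∀ i ∈ R, PM r (nf i) ≤ θ)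
    (hθ1 : θ ≤ 1) (h0 : ∀ i ∈ R, PM r (nf i) ≠ 0)
    (E : Finset κ → Set (ι → Bool)) (hE : ∀ J ⊆ R, MeasurableSet (E J))
    (hEl : ∀ J ⊆ R, Loc (⋃ i ∈ R \ J, s i)ᶜ (E J))
    (hEd : ∀ J ⊆ R, ∀ J' ⊆ R, J ≠ J' → Disjoint (E J) (E J'))
    (G : Set (ι → Bool)) (hEG : ∀ J ⊆ R, E J ⊆ G) (hG : MeasurableSet G)
    (hGl : Loc (⋃ i ∈ R, s i)ᶜ G) (n : ℕ) :
    PM r (⋃ J ∈ R.powerset.filter (fun J => n ≤ J.card), (E J ∩ {ω | ∀ i ∈ J, ω ∈ nf i})) ≤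
      θ ^ n * PM r G := by
  have hN : ∀ T ⊆ R, MeasurableSet {ω | ∀ i ∈ T, ω ∈ nf i} := fun T hT =>
    meas_forallT fun i hi => hm i (hT hi)
  have hP0 : ∏ i ∈ R, PM r (nf i) ≠ 0 := Finset.prod_ne_zero_iff.2 h0
  have hPt : ∏ i ∈ R, PM r (nf i) ≠ ⊤ := ENNReal.prod_ne_top fun i _ => measure_ne_top _ _
  have h1 : ∀ J ⊆ R, PM r (E J ∩ {ω | ∀ i ∈ J, ω ∈ nf i}) * ∏ i ∈ R \ J, PM r (nf i) =
      PM r (E J ∩ {ω | ∀ i ∈ R, ω ∈ nf i}) := by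
    intro J hJ
    have hs : R \ J ⊆ R := Finset.sdiff_subset
    rw [← ind_prod r (R \ J) s nf (fun k hk => hm k (hs hk)) (fun k hk => hl k (hs hk))
      (fun k hk l hl => hd k (hs hk) l (hs hl))]
    rw [← ind_eq r (s := ⋃ i ∈ R \ J, s i) (t := (⋃ i ∈ R \ J, s i)ᶜ) ((hE J hJ).inter (hN J hJ))
      (hN _ hs) (Loc.forallT fun k hk => hl k (hs hk)) ((hEl J hJ).inter ((Loc.forallT fun k hk => hl k (hJ hk)).mono ?_))
      disjoint_compl_right]
    · congr 1
      ext ω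
      simp only [Set.mem_inter_iff, Set.mem_ofPred_eq, Finset.mem_sdiff]
      constructor
      · rintro ⟨⟨h1, h2⟩, h3⟩
        exact ⟨h1, fun i hi => by by_cases hiJ : i ∈ J; exact h2 i hiJ; exact h3 i ⟨hi, hiJ⟩⟩
      · rintro ⟨h1, h2⟩
        exact ⟨⟨h1, fun i hi => h2 i (hJ hi)⟩, fun i hi => h2 i hi.1⟩
    · rw [Set.subset_compl_iff_disjoint_left, Set.disjoint_iUnion₂_left]
      intro i hi
      rw [Set.disjoint_iUnion₂_right]
      intro j hj
      refine hd i (hs hi) j (hJ hj) ?_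
      rintro rfl
      exact (Finset.mem_sdiff.1 hi).2 hj
  rw [← ENNReal.mul_le_mul_iff_left hP0 hPt]
  set Q := R.powerset.filter (fun J => n ≤ J.card) with hQ
  have hQR : ∀ J ∈ Q, J ⊆ R := fun J hJ => Finset.mem_powerset.1 (Finset.mem_filter.1 hJ).1
  calc _ ≤ (∑ J ∈ Q, PM r (E J ∩ {ω | ∀ i ∈ J, ω ∈ nf i})) * ∏ i ∈ R, PM r (nf i) := by
        gcongr; exact measure_biUnion_finset_le _ _
    _ = ∑ J ∈ Q, PM r (E J ∩ {ω | ∀ i ∈ J, ω ∈ nf i}) * ∏ i ∈ R, PM r (nf i) := Finset.sum_mul _ _ _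
    _ ≤ ∑ J ∈ Q, θ ^ n * PM r (E J ∩ {ω | ∀ i ∈ R, ω ∈ nf i}) := by
        refine Finset.sum_le_sum fun J hJ => ?_
        rw [← h1 J (hQR J hJ), ← Finset.prod_sdiff (hQR J hJ)]
        have : ∏ i ∈ J, PM r (nf i) ≤ θ ^ n :=
          (Finset.prod_le_pow_card _ _ _ fun i hi => hθ i (hQR J hJ hi)).trans
            (pow_le_pow_right_of_le_one' hθ1 (Finset.mem_filter.1 hJ).2)
        calc _ ≤ PM r (E J ∩ {ω | ∀ i ∈ J, ω ∈ nf i}) * ((∏ i ∈ R \ J, PM r (nf i)) * θ ^ n) := by gcongr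
          _ = _ := by ring
    _ = θ ^ n * ∑ J ∈ Q, PM r (E J ∩ {ω | ∀ i ∈ R, ω ∈ nf i}) := by rw [Finset.mul_sum]
    _ = θ ^ n * PM r (⋃ J ∈ Q, E J ∩ {ω | ∀ i ∈ R, ω ∈ nf i}) := by
        rw [measure_biUnion_finset]
        · intro J hJ J' hJ' hne
          exact (hEd J (hQR J hJ) J' (hQR J' hJ') hne).mono Set.inter_subset_left Set.inter_subset_left
        · intro J hJ; exact (hE J (hQR J hJ)).inter (hN R le_rfl)
    _ ≤ θ ^ n * PM r (G ∩ {ω | ∀ i ∈ R, ω ∈ nf i}) := by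
        gcongr
        refine Set.iUnion₂_subset fun J hJ => ?_
        exact Set.inter_subset_inter_left _ (hEG J (hQR J hJ))
    _ = _ := by
        rw [ind_eq r (s := ⋃ i ∈ R, s i) (t := (⋃ i ∈ R, s i)ᶜ) hG (hN R le_rfl) (Loc.forallT hl) hGl
          disjoint_compl_right, ind_prod r R s nf hm hl hd, mul_assoc]

end spr

/-- sample space with three layers -/
abbrev Om (d : ℕ) := Edge d × Fin 3 → Bool

def la (ω : Om d) : Config d := fun e => ω (e, 0)
def wp (ω : Om d) : Config d := fun e => ω (e, 0) || ω (e, 1)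
def wq (ω : Om d) : Config d := fun e => (ω (e, 0) || ω (e, 1)) || ω (e, 2)

/-- parameters of the layers -/
def rr (p β κ : unitInterval) : Edge d × Fin 3 → unitInterval := fun x => ![p, β, κ] x.2

lemma la_le (ω : Om d) : la ω ≤ wp ω := by
  intro e; unfold la wp; cases ω (e, 0) <;> simp

lemma wp_le (ω : Om d) : wp ω ≤ wq ω := by
  intro e; unfold wp wq; cases ω (e, 0) <;> cases ω (e, 1) <;> simp

lemma measurable_la : Measurable (la : Om d → Config d) :=
  measurable_pi_lambda _ fun e => measurable_pi_apply _

lemma measurable_loc {T : Type*} [MeasurableSpace T] {ι : Type*} {s : Set ι} (hs : s.Finite) (f : (ι → Bool) → T)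
    (h : ∀ x y : ι → Bool, (∀ i ∈ s, x i = y i) → f x = f y) : Measurable f := by
  intro A _
  have : Loc s (f ⁻¹' A) := fun x y hxy hx => by
    rw [Set.mem_preimage, ← h x y hxy]; exact hx
  exact this.measurable hs

lemma measurable_wp : Measurable (wp : Om d → Config d) :=
  measurable_pi_lambda _ fun e => measurable_loc (s := {(e, 0), (e, 1)}) (Set.toFinite _) _
    fun x y h => by simp [wp, h (e, 0), h (e, 1)]

lemma measurable_wq : Measurable (wq : Om d → Config d) :=
  measurable_pi_lambda _ fun e => measurable_loc (s := {(e, 0), (e, 1), (e, 2)}) (Set.toFinite _) _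
    fun x y h => by simp [wq, h (e, 0), h (e, 1), h (e, 2)]

/-- law of an edgewise function of the layers -/
lemma law_of (p β κ : unitInterval) (q : unitInterval) (f : Om d → Config d)
    (hf : ∀ e (x y : Om d), (∀ i, x (e, i) = y (e, i)) → f x e = f y e)
    (h1 : ∀ e, PM (rr p β κ) {ω : Om d | f ω e = false} = ENNReal.ofReal (1 - q)) :
    (PM (rr p β κ)).map f = PM (fun _ : Edge d => q) := by
  have hloc : ∀ (e : Edge d) (b : Bool), Loc {x : Edge d × Fin 3 | x.1 = e} {ω : Om d | f ω e = b} := by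
    intro e b x y hxy hx
    have hx : f x e = b := hx
    show f y e = b
    rw [← hx]; exact (hf e x y fun i => hxy (e, i) rfl).symm
  have hfin : ∀ e : Edge d, {x : Edge d × Fin 3 | x.1 = e}.Finite := by
    intro e
    refine (Set.finite_range (fun i : Fin 3 => (e, i))).subset ?_
    rintro ⟨e', i⟩ h
    exact ⟨i, by rw [← (show e' = e from h)]⟩
  have hme : ∀ (e : Edge d) (b : Bool), MeasurableSet {ω : Om d | f ω e = b} := fun e b =>
    (hloc e b).measurable (hfin e)
  have hm : Measurable f := measurable_pi_lambda _ fun e => by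
    intro A _
    have : Loc {x : Edge d × Fin 3 | x.1 = e} ((fun c => f c e) ⁻¹' A) := fun x y hxy hx => by
      rw [Set.mem_preimage, ← hf e x y fun i => hxy (e, i) rfl]; exact hx
    exact this.measurable (hfin e)
  have hpr : IsProbabilityMeasure ((PM (rr p β κ)).map f) := Measure.isProbabilityMeasure_map hm.aemeasurable
  have h2 : ∀ e b, PM (rr p β κ) {ω : Om d | f ω e = b} = bern q {b} := by
    intro e b
    cases b
    · rw [h1, bern_false]
    · have : {ω : Om d | f ω e = true} = {ω : Om d | f ω e = false}ᶜ := by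
        ext ω; simp
      rw [this, prob_compl_eq_one_sub (hme e false), h1, bern_true]
      rw [← ENNReal.ofReal_one, ← ENNReal.ofReal_sub _ (by linarith [q.2.2])]; congr 1; ring
  refine PM_char _ _ fun s g => ?_
  have hms : MeasurableSet {ω : Config d | ∀ e ∈ s, ω e = g e} := by
    refine Loc.measurable (s := (s : Set (Edge d))) (fun x y hxy hx e he => ?_) s.finite_toSet
    rw [← hxy e he]; exact hx e he
  rw [Measure.map_apply hm hms]
  have := ind_prod (rr p β κ) s (fun e => {x : Edge d × Fin 3 | x.1 = e}) (fun e => {ω : Om d | f ω e = g e})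
    (fun e _ => hme e _) (fun e _ => hloc e _) (fun e _ e' _ hne => by
      rw [Set.disjoint_left]; intro x h1 h2; exact hne (h1.symm.trans h2))
  simp only [h2] at this
  exact this

lemma law_la (p β κ : unitInterval) : (PM (rr p β κ)).map la = PM (fun _ : Edge d => p) := by
  refine law_of p β κ p la (fun e x y h => h 0) fun e => ?_
  have := PM_coord (rr p β κ) ((e, 0) : Edge d × Fin 3) false
  rw [bern_false] at this
  exact this

lemma closed_wp (p β κ : unitInterval) (e : Edge d) :
    PM (rr p β κ) {ω : Om d | wp ω e = false} = ENNReal.ofReal (1 - p) * ENNReal.ofReal (1 - β) := by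
  classical
  have := PM_cyl (rr p β κ) {((e, 0) : Edge d × Fin 3), (e, 1)} (fun _ => false)
  rw [Finset.prod_pair (by simp), bern_false, bern_false] at this
  rw [show {ω : Om d | wp ω e = false} = {ω | ∀ x ∈ ({(e, 0), (e, 1)} : Finset (Edge d × Fin 3)), ω x = false} by
    ext ω; simp [wp]]
  exact this

lemma closed_wq (p β κ : unitInterval) (e : Edge d) :
    PM (rr p β κ) {ω : Om d | wq ω e = false} =
      ENNReal.ofReal (1 - p) * ENNReal.ofReal (1 - β) * ENNReal.ofReal (1 - κ) := by
  classical
  have := PM_cyl (rr p β κ) {((e, 0) : Edge d × Fin 3), (e, 1), (e, 2)} (fun _ => false)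
  rw [Finset.prod_insert (by simp), Finset.prod_pair (by simp), bern_false, bern_false, bern_false, ← mul_assoc] at this
  rw [show {ω : Om d | wq ω e = false} = {ω | ∀ x ∈ ({(e, 0), (e, 1), (e, 2)} : Finset (Edge d × Fin 3)), ω x = false} by
    ext ω; simp [wq, and_assoc]]
  exact this

lemma law_wp (p β κ q : unitInterval) (h : (1 - q : ℝ) = (1 - p) * (1 - β)) :
    (PM (rr p β κ)).map wp = PM (fun _ : Edge d => q) := by
  refine law_of p β κ q wp (fun e x y h => by simp [wp, h]) fun e => ?_
  rw [closed_wp, h, ENNReal.ofReal_mul (by linarith [p.2.2])]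

lemma law_wq (p β κ q : unitInterval) (h : (1 - q : ℝ) = (1 - p) * (1 - β) * (1 - κ)) :
    (PM (rr p β κ)).map wq = PM (fun _ : Edge d => q) := by
  refine law_of p β κ q wq (fun e x y h => by simp [wq, h]) fun e => ?_
  have h1 : (0 : ℝ) ≤ 1 - p := by linarith [p.2.2]
  have h2 : (0 : ℝ) ≤ 1 - β := by linarith [β.2.2]
  rw [closed_wq, h, ENNReal.ofReal_mul (mul_nonneg h1 h2), ENNReal.ofReal_mul h1]

end

section
variable {d : ℕ}

/-- configurations agreeing on the edges touching the cluster have the same cluster -/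
lemma cluster_congr {x x' : Config d} {S : Set (V d)} {w : V d}
    (h : ∀ (b c : V d) (hbc : sym2dist1 s(b, c) = 1), b ∈ S → c ∈ S → Conn x S w b →
      x ⟨s(b, c), hbc⟩ = x' ⟨s(b, c), hbc⟩) (v : V d) : Conn x S w v ↔ Conn x' S w v := by
  constructor
  · intro hv
    induction hv with
    | refl => exact Conn.refl _
    | @tail b c hb hbc ih =>
      obtain ⟨⟨h1, h2⟩, h3, h4⟩ := hbc
      refine Relation.ReflTransGen.tail ih ⟨⟨h1, ?_⟩, h3, h4⟩
      exact (h b c h1 h3 h4 hb).symm.trans h2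
  · intro hv
    induction hv with
    | refl => exact Conn.refl _
    | @tail b c hb hbc ih =>
      obtain ⟨⟨h1, h2⟩, h3, h4⟩ := hbc
      refine Relation.ReflTransGen.tail ih ⟨⟨h1, ?_⟩, h3, h4⟩
      exact (h b c h1 h3 h4 ih).trans h2

namespace Pr
variable {P : Pr d}

lemma Dm_r {k : ℕ} {w u : V d} (hu : u ∈ cb (P.z k w) (5 * P.A)) : P.Dm k u ⊆ cb w (P.r k) := by
  intro y hy
  have hU := P.U0 k
  refine cb_mono (cb_trans (cb_trans hy (sc_cb hU.le hu)) (cb_symm (P.w_cb k w))) ?_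
  rw [r_eq]; nlinarith

lemma Dm_r' {k : ℕ} {w : V d} : P.Dm k (P.z k w) ⊆ cb w (P.r k) :=
  Dm_r (cb_self (by have := P.A100; linarith))

lemma Lam_r {k : ℕ} {w : V d} : P.Lam k w ⊆ cb w (P.r k) := fun y hy =>
  cb_mono (cb_trans hy (cb_symm (P.w_cb k w))) (by
    have hU := P.U0 k
    have hA := P.A100
    have hc : (0 : ℤ) ≤ P.c := by positivity
    rw [r_eq]; nlinarith)

/-- the tile of index `i` -/
def tile (P : Pr d) (i : V d) : Set (V d) := cb (sc P.M i) P.h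

lemma tile_idx {v i : V d} : v ∈ P.tile i ↔ P.idx v = i :=
  ⟨fun h => P.idx_eq h, fun h => h ▸ P.idx_cb v⟩

lemma tile_disj {i j : V d} (h : i ≠ j) : Disjoint (P.tile i) (P.tile j) := by
  rw [Set.disjoint_left]
  intro v h1 h2
  exact h ((tile_idx.1 h1).symm.trans (tile_idx.1 h2))

/-- layer-1 edges of a tile -/
def ts (P : Pr d) (i : V d) : Set (Edge d × Fin 3) := {x | x.1 ∈ EdgesIn (P.tile i) ∧ x.2 = 1}

lemma ts_fin (i : V d) : (P.ts i).Finite := by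
  refine ((EdgesIn_finite (cb_finite _ _ : (P.tile i).Finite)).prod (Set.finite_univ (α := Fin 3))).subset ?_
  rintro ⟨e, j⟩ ⟨h, -⟩; exact ⟨h, trivial⟩

/-- the tile is not fully open in layer 1 -/
def nf (P : Pr d) (i : V d) : Set (Om d) := {ω | ∃ e ∈ EdgesIn (P.tile i), ω (e, 1) = false}

lemma nf_loc (i : V d) : Loc (P.ts i) (P.nf i) := by
  rintro x y h ⟨e, he, h2⟩
  exact ⟨e, he, (h (e, 1) ⟨he, rfl⟩).symm.trans h2⟩

lemma nf_compl {p β κ : unitInterval} (i : V d) :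
    PM (rr p β κ) (P.nf i)ᶜ = ENNReal.ofReal β ^ (P.ts_fin i).toFinset.card := by
  have := PM_cyl (rr p β κ) (P.ts_fin i).toFinset (fun _ => true)
  rw [Finset.prod_congr rfl (g := fun _ => ENNReal.ofReal β), Finset.prod_const] at this
  · rw [← this]; congr 1
    ext ω
    simp only [Set.mem_compl_iff, nf, Set.mem_ofPred_eq, Set.Finite.mem_toFinset, not_exists, not_and]
    constructor
    · rintro h ⟨e, j⟩ ⟨h1, h2⟩
      have h2 : j = 1 := h2
      subst h2
      simpa using h e h1
    · intro h e he
      simpa using h (e, 1) ⟨he, rfl⟩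
  · rintro ⟨e, j⟩ he
    rw [Set.Finite.mem_toFinset] at he
    have h2 : j = 1 := he.2
    subst h2
    exact bern_true _

/-- bound on the number of edges of a tile -/
def mE (P : Pr d) : ℕ := ((2 * P.h + 1) ^ d + 1).choose 2

lemma ts_card (i : V d) : (P.ts_fin i).toFinset.card ≤ P.mE := by
  classical
  have : (P.ts_fin i).toFinset.card ≤ ((cbF (sc (P.M : ℤ) i) (P.h : ℤ)).sym2).card := by
    refine Finset.card_le_card_of_injOn (fun x => x.1.1) ?_ ?_
    · rintro ⟨e, j⟩ he
      rw [Finset.mem_coe, Set.Finite.mem_toFinset] at he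
      simp only [Finset.mem_coe, Finset.mem_sym2_iff, mem_cbF]
      exact he.1
    · rintro ⟨e, j⟩ he ⟨e', j'⟩ he' h
      rw [Finset.mem_coe, Set.Finite.mem_toFinset] at he he'
      have h1 : e = e' := Subtype.ext h
      have h2 : j = j' := (show j = 1 from he.2).trans (show j' = 1 from he'.2).symm
      rw [h1, h2]
  refine this.trans ?_
  rw [Finset.card_sym2, card_cbF]; rfl

lemma nf_le {p β κ : unitInterval} {δ : ℝ≥0∞} (hδ : δ ≤ ENNReal.ofReal β) (i : V d) :
    PM (rr p β κ) (P.nf i) ≤ 1 - δ ^ P.mE := by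
  have hm : MeasurableSet (P.nf i) := (nf_loc i).measurable (ts_fin i)
  have h1 := prob_compl_eq_one_sub (μ := PM (rr p β κ)) hm.compl
  rw [compl_compl] at h1
  rw [h1, nf_compl]
  refine tsub_le_tsub_left ?_ _
  calc δ ^ P.mE ≤ ENNReal.ofReal β ^ P.mE := by gcongr
    _ ≤ _ := pow_le_pow_right_of_le_one' (by rw [ENNReal.ofReal_le_one]; exact β.2.2) (ts_card i)

lemma nf_ne {p β κ : unitInterval} (hβ : (β : ℝ) < 1) (i : V d) : PM (rr p β κ) (P.nf i) ≠ 0 := by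
  have hm : MeasurableSet (P.nf i) := (nf_loc i).measurable (ts_fin i)
  have h1 := prob_compl_eq_one_sub (μ := PM (rr p β κ)) hm.compl
  rw [compl_compl] at h1
  rw [h1, nf_compl]
  have h2 : ENNReal.ofReal β < 1 := by rw [ENNReal.ofReal_lt_one]; exact hβ
  have h3 : (P.ts_fin i).toFinset.card ≠ 0 := by
    have hd := P.hd
    have hh := P.hh
    let v : V d := Function.update (sc P.M i) ⟨0, by omega⟩ (sc P.M i ⟨0, by omega⟩ + 1)
    have hv : dist1 (sc P.M i) v = 1 := by
      unfold dist1
      rw [Finset.sum_eq_single (⟨0, by omega⟩ : Fin d)]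
      · simp [v]
      · intro b _ hb; simp [v, Function.update_of_ne hb]
      · simp
    rw [Finset.card_ne_zero]
    refine ⟨(⟨s(sc P.M i, v), hv⟩, 1), ?_⟩
    rw [Set.Finite.mem_toFinset]
    refine ⟨?_, rfl⟩
    intro u hu
    rw [Sym2.mem_iff] at hu
    rcases hu with rfl | rfl
    · exact cb_self (by positivity)
    · refine cb_mono (cb_symm (cb_of_dist1 (n := 1) hv.le)) (by exact_mod_cast hh)
  have h4 : ENNReal.ofReal β ^ (P.ts_fin i).toFinset.card < 1 := pow_lt_one₀ (zero_le) h2 h3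
  exact (tsub_pos_of_lt h4).ne'

/-- bad event after deleting the edge `ww'` -/
def BadE (P : Pr d) (k : ℕ) (w w' : V d) (ω : Om d) : Prop :=
  P.Bad (delc w w' (la ω)) (delc w w' (wp ω)) k w

/-- dependence set -/
def dep (P : Pr d) (k : ℕ) (w : V d) : Set (Edge d × Fin 3) := {x | x.1 ∈ EdgesIn (cb w (P.r k))}

lemma dep_fin (k : ℕ) (w : V d) : (P.dep k w).Finite := by
  refine ((EdgesIn_finite (cb_finite w (P.r k))).prod (Set.finite_univ (α := Fin 3))).subset ?_
  rintro ⟨e, j⟩ h; exact ⟨h, trivial⟩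

lemma BadE_loc (k : ℕ) (w w' : V d) : Loc (P.dep k w) {ω | P.BadE k w w' ω} := by
  intro x y h hx
  refine (Bad_congr (fun e he => ?_) (fun e he => ?_)).1 hx
  · exact delc_congr (h (e, 0) he)
  · refine delc_congr ?_
    have h0 := h (e, 0) he
    have h1 := h (e, 1) he
    simp only [wp, h0, h1]

/-- tile `i` is touched by the cluster of `w` -/
def tch (P : Pr d) (k : ℕ) (w : V d) (x : Config d) (i : V d) : Prop :=
  ∃ v ∈ P.tile i, Conn x (P.Lam k w) w v

lemma key (k : ℕ) (w w' : V d) {ω : Om d} (h1 : P.F1 (delc w w' (la ω)) k w)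
    (h2 : ¬ P.F2 (delc w w' (la ω)) (delc w w' (wp ω)) k w) :
    (∃ T : Finset (V d), 2 ^ k ≤ T.card ∧ ∀ i ∈ T, i ∈ P.Ac (delc w w' (la ω)) k (P.z k w) ∧
      P.tch k w (delc w w' (wp ω)) i) ∧
    ∀ i ∈ P.Ac (delc w w' (la ω)) k (P.z k w), i ≠ P.idx w → P.tch k w (delc w w' (wp ω)) i → ω ∈ P.nf i := by
  have hg := F1_self h1
  unfold F2 at h2
  push Not at h2
  obtain ⟨v, hv, hv2, hc, hno⟩ := h2
  constructor
  · obtain ⟨n, f, hf, hf0, hfn, hfL⟩ := path_of_conn hc (P.w_Lam k w)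
    obtain ⟨T, hT, hT1, hT2⟩ := crossing P.hd P.s0 P.hA' P.hodd' k (fun t => P.idx (f t)) (P.z k w) 0 n hg
      (Nat.zero_le _) (fun t _ ht => P.idx_step (r := 1) (by have := P.M0; linarith) (edgeOpen_cb (hf t ht)))
      (by simp only [hf0]; rfl) (by simp only [hfn]; exact hv2)
    refine ⟨T, hT, fun i hi => ⟨hT1 i hi, ?_⟩⟩
    obtain ⟨t, -, ht, hti⟩ := hT2 i hi
    refine ⟨f t, tile_idx.2 hti, ?_⟩
    have := conn_of_path (ω := delc w w' (wp ω)) (S := P.Lam k w) (n := t) (f := f)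
      (fun j hj => hf j (by omega)) (fun j hj => hfL j (by omega))
    rwa [hf0] at this
  · rintro i hi hiw ⟨u, hu, hcu⟩
    by_contra hnf
    have hop : ∀ e ∈ EdgesIn (P.tile i), ω (e, 1) = true := by
      intro e he
      by_contra hcon
      exact hnf ⟨e, he, by simpa using hcon⟩
    have hgi := Acc_good P.s0 hg hi
    obtain ⟨y, hy⟩ := hgi.1
    have hyt : y ∈ P.tile i := cb_mono hy.1 (by exact_mod_cast P.hR)
    have hc2 : Conn (delc w w' (wp ω)) (P.tile i) u y := by
      have := nc_cb hu hyt
      refine Conn.congr_le this fun e he => ?_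
      rw [delc_ne, wp, hop e he]; simp
      intro hc
      have := he w (by rw [hc]; simp)
      exact hiw (tile_idx.1 this).symm
    have hsub : P.tile i ⊆ P.Lam k w := by
      intro y hy
      have h2 := cb_trans hy (sc_cb P.M0.le (Acc_cb (by have := P.A100; linarith) hi))
      rw [sc_sc] at h2
      refine cb_mono h2 ?_
      have := P.MU k
      have := P.eM
      rw [U_eq] at *
      linarith
    exact hno y ⟨i, hi, hy⟩ (hcu.trans (hc2.mono le_rfl hsub))

open Classical in
lemma F2_tail {p β κ : unitInterval} (hβ : (β : ℝ) < 1) {δ : ℝ≥0∞} (hδ : δ ≤ ENNReal.ofReal β)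
    (k : ℕ) (w w' : V d) :
    PM (rr p β κ) {ω : Om d | P.F1 (delc w w' (la ω)) k w ∧ ¬ P.F2 (delc w w' (la ω)) (delc w w' (wp ω)) k w} ≤
      (1 - δ ^ P.mE) ^ (2 ^ k - 1) := by
  set μ := PM (rr (d := d) p β κ) with hμ
  set θ := 1 - δ ^ P.mE with hθ
  set Q := (cbF (sc ((P.A : ℤ) ^ k) (P.z k w)) (4 * (P.A : ℤ) ^ k)).powerset with hQ
  let G : Finset (V d) → Set (Om d) := fun R => {ω | P.Gd (delc w w' (la ω)) k (P.z k w) ∧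
    P.Ac (delc w w' (la ω)) k (P.z k w) \ {P.idx w} = ↑R}
  let E : Finset (V d) → Finset (V d) → Set (Om d) := fun R J => G R ∩
    {ω | ∀ i ∈ R, (P.tch k w (delc w w' (wp ω)) i ↔ i ∈ J)}
  have hL0 : ∀ R, Loc {x : Edge d × Fin 3 | x.2 = 0 ∧ x ∈ P.dep k w} (G R) := by
    rintro R x y h ⟨h1, h2⟩
    have hag : ∀ e ∈ EdgesIn (P.Dm k (P.z k w)), delc w w' (la x) e = delc w w' (la y) e :=
      fun e he => delc_congr (h (e, 0) ⟨rfl, EdgesIn_mono Dm_r' he⟩)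
    refine ⟨(Gd_congr hag).1 h1, ?_⟩
    rw [← Ac_congr hag]; exact h2
  have hdis : ∀ R : Finset (V d), {x : Edge d × Fin 3 | x.2 = 0 ∧ x ∈ P.dep k w} ⊆ (⋃ i ∈ R, P.ts i)ᶜ := by
    rintro R ⟨e, j⟩ ⟨h, -⟩ hc
    obtain ⟨i, -, -, h2⟩ := Set.mem_iUnion₂.1 hc
    have h : j = 0 := h
    have h2 : j = 1 := h2
    rw [h] at h2; exact absurd h2 (by simp)
  have hGm : ∀ R, MeasurableSet (G R) := fun R =>
    (hL0 R).measurable ((dep_fin k w).subset fun x hx => hx.2)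
  have hEm : ∀ R J, MeasurableSet (E R J) := by
    intro R J
    refine Loc.measurable (s := P.dep k w) (Loc.inter ((hL0 R).mono fun x hx => hx.2) ?_) (dep_fin k w)
    intro x y h hx i hi
    rw [← hx i hi]
    unfold tch
    refine exists_congr fun v => and_congr_right fun _ => ?_
    have hag : ∀ e ∈ EdgesIn (P.Lam k w), delc w w' (wp y) e = delc w w' (wp x) e := fun e he => by
      have he' := EdgesIn_mono Lam_r he
      refine delc_congr ?_
      simp only [wp, h (e, 0) he', h (e, 1) he']
    exact ⟨fun h => h.congr_le fun e he => (hag e he).le, fun h => h.congr_le fun e he => (hag e he).ge⟩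
  have hEl : ∀ R, ∀ J ⊆ R, Loc (⋃ i ∈ R \ J, P.ts i)ᶜ (E R J) := by
    rintro R J hJ x y h ⟨hx1, hx2⟩
    refine ⟨((hL0 R).mono (hdis (R \ J))) x y h hx1, ?_⟩
    intro i hi
    rw [← hx2 i hi]
    unfold tch
    refine exists_congr fun v => and_congr_right fun _ => ?_
    refine (cluster_congr ?_ v).symm
    intro b c hbc hb hc hconn
    refine delc_congr ?_
    have e0 : x (⟨s(b, c), hbc⟩, 0) = y (⟨s(b, c), hbc⟩, 0) := by
      refine h _ ?_
      intro hcon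
      obtain ⟨i, -, -, h2⟩ := Set.mem_iUnion₂.1 hcon
      exact absurd h2 (by simp)
    have e1 : x (⟨s(b, c), hbc⟩, 1) = y (⟨s(b, c), hbc⟩, 1) := by
      refine h _ ?_
      intro hcon
      obtain ⟨i, hi, h3, -⟩ := Set.mem_iUnion₂.1 hcon
      have hbi : b ∈ P.tile i := h3 b (by simp)
      obtain ⟨hi1, hi2⟩ := Finset.mem_sdiff.1 hi
      exact hi2 ((hx2 i hi1).1 ⟨b, hbi, hconn⟩)
    simp only [wp, e0, e1]
  have hsub : {ω : Om d | P.F1 (delc w w' (la ω)) k w ∧ ¬ P.F2 (delc w w' (la ω)) (delc w w' (wp ω)) k w} ⊆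
      ⋃ R ∈ Q, ⋃ J ∈ R.powerset.filter (fun J => 2 ^ k - 1 ≤ J.card), (E R J ∩ {ω | ∀ i ∈ J, ω ∈ P.nf i}) := by
    rintro ω ⟨h1, h2⟩
    obtain ⟨⟨T, hT, hT2⟩, h3⟩ := key k w w' h1 h2
    have hAc : ∀ i ∈ P.Ac (delc w w' (la ω)) k (P.z k w), i ∈ cbF (sc ((P.A : ℤ) ^ k) (P.z k w)) (4 * (P.A : ℤ) ^ k) :=
      fun i hi => mem_cbF.2 (Acc_cb (by have := P.A100; linarith) hi)
    have hfin : (P.Ac (delc w w' (la ω)) k (P.z k w) \ {P.idx w}).Finite :=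
      (Finset.finite_toSet _).subset fun i hi => hAc i hi.1
    let R := hfin.toFinset
    have hR : ∀ i, i ∈ R ↔ i ∈ P.Ac (delc w w' (la ω)) k (P.z k w) ∧ i ≠ P.idx w := by
      intro i; simp [R]
    let J := R.filter (fun i => P.tch k w (delc w w' (wp ω)) i)
    refine Set.mem_iUnion₂.2 ⟨R, ?_, Set.mem_iUnion₂.2 ⟨J, ?_, ⟨⟨F1_self h1, ?_⟩, ?_⟩, ?_⟩⟩
    · rw [hQ, Finset.mem_powerset]; exact fun i hi => hAc i ((hR i).1 hi).1
    · rw [Finset.mem_filter, Finset.mem_powerset]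
      refine ⟨Finset.filter_subset _ _, ?_⟩
      calc 2 ^ k - 1 ≤ T.card - 1 := by omega
        _ ≤ (T.erase (P.idx w)).card := Finset.pred_card_le_card_erase
        _ ≤ J.card := by
          refine Finset.card_le_card fun i hi => ?_
          obtain ⟨hi1, hi2⟩ := Finset.mem_erase.1 hi
          exact Finset.mem_filter.2 ⟨(hR i).2 ⟨(hT2 i hi2).1, hi1⟩, (hT2 i hi2).2⟩
    · simp [R]
    · intro i hi
      simp [J, hi]
    · intro i hi
      obtain ⟨hi1, hi2⟩ := Finset.mem_filter.1 hi
      exact h3 i ((hR i).1 hi1).1 ((hR i).1 hi1).2 hi2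
  calc _ ≤ μ (⋃ R ∈ Q, ⋃ J ∈ R.powerset.filter (fun J => 2 ^ k - 1 ≤ J.card), (E R J ∩ {ω | ∀ i ∈ J, ω ∈ P.nf i})) :=
        measure_mono hsub
    _ ≤ ∑ R ∈ Q, μ (⋃ J ∈ R.powerset.filter (fun J => 2 ^ k - 1 ≤ J.card), (E R J ∩ {ω | ∀ i ∈ J, ω ∈ P.nf i})) :=
        measure_biUnion_finset_le _ _
    _ ≤ ∑ R ∈ Q, θ ^ (2 ^ k - 1) * μ (G R) := by
        refine Finset.sum_le_sum fun R _ => ?_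
        refine spr (rr p β κ) R P.ts P.nf (fun i _ => (nf_loc i).measurable (ts_fin i)) (fun i _ => nf_loc i) ?_ θ
          (fun i _ => nf_le hδ i) tsub_le_self (fun i _ => nf_ne hβ i) (E R) (fun J _ => hEm R J) (hEl R) ?_ (G R)
          (fun J _ => Set.inter_subset_left) (hGm R) ((hL0 R).mono (hdis R)) _
        · intro i _ j _ hij
          rw [Set.disjoint_left]
          rintro ⟨e, l⟩ h1 h2
          exact Set.disjoint_left.1 (EdgesIn_disj (tile_disj hij)) h1.1 h2.1
        · intro J hJ J' hJ' hne
          rw [Set.disjoint_left]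
          rintro ω ⟨-, h1⟩ ⟨-, h2⟩
          apply hne
          ext i
          constructor
          · intro hi; exact (h2 i (hJ hi)).1 ((h1 i (hJ hi)).2 hi)
          · intro hi; exact (h1 i (hJ' hi)).1 ((h2 i (hJ' hi)).2 hi)
    _ = θ ^ (2 ^ k - 1) * μ (⋃ R ∈ Q, G R) := by
        rw [← Finset.mul_sum, measure_biUnion_finset]
        · intro R _ R' _ hne
          rw [Function.onFun, Set.disjoint_left]
          rintro ω ⟨-, h1⟩ ⟨-, h2⟩
          exact hne (Finset.coe_injective (h1.symm.trans h2))
        · exact fun R _ => hGm R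
    _ ≤ θ ^ (2 ^ k - 1) * 1 := by gcongr; exact prob_le_one
    _ = _ := mul_one _

end Pr
end

section
variable {d : ℕ}

section greedy
variable {ι : Type*}

open Classical in
lemma exp2 (r : ι → unitInterval) (U : Finset (V d)) (B : V d → Set (ι → Bool)) (hm : ∀ w, MeasurableSet (B w))
    (π : ℝ≥0∞) (hB : ∀ T ⊆ U, PM r {ω | ∀ w ∈ T, ω ∈ B w} ≤ π ^ T.card) :
    ∫⁻ ω, (2 : ℝ≥0∞) ^ (U.filter (fun w => ω ∈ B w)).card ∂(PM r) ≤ (1 + π) ^ U.card := by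
  have h1 : ∀ ω : ι → Bool, (2 : ℝ≥0∞) ^ (U.filter (fun w => ω ∈ B w)).card =
      ∑ T ∈ U.powerset, Set.indicator {ω | ∀ w ∈ T, ω ∈ B w} (fun _ => (1 : ℝ≥0∞)) ω := by
    intro ω
    simp only [Set.indicator_apply, Set.mem_ofPred_eq]
    rw [Finset.sum_boole]
    have : U.powerset.filter (fun T => ∀ w ∈ T, ω ∈ B w) = (U.filter (fun w => ω ∈ B w)).powerset := by
      ext T
      simp only [Finset.mem_filter, Finset.mem_powerset]
      constructor
      · rintro ⟨h1, h2⟩ w hw; exact Finset.mem_filter.2 ⟨h1 hw, h2 w hw⟩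
      · intro h; exact ⟨fun w hw => (Finset.mem_filter.1 (h hw)).1, fun w hw => (Finset.mem_filter.1 (h hw)).2⟩
    rw [this, Finset.card_powerset]; push_cast; rfl
  simp only [h1]
  rw [lintegral_finsetSum _ fun T _ => measurable_const.indicator (meas_forallT fun k _ => hm k)]
  calc _ ≤ ∑ T ∈ U.powerset, π ^ T.card * 1 ^ (U.card - T.card) := by
        refine Finset.sum_le_sum fun T hT => ?_
        rw [lintegral_indicator (meas_forallT fun k _ => hm k)]
        simp only [lintegral_const, Measure.restrict_apply MeasurableSet.univ, Set.univ_inter, one_mul, one_pow, mul_one]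
        exact hB T (Finset.mem_powerset.1 hT)
    _ = (1 + π) ^ U.card := by rw [Finset.sum_pow_mul_eq_add_pow, add_comm]

lemma four_pow {π : ℝ≥0∞} {b : ℕ} (h : π * b ≤ 1) : (1 + π) ^ b ≤ 4 := by
  rcases Nat.eq_zero_or_pos b with rfl | hb
  · simp
  have hb0 : (b : ℝ≥0∞) ≠ 0 := by exact_mod_cast hb.ne'
  have hπ : π ≠ ⊤ := by
    rintro rfl
    rw [ENNReal.top_mul hb0] at h; simp at h
  lift π to NNReal using hπ
  have h' : (π : ℝ) * b ≤ 1 := by exact_mod_cast h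
  have : ((1 : ℝ) + π) ^ b ≤ 4 := by
    calc ((1 : ℝ) + π) ^ b ≤ (Real.exp π) ^ b := by
          gcongr; rw [add_comm]; exact Real.add_one_le_exp _
      _ = Real.exp (π * b) := by rw [← Real.exp_nat_mul, mul_comm]
      _ ≤ Real.exp 1 := by gcongr
      _ ≤ 4 := by have := Real.exp_one_lt_d9; linarith
  exact_mod_cast this

/-- coarse boxes -/
noncomputable def cbox (l : ℕ) (z : V d) : Finset (V d) := cbF (sc (l : ℤ) z) ((2 * l : ℕ) : ℤ)

open Classical in
noncomputable def UU (l : ℕ) : ℕ → V d → Finset (Finset (V d))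
  | 0, z => {cbox l z}
  | n + 1, z => (cbF z ((1 : ℕ) : ℤ)).biUnion fun z' => (UU l n z').image fun U => cbox l z ∪ U

lemma UU_card (l : ℕ) : ∀ (n : ℕ) (z : V d), (UU l n z).card ≤ (3 ^ d) ^ n := by
  intro n
  induction n with
  | zero => intro z; simp [UU]
  | succ n ih =>
    intro z
    rw [UU]
    refine Finset.card_biUnion_le.trans ?_
    calc _ ≤ ∑ z' ∈ cbF z ((1 : ℕ) : ℤ), (3 ^ d) ^ n := Finset.sum_le_sum fun z' _ =>
          Finset.card_image_le.trans (ih z')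
      _ = _ := by rw [Finset.sum_const, card_cbF, smul_eq_mul, pow_succ, mul_comm]

lemma UU_size (l : ℕ) (hl : 1 ≤ l) : ∀ (n : ℕ) (z : V d), ∀ U ∈ UU l n z, U.card ≤ (5 * l) ^ d * (n + 1) := by
  have hb : ∀ z : V d, (cbox l z).card ≤ (5 * l) ^ d := by
    intro z; rw [cbox, card_cbF]; gcongr; omega
  intro n
  induction n with
  | zero => intro z U hU; rw [UU, Finset.mem_singleton] at hU; rw [hU]; simpa using hb z
  | succ n ih =>
    intro z U hU
    rw [UU, Finset.mem_biUnion] at hU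
    obtain ⟨z', -, hU⟩ := hU
    obtain ⟨U', hU', rfl⟩ := Finset.mem_image.1 hU
    refine (Finset.card_union_le _ _).trans ?_
    have := hb z
    have := ih z' U' hU'
    nlinarith

lemma walk_cb {f : ℕ → V d} {m : ℕ} (hf : ∀ t < m, f (t + 1) ∈ cb (f t) 1) : ∀ t ≤ m, f t ∈ cb (f 0) t := by
  intro t
  induction t with
  | zero => intro _; exact cb_self (by simp)
  | succ t ih => intro h; exact cb_mono (cb_trans (hf t h) (ih (by omega))) (by push_cast; linarith)

lemma UU_path (l : ℕ) (hl : 1 ≤ l) : ∀ (n m : ℕ) (z : V d) (f : ℕ → V d), (∀ k, z k = f 0 k / l) →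
    (∀ t < m, f (t + 1) ∈ cb (f t) 1) → m < (n + 1) * l → ∃ U ∈ UU l n z, ∀ t ≤ m, f t ∈ U := by
  have hl0 : (0 : ℤ) < l := by exact_mod_cast hl
  have hbox : ∀ (m : ℕ) (z : V d) (f : ℕ → V d), (∀ k, z k = f 0 k / l) →
    (∀ t < m, f (t + 1) ∈ cb (f t) 1) → ∀ t ≤ m, t ≤ l → f t ∈ cbox l z := by
    intro m z f hz hf t ht htl
    rw [cbox, mem_cbF]
    have h1 : f 0 ∈ cb (sc (l : ℤ) z) l := by
      intro k
      simp only [sc, hz k]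
      have := Int.mul_ediv_add_emod (f 0 k) l
      have := Int.emod_nonneg (f 0 k) hl0.ne'
      have := Int.emod_lt_of_pos (f 0 k) hl0
      rw [abs_le]; constructor <;> linarith
    exact cb_mono (cb_trans (walk_cb hf t ht) h1) (by push_cast; omega)
  intro n
  induction n with
  | zero =>
    intro m z f hz hf hm
    exact ⟨cbox l z, by simp [UU], fun t ht => hbox m z f hz hf t ht (by omega)⟩
  | succ n ih =>
    intro m z f hz hf hm
    by_cases hml : m < l
    · obtain ⟨U, hU, -⟩ := ih 0 (fun k => f 0 k / l) f (fun k => rfl) (by intro t ht; omega) (by positivity)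
      refine ⟨cbox l z ∪ U, ?_, fun t ht => Finset.mem_union_left _ (hbox m z f hz hf t ht (by omega))⟩
      rw [UU, Finset.mem_biUnion]
      refine ⟨(fun k => f 0 k / l), ?_, Finset.mem_image_of_mem _ hU⟩
      rw [mem_cbF]
      intro k; rw [hz k]; simp
    · push Not at hml
      obtain ⟨U, hU, hU2⟩ := ih (m - l) (fun k => f l k / l) (fun t => f (l + t)) (fun k => rfl)
        (fun t ht => hf (l + t) (by omega)) (by
          have : (n + 1 + 1) * l = (n + 1) * l + l := by ring
          omega)
      refine ⟨cbox l z ∪ U, ?_, ?_⟩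
      · rw [UU, Finset.mem_biUnion]
        refine ⟨(fun k => f l k / l), ?_, Finset.mem_image_of_mem _ hU⟩
        rw [mem_cbF]
        intro k
        have h1 := abs_le.1 (walk_cb hf l hml k)
        rw [hz k]
        have e1 : f l k / l ≤ (f 0 k + 1 * l) / l := Int.ediv_le_ediv hl0 (by linarith)
        have e2 : (f 0 k + (-1) * l) / l ≤ f l k / l := Int.ediv_le_ediv hl0 (by linarith)
        rw [Int.add_mul_ediv_right _ _ hl0.ne'] at e1 e2
        rw [abs_le]; push_cast; constructor <;> linarith
      · intro t ht
        by_cases htl : t ≤ l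
        · exact Finset.mem_union_left _ (hbox m z f hz hf t ht htl)
        · have := hU2 (t - l) (by omega)
          rw [show l + (t - l) = t by omega] at this
          exact Finset.mem_union_right _ this

lemma nat_le_two (x t : ℕ) : (x : ℝ≥0∞) ≤ t + 2 ^ x / 2 ^ t := by
  by_cases h : x ≤ t
  · exact le_add_right (by exact_mod_cast h)
  · obtain ⟨y, rfl⟩ := Nat.exists_eq_add_of_le (le_of_not_ge h)
    rw [pow_add, mul_comm, mul_div_assoc, ENNReal.div_self (by simp) (by finiteness), mul_one]
    push_cast
    gcongr
    exact_mod_cast (Nat.lt_two_pow_self (n := y)).le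

open Classical in
/-- greedy lattice path bound -/
lemma greedy (r : ι → unitInterval) (B : V d → Set (ι → Bool)) (hm : ∀ w, MeasurableSet (B w))
    (π : ℝ≥0∞) (L : ℕ) (hL : 1 ≤ L)
    (hB : ∀ T : Finset (V d), (∀ w ∈ T, ∀ w' ∈ T, w ≠ w' → w ∉ cb w' ((L : ℤ) - 1)) →
      PM r {ω | ∀ w ∈ T, ω ∈ B w} ≤ π ^ T.card)
    (l : ℕ) (hl : 1 ≤ l) (hπ : π * ((5 * l) ^ d : ℕ) ≤ 1) (m : ℕ) (S : (ι → Bool) → Finset (V d))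
    (hS : ∀ ω, ∃ f : ℕ → V d, f 0 = 0 ∧ (∀ t < m, f (t + 1) ∈ cb (f t) 1) ∧ ∀ w ∈ S ω, ∃ t ≤ m, f t = w) :
    ∫⁻ ω, ((S ω).filter (fun w => ω ∈ B w)).card ∂(PM r) ≤ L ^ d * ((m / l + 1 : ℕ) * (2 * d + 3 : ℕ)) := by
  set n := m / l with hn
  set t := (n + 1) * (2 * d + 2) with ht
  have hL0 : (0 : ℤ) < L := by exact_mod_cast hL
  let res : V d → V d := fun w k => w k % L
  let Rs : Finset (V d) := Fintype.piFinset fun _ => Finset.Ico 0 (L : ℤ)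
  have hRs : Rs.card = L ^ d := by simp [Rs]
  have hres : ∀ w, res w ∈ Rs := by
    intro w; rw [Fintype.mem_piFinset]; intro k
    exact Finset.mem_Ico.2 ⟨Int.emod_nonneg _ hL0.ne', Int.emod_lt_of_pos _ hL0⟩
  let W : Finset (V d) → V d → Finset (V d) := fun U a => U.filter fun w => res w = a
  have hpt : ∀ ω, (((S ω).filter (fun w => ω ∈ B w)).card : ℝ≥0∞) ≤
      ∑ a ∈ Rs, ((t : ℝ≥0∞) + ∑ U ∈ UU l n (0 : V d), 2 ^ ((W U a).filter (fun w => ω ∈ B w)).card * (2 ^ t)⁻¹) := by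
    intro ω
    obtain ⟨f, hf0, hf, hfS⟩ := hS ω
    obtain ⟨U, hU, hU2⟩ := UU_path l hl n m 0 f (fun k => by rw [hf0]; simp) hf (by
      have := Nat.lt_div_mul_add (a := m) (b := l) (by omega)
      rw [← hn] at this; linarith [add_mul n 1 l])
    have h1 : ((S ω).filter (fun w => ω ∈ B w)).card ≤ ∑ a ∈ Rs, ((W U a).filter (fun w => ω ∈ B w)).card := by
      refine le_trans (Finset.card_le_card ?_) Finset.card_biUnion_le
      intro w hw
      obtain ⟨hw1, hw2⟩ := Finset.mem_filter.1 hw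
      obtain ⟨t, ht, rfl⟩ := hfS w hw1
      exact Finset.mem_biUnion.2 ⟨res (f t), hres _, Finset.mem_filter.2 ⟨Finset.mem_filter.2 ⟨hU2 t ht, rfl⟩, hw2⟩⟩
    refine (Nat.cast_le.2 h1).trans ?_
    rw [Nat.cast_sum]
    refine Finset.sum_le_sum fun a _ => ?_
    refine (nat_le_two _ t).trans ?_
    gcongr
    rw [div_eq_mul_inv]
    exact Finset.single_le_sum (f := fun U => (2 : ℝ≥0∞) ^ ((W U a).filter (fun w => ω ∈ B w)).card * (2 ^ t)⁻¹)
      (fun _ _ => zero_le) hU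
  have hmeas : ∀ U a, Measurable fun ω : ι → Bool => (2 : ℝ≥0∞) ^ ((W U a).filter (fun w => ω ∈ B w)).card := by
    intro U a
    have : ∀ ω : ι → Bool, (2 : ℝ≥0∞) ^ ((W U a).filter (fun w => ω ∈ B w)).card =
        ∏ w ∈ W U a, (if ω ∈ B w then (2 : ℝ≥0∞) else 1) := by
      intro ω; rw [Finset.prod_ite]; simp
    simp only [this]
    exact Finset.measurable_prod _ fun w _ => Measurable.ite (hm w) measurable_const measurable_const
  have hIntU : ∀ U ∈ UU l n (0 : V d), ∀ a, ∫⁻ ω, (2 : ℝ≥0∞) ^ ((W U a).filter (fun w => ω ∈ B w)).card ∂(PM r) ≤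
      2 ^ (2 * (n + 1)) := by
    intro U hU a
    refine (exp2 r (W U a) B hm π fun T hT => hB T ?_).trans ?_
    · intro w hw w' hw' hne hc
      have h1 := (Finset.mem_filter.1 (hT hw)).2
      have h2 := (Finset.mem_filter.1 (hT hw')).2
      apply hne
      funext k
      have h3 : w k % L = w' k % L := congrFun (h1.trans h2.symm) k
      have h4 := abs_le.1 (hc k)
      have h5 : (L : ℤ) ∣ w k - w' k := Int.ModEq.dvd (Int.ModEq.symm h3)
      have h6 := Int.eq_zero_of_abs_lt_dvd h5 (by rw [abs_lt]; constructor <;> linarith)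
      linarith
    · calc (1 + π) ^ (W U a).card ≤ (1 + π) ^ ((5 * l) ^ d * (n + 1)) := by
            refine pow_le_pow_right₀ (by simp) ((Finset.card_filter_le _ _).trans (UU_size l hl n 0 U hU))
        _ = ((1 + π) ^ ((5 * l) ^ d)) ^ (n + 1) := pow_mul _ _ _
        _ ≤ 4 ^ (n + 1) := by gcongr; exact four_pow hπ
        _ = _ := by rw [pow_mul]; norm_num
  calc _ ≤ ∫⁻ ω, ∑ a ∈ Rs, ((t : ℝ≥0∞) + ∑ U ∈ UU l n (0 : V d), 2 ^ ((W U a).filter (fun w => ω ∈ B w)).card * (2 ^ t)⁻¹)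
          ∂(PM r) := lintegral_mono hpt
    _ = ∑ a ∈ Rs, ((t : ℝ≥0∞) + ∑ U ∈ UU l n (0 : V d), (∫⁻ ω, 2 ^ ((W U a).filter (fun w => ω ∈ B w)).card ∂(PM r)) * (2 ^ t)⁻¹) := by
        rw [lintegral_finsetSum]
        · refine Finset.sum_congr rfl fun a _ => ?_
          rw [lintegral_add_left measurable_const, lintegral_const, measure_univ, mul_one,
            lintegral_finsetSum _ fun U _ => (hmeas U a).mul_const _]
          congr 1
          refine Finset.sum_congr rfl fun U _ => ?_
          rw [lintegral_mul_const _ (hmeas U a)]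
        · intro a _
          exact measurable_const.add (Finset.measurable_sum _ fun U _ => (hmeas U a).mul_const _)
    _ ≤ ∑ a ∈ Rs, ((t : ℝ≥0∞) + 1) := by
        refine Finset.sum_le_sum fun a _ => ?_
        gcongr
        calc _ ≤ ∑ U ∈ UU l n (0 : V d), (2 : ℝ≥0∞) ^ (2 * (n + 1)) * (2 ^ t)⁻¹ := by
              refine Finset.sum_le_sum fun U hU => ?_
              gcongr; exact hIntU U hU a
          _ = (UU l n (0 : V d)).card * ((2 : ℝ≥0∞) ^ (2 * (n + 1)) * (2 ^ t)⁻¹) := by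
              rw [Finset.sum_const, nsmul_eq_mul]
          _ ≤ 2 ^ (2 * d * (n + 1)) * ((2 : ℝ≥0∞) ^ (2 * (n + 1)) * (2 ^ t)⁻¹) := by
              gcongr
              have : (UU l n (0 : V d)).card ≤ 2 ^ (2 * d * (n + 1)) := by
                refine (UU_card l n 0).trans ?_
                calc (3 ^ d) ^ n = 3 ^ (d * n) := (pow_mul _ _ _).symm
                  _ ≤ 4 ^ (d * n) := by gcongr; norm_num
                  _ ≤ 4 ^ (d * (n + 1)) := by gcongr; norm_num; omega
                  _ = _ := by rw [show (4:ℕ) = 2^2 by norm_num, ← pow_mul, mul_assoc]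
              exact_mod_cast this
          _ = 2 ^ t * (2 ^ t)⁻¹ := by rw [← mul_assoc, ← pow_add, ht]; congr 2; ring
          _ = 1 := ENNReal.mul_inv_cancel (by simp) (by finiteness)
    _ = L ^ d * ((t : ℝ≥0∞) + 1) := by rw [Finset.sum_const, hRs, nsmul_eq_mul]; push_cast; rfl
    _ ≤ _ := by
        gcongr
        rw [ht]
        have : (n + 1) * (2 * d + 2) + 1 ≤ (n + 1) * (2 * d + 3) := by nlinarith
        exact_mod_cast this

open Classical in
lemma greedy_triv (r : ι → unitInterval) (B : V d → Set (ι → Bool)) (m : ℕ) (S : (ι → Bool) → Finset (V d))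
    (hS : ∀ ω, ∃ f : ℕ → V d, f 0 = 0 ∧ (∀ t < m, f (t + 1) ∈ cb (f t) 1) ∧ ∀ w ∈ S ω, ∃ t ≤ m, f t = w) :
    ∫⁻ ω, ((S ω).filter (fun w => ω ∈ B w)).card ∂(PM r) ≤ (m + 1 : ℕ) := by
  calc _ ≤ ∫⁻ _, ((m + 1 : ℕ) : ℝ≥0∞) ∂(PM r) := by
        refine lintegral_mono fun ω => ?_
        obtain ⟨f, -, -, hf⟩ := hS ω
        have : ((S ω).filter (fun w => ω ∈ B w)).card ≤ m + 1 := by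
          refine (Finset.card_filter_le _ _).trans ?_
          calc _ ≤ ((Finset.range (m + 1)).image f).card := Finset.card_le_card fun w hw => by
                obtain ⟨t, ht, rfl⟩ := hf w hw
                exact Finset.mem_image_of_mem _ (by simp; omega)
            _ ≤ _ := Finset.card_image_le.trans (by simp)
        exact Nat.cast_le.2 this
    _ = _ := by simp

open Classical in
lemma greedy_union (r : ι → unitInterval) (B : V d → Set (ι → Bool)) (hm : ∀ w, MeasurableSet (B w))
    (π : ℝ≥0∞) (hB : ∀ w, PM r (B w) ≤ π) (m : ℕ) (S : (ι → Bool) → Finset (V d))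
    (hS : ∀ ω, ∃ f : ℕ → V d, f 0 = 0 ∧ (∀ t < m, f (t + 1) ∈ cb (f t) 1) ∧ ∀ w ∈ S ω, ∃ t ≤ m, f t = w) :
    ∫⁻ ω, ((S ω).filter (fun w => ω ∈ B w)).card ∂(PM r) ≤ ((2 * m + 1) ^ d : ℕ) * π := by
  calc _ ≤ ∫⁻ ω, ∑ w ∈ cbF (0 : V d) m, (B w).indicator (fun _ => (1 : ℝ≥0∞)) ω ∂(PM r) := by
        refine lintegral_mono fun ω => ?_
        obtain ⟨f, hf0, hf1, hf⟩ := hS ω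
        simp only [Set.indicator_apply]
        rw [Finset.sum_boole]
        refine Nat.cast_le.2 (Finset.card_le_card fun w hw => ?_)
        obtain ⟨h1, h2⟩ := Finset.mem_filter.1 hw
        obtain ⟨t, ht, rfl⟩ := hf w h1
        have := walk_cb hf1 t ht
        rw [hf0] at this
        exact Finset.mem_filter.2 ⟨mem_cbF.2 (cb_mono this (by exact_mod_cast ht)), h2⟩
    _ = ∑ w ∈ cbF (0 : V d) m, PM r (B w) := by
        rw [lintegral_finsetSum _ fun w _ => measurable_const.indicator (hm w)]
        refine Finset.sum_congr rfl fun w _ => ?_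
        rw [lintegral_indicator (hm w)]; simp
    _ ≤ ∑ w ∈ cbF (0 : V d) m, π := Finset.sum_le_sum fun w _ => hB w
    _ = _ := by rw [Finset.sum_const, card_cbF, nsmul_eq_mul]

end greedy
end

section
variable {d : ℕ}

/-- polynomial growth in `2^j` -/
def PB (f : ℕ → ℕ) : Prop := ∃ K e : ℕ, ∀ j, f j ≤ K * (2 ^ j) ^ e

lemma PB.mul {f g : ℕ → ℕ} (hf : PB f) (hg : PB g) : PB fun j => f j * g j := by
  obtain ⟨K, e, h⟩ := hf
  obtain ⟨K', e', h'⟩ := hg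
  refine ⟨K * K', e + e', fun j => (Nat.mul_le_mul (h j) (h' j)).trans (le_of_eq ?_)⟩
  rw [pow_add]; ring

lemma PB.add {f g : ℕ → ℕ} (hf : PB f) (hg : PB g) : PB fun j => f j + g j := by
  obtain ⟨K, e, h⟩ := hf
  obtain ⟨K', e', h'⟩ := hg
  refine ⟨K + K', e + e', fun j => ?_⟩
  have h1 : (2 ^ j) ^ e ≤ (2 ^ j) ^ (e + e') := Nat.pow_le_pow_right (by positivity) (by omega)
  have h2 : (2 ^ j) ^ e' ≤ (2 ^ j) ^ (e + e') := Nat.pow_le_pow_right (by positivity) (by omega)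
  calc _ ≤ K * (2 ^ j) ^ (e + e') + K' * (2 ^ j) ^ (e + e') :=
        Nat.add_le_add ((h j).trans (Nat.mul_le_mul_left _ h1)) ((h' j).trans (Nat.mul_le_mul_left _ h2))
    _ = _ := by ring

lemma PB.const (c : ℕ) : PB fun _ => c := ⟨c, 0, fun j => by simp⟩

lemma PB.pow {f : ℕ → ℕ} (hf : PB f) (n : ℕ) : PB fun j => f j ^ n := by
  obtain ⟨K, e, h⟩ := hf
  refine ⟨K ^ n, e * n, fun j => (Nat.pow_le_pow_left (h j) n).trans (le_of_eq ?_)⟩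
  rw [mul_pow, ← pow_mul]

lemma PB.exp (A : ℕ) : PB fun j => A ^ j := by
  refine ⟨1, A, fun j => ?_⟩
  rw [one_mul, ← pow_mul, mul_comm, pow_mul]
  exact Nat.pow_le_pow_left Nat.lt_two_pow_self.le j

lemma PB.evl {f : ℕ → ℕ} (hf : PB f) {C θ : ℝ≥0∞} (hC : C ≠ ⊤) (hθ : θ < 1) :
    ∃ J, ∀ j ≥ J, C * θ ^ 2 ^ j * f j ≤ 1 := by
  obtain ⟨K, e, h⟩ := hf
  have hθ' : θ ≠ ⊤ := hθ.ne_top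
  lift C to NNReal using hC
  lift θ to NNReal using hθ'
  have hθ1 : (θ : ℝ) < 1 := by exact_mod_cast hθ
  have h1 := tendsto_pow_const_mul_const_pow_of_abs_lt_one e (r := (θ : ℝ)) (by rw [abs_of_nonneg θ.coe_nonneg]; exact hθ1)
  have h2 := (h1.const_mul ((C : ℝ) * K)).comp (tendsto_pow_atTop_atTop_of_one_lt (show 1 < 2 by norm_num))
  rw [mul_zero] at h2
  obtain ⟨J, hJ⟩ := eventually_atTop.1 (h2.eventually (ge_mem_nhds (show (0 : ℝ) < 1 by norm_num)))
  refine ⟨J, fun j hj => ?_⟩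
  have h3 := hJ j hj
  simp only [Function.comp] at h3
  calc (C : ℝ≥0∞) * θ ^ 2 ^ j * f j ≤ C * θ ^ 2 ^ j * ((K * (2 ^ j) ^ e : ℕ)) := by gcongr; exact h j
    _ ≤ 1 := by
      have : (C : ℝ) * θ ^ 2 ^ j * ((K * (2 ^ j) ^ e : ℕ)) ≤ 1 := by
        refine le_trans (le_of_eq ?_) h3
        push_cast; ring
      exact_mod_cast this

namespace Pr
variable {P : Pr d}

lemma PB_NN : PB fun j => P.NN (j + 1) := by
  unfold NN
  have := ((((PB.exp P.A).mul (PB.const (2 * (P.M * (8 + P.c)) * P.A))).add (PB.const 1)).pow d)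
  convert this using 4
  ring

lemma PB_r : PB fun j => 2 * P.r j + 1 := by
  unfold r
  have := (((PB.exp P.A).mul (PB.const (2 * (5 * P.A + P.c + 8) * P.M))).add (PB.const 1))
  convert this using 3
  ring

/-- bad at level `k` after removal of some edge at `w` -/
def BadV (P : Pr d) (k : ℕ) (w : V d) : Set (Om d) := {ω | ∃ w' ∈ cbF w 1, P.BadE k w w' ω}

lemma BadV_loc (k : ℕ) (w : V d) : Loc (P.dep k w) (P.BadV k w) := by
  rintro x y h ⟨w', h1, h2⟩
  exact ⟨w', h1, BadE_loc k w w' x y h h2⟩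

lemma BadV_meas (k : ℕ) (w : V d) : MeasurableSet (P.BadV k w) := (BadV_loc k w).measurable (dep_fin k w)

lemma delc_same (w : V d) (x : Config d) : delc w w x = x := by
  refine delc_self ?_
  rintro ⟨h, -⟩
  simp [sym2dist1, dist1] at h

lemma BadV_of_Bad {k : ℕ} {w : V d} {ω : Om d} (h : P.Bad (la ω) (wp ω) k w) : ω ∈ P.BadV k w :=
  ⟨w, mem_cbF.2 (cb_self (by norm_num)), by unfold BadE; rwa [delc_same, delc_same]⟩

lemma KK1 : 1 ≤ P.KK := Nat.one_le_pow _ _ (by positivity)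

lemma F1_tail {p β κ : unitInterval} {η : ℝ≥0∞} (hp : (p : ℝ) < 1)
    (hη : ∀ i, PM (fun _ : Edge d => p) {a | ¬ gdB P.M P.R P.c a i} ≤ η) (hη2 : P.KK * η ≤ 1 / 2)
    (k : ℕ) (w w' : V d) :
    PM (rr p β κ) {ω : Om d | ¬ P.F1 (delc w w' (la ω)) k w} ≤
      (10 * P.A + 1 : ℕ) ^ d * (ENNReal.ofReal (1 - p))⁻¹ * (1 / 2) ^ 2 ^ k := by
  have hq : ENNReal.ofReal (1 - p) ≠ 0 := (ENNReal.ofReal_pos.2 (by linarith)).ne'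
  have h1 : ∀ u, PM (fun _ : Edge d => p) {a | ¬ P.Gd a k u} ≤ (1 / 2) ^ 2 ^ k := by
    intro u
    calc _ ≤ P.KK * PM (fun _ : Edge d => p) {a | ¬ P.Gd a k u} :=
          le_mul_of_one_le_left' (by exact_mod_cast KK1)
      _ ≤ _ := (Gd_tail hη k u).trans (by gcongr)
  have h2 : ∀ u, PM (rr p β κ) {ω : Om d | ¬ P.Gd (delc w w' (la ω)) k u} ≤
      (ENNReal.ofReal (1 - p))⁻¹ * (1 / 2) ^ 2 ^ k := by
    intro u
    have hm : MeasurableSet {a : Config d | ¬ P.Gd (delc w w' a) k u} :=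
      measurable_delc w w' (meas_Gd k u).compl
    have : PM (rr p β κ) {ω : Om d | ¬ P.Gd (delc w w' (la ω)) k u} =
        PM (fun _ : Edge d => p) {a | ¬ P.Gd (delc w w' a) k u} := by
      rw [← law_la p β κ, Measure.map_apply measurable_la hm]; rfl
    rw [this]
    rw [← ENNReal.div_eq_inv_mul, ENNReal.le_div_iff_mul_le (Or.inl hq) (Or.inl (by finiteness)), mul_comm]
    exact (Gd_del k u w w').trans (h1 u)
  calc _ ≤ PM (rr p β κ) (⋃ u ∈ cbF (P.z k w) (5 * P.A : ℕ), {ω : Om d | ¬ P.Gd (delc w w' (la ω)) k u}) := by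
        refine measure_mono fun ω hω => ?_
        have hω : ¬ P.F1 (delc w w' (la ω)) k w := hω
        unfold F1 at hω
        push Not at hω
        obtain ⟨u, hu, hu2⟩ := hω
        exact Set.mem_iUnion₂.2 ⟨u, mem_cbF.2 (by exact_mod_cast hu), hu2⟩
    _ ≤ ∑ u ∈ cbF (P.z k w) (5 * P.A : ℕ), _ := measure_biUnion_finset_le _ _
    _ ≤ ∑ u ∈ cbF (P.z k w) (5 * P.A : ℕ), (ENNReal.ofReal (1 - p))⁻¹ * (1 / 2) ^ 2 ^ k :=
        Finset.sum_le_sum fun u _ => h2 u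
    _ = _ := by
        rw [Finset.sum_const, card_cbF, nsmul_eq_mul, mul_assoc]; congr 1; push_cast; ring

/-- the constant in the tail -/
noncomputable def C0 (P : Pr d) (p : unitInterval) : ℝ≥0∞ :=
  (3 ^ d : ℕ) * ((10 * P.A + 1 : ℕ) ^ d * (ENNReal.ofReal (1 - p))⁻¹ + 2)

lemma C0_ne {p : unitInterval} (hp : (p : ℝ) < 1) : P.C0 p ≠ ⊤ := by
  have hq : ENNReal.ofReal (1 - p) ≠ 0 := (ENNReal.ofReal_pos.2 (by linarith)).ne'
  unfold C0
  have : (ENNReal.ofReal (1 - p))⁻¹ ≠ ⊤ := ENNReal.inv_ne_top.2 hq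
  finiteness

lemma BadV_tail {p β κ : unitInterval} {η δ θ : ℝ≥0∞} (hp : (p : ℝ) < 1)
    (hη : ∀ i, PM (fun _ : Edge d => p) {a | ¬ gdB P.M P.R P.c a i} ≤ η) (hη2 : P.KK * η ≤ 1 / 2)
    (hβ : (β : ℝ) < 1) (hδ : δ ≤ ENNReal.ofReal β) (hθ : 1 / 2 ≤ θ) (hθ' : 1 - δ ^ P.mE ≤ θ)
    (k : ℕ) (w : V d) : PM (rr p β κ) (P.BadV k w) ≤ P.C0 p * θ ^ 2 ^ k := by
  have h2 : θ ^ (2 ^ k - 1) ≤ 2 * θ ^ 2 ^ k := by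
    have e : 2 ^ k = (2 ^ k - 1) + 1 := by have : 0 < 2 ^ k := by positivity
                                           omega
    conv_rhs => rw [e, pow_succ]
    calc θ ^ (2 ^ k - 1) = 2 * (θ ^ (2 ^ k - 1) * (1 / 2)) := by
          rw [mul_left_comm, one_div, ENNReal.mul_inv_cancel (by norm_num) (by finiteness), mul_one]
      _ ≤ _ := by gcongr
  calc _ ≤ PM (rr p β κ) (⋃ w' ∈ cbF w (1 : ℕ), {ω : Om d | P.BadE k w w' ω}) := by
        refine measure_mono fun ω hω => ?_
        obtain ⟨w', h1, h2⟩ := hω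
        exact Set.mem_iUnion₂.2 ⟨w', h1, h2⟩
    _ ≤ ∑ w' ∈ cbF w (1 : ℕ), _ := measure_biUnion_finset_le _ _
    _ ≤ ∑ w' ∈ cbF w (1 : ℕ), ((10 * P.A + 1 : ℕ) ^ d * (ENNReal.ofReal (1 - p))⁻¹ + 2) * θ ^ 2 ^ k := by
        refine Finset.sum_le_sum fun w' _ => ?_
        calc _ ≤ PM (rr p β κ) ({ω : Om d | ¬ P.F1 (delc w w' (la ω)) k w} ∪ {ω : Om d |
                P.F1 (delc w w' (la ω)) k w ∧ ¬ P.F2 (delc w w' (la ω)) (delc w w' (wp ω)) k w}) := by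
              refine measure_mono fun ω hω => ?_
              have hω : ¬ (P.F1 (delc w w' (la ω)) k w ∧ P.F2 (delc w w' (la ω)) (delc w w' (wp ω)) k w) := hω
              by_cases h : P.F1 (delc w w' (la ω)) k w
              · exact Or.inr ⟨h, fun h' => hω ⟨h, h'⟩⟩
              · exact Or.inl h
          _ ≤ _ := measure_union_le _ _
          _ ≤ (10 * P.A + 1 : ℕ) ^ d * (ENNReal.ofReal (1 - p))⁻¹ * (1 / 2) ^ 2 ^ k + (1 - δ ^ P.mE) ^ (2 ^ k - 1) :=
              add_le_add (F1_tail hp hη hη2 k w w') (F2_tail hβ hδ k w w')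
          _ ≤ (10 * P.A + 1 : ℕ) ^ d * (ENNReal.ofReal (1 - p))⁻¹ * θ ^ 2 ^ k + 2 * θ ^ 2 ^ k := by
              gcongr
              exact le_trans (by gcongr) h2
          _ = _ := by rw [add_mul]
    _ = _ := by rw [Finset.sum_const, card_cbF, nsmul_eq_mul]; unfold C0; push_cast; ring

lemma dep_disj {k : ℕ} {w w' : V d} (h : w ∉ cb w' (2 * P.r k)) : Disjoint (P.dep k w) (P.dep k w') := by
  rw [Set.disjoint_left]
  rintro ⟨e, i⟩ h1 h2
  obtain ⟨e, he⟩ := e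
  induction e with | _ a b =>
  have h1 : a ∈ cb w (P.r k) := h1 a (Sym2.mem_mk_left _ _)
  have h2 : a ∈ cb w' (P.r k) := h2 a (Sym2.mem_mk_left _ _)
  exact h (cb_mono (cb_trans (cb_symm h1) h2) (by linarith))

end Pr
end

section
variable {d : ℕ}
namespace Pr
variable {P : Pr d}

open Classical in
lemma sum_bad {p : unitInterval} {C θ : ℝ≥0∞} (hC : C ≠ ⊤) (hθ : θ < 1) :
    ∃ K : ℝ≥0∞, K ≠ ⊤ ∧ ∀ β κ : unitInterval, (∀ k w, PM (rr p β κ) (P.BadV k w) ≤ C * θ ^ 2 ^ k) →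
      ∀ (m : ℕ), 1 ≤ m → ∀ S : Om d → Finset (V d),
      (∀ ω, ∃ f : ℕ → V d, f 0 = 0 ∧ (∀ t < m, f (t + 1) ∈ cb (f t) 1) ∧ ∀ w ∈ S ω, ∃ t ≤ m, f t = w) →
      ∑' j, (P.NN (j + 1) : ℝ≥0∞) * ∫⁻ ω, ((S ω).filter (fun w => ω ∈ P.BadV j w)).card ∂(PM (rr p β κ)) ≤ m * K := by
  let N : ℕ → ℕ := fun j => P.NN (j + 1)
  let L : ℕ → ℕ := fun j => 2 * P.r j + 1
  let l : ℕ → ℕ := fun j => N j * L j ^ d * 2 ^ j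
  have hN : ∀ j, 1 ≤ N j := fun j => Nat.one_le_pow _ _ (by positivity)
  have hL : ∀ j, 1 ≤ L j := fun j => by simp [L]
  have hl : ∀ j, 1 ≤ l j := fun j => Nat.mul_pos (Nat.mul_pos (hN j) (pow_pos (hL j) d)) (by positivity)
  have hlP : PB l := (PB_NN.mul (PB_r.pow d)).mul (PB.exp 2)
  obtain ⟨J, hJ⟩ := ((((PB.const 5).mul hlP).pow d).mul (PB_NN (P := P) |>.mul (PB.exp 2))).evl hC hθ
  let b : ℕ → ℝ≥0∞ := fun j => (if j < J then 2 * (N j : ℝ≥0∞) else 0) + (4 * d + 6 : ℕ) * (1 / 2) ^ j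
  refine ⟨∑' j, b j, ?_, fun β κ hV m hm S hS => ?_⟩
  · rw [ENNReal.tsum_add, ENNReal.tsum_mul_left]
    refine ENNReal.add_ne_top.2 ⟨?_, ?_⟩
    · rw [tsum_eq_sum (s := Finset.range J) (fun j hj => if_neg (by simpa using hj))]
      refine (ENNReal.sum_lt_top.2 fun j hj => ?_).ne
      split_ifs <;> finiteness
    · rw [one_div, ENNReal.tsum_geometric]
      have : (1 - (2 : ℝ≥0∞)⁻¹)⁻¹ ≠ ⊤ := by simp
      finiteness
  rw [← ENNReal.tsum_mul_left]
  refine ENNReal.tsum_le_tsum fun j => ?_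
  by_cases hj : j < J
  · calc _ ≤ (N j : ℝ≥0∞) * (m + 1 : ℕ) := by gcongr; exact greedy_triv _ _ m S hS
      _ ≤ (N j : ℝ≥0∞) * (2 * m : ℕ) := by gcongr; omega
      _ = m * (2 * N j) := by push_cast; ring
      _ ≤ m * b j := by simp only [b, if_pos hj]; gcongr; exact le_self_add
  push Not at hj
  have hx := hJ j hj
  have hb : b j = (4 * d + 6 : ℕ) * (1 / 2) ^ j := by simp only [b, if_neg (not_lt.2 hj), zero_add]
  have h2 : (2 : ℝ≥0∞) ^ j * (1 / 2) ^ j = 1 := by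
    rw [← mul_pow, one_div, ENNReal.mul_inv_cancel (by norm_num) (by finiteness), one_pow]
  rw [hb]
  set π := C * θ ^ 2 ^ j with hπ
  by_cases hlm : l j ≤ m
  · have hg := greedy (rr p β κ) (P.BadV j) (BadV_meas j) π (L j) (hL j) (by
      intro T hT
      refine ind_prod_le (rr p β κ) T (fun w => P.dep j w) (fun w => P.BadV j w) ?_ ?_ ?_ π ?_
      · exact fun w _ => BadV_meas j w
      · exact fun w _ => BadV_loc j w
      · intro w hw w' hw' hne
        refine dep_disj ?_
        have := hT w hw w' hw' hne
        simpa [L] using this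
      · exact fun w _ => hV j w) (l j) (hl j) (by
      refine le_trans ?_ hx
      gcongr
      exact Nat.le_mul_of_pos_right _ (Nat.mul_pos (hN j) (by positivity))) m S hS
    have h3 : 2 ^ j * (N j * (L j ^ d * ((m / l j + 1) * (2 * d + 3)))) ≤ m * (4 * d + 6) := by
      have : l j * (m / l j) ≤ m := Nat.mul_div_le m (l j)
      calc _ = (l j * (m / l j) + l j) * (2 * d + 3) := by simp only [l]; ring
        _ ≤ (m + m) * (2 * d + 3) := by gcongr
        _ = _ := by ring
    calc _ ≤ (N j : ℝ≥0∞) * (L j ^ d * ((m / l j + 1 : ℕ) * (2 * d + 3 : ℕ))) := by gcongr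
      _ = (2 ^ j * (1 / 2) ^ j) * (N j : ℝ≥0∞) * (L j ^ d * ((m / l j + 1 : ℕ) * (2 * d + 3 : ℕ))) := by rw [h2, one_mul]
      _ = ((2 ^ j * (N j * (L j ^ d * ((m / l j + 1) * (2 * d + 3)))) : ℕ) : ℝ≥0∞) * (1 / 2) ^ j := by push_cast; ring
      _ ≤ ((m * (4 * d + 6) : ℕ) : ℝ≥0∞) * (1 / 2) ^ j := by gcongr
      _ = _ := by push_cast; ring
  · push Not at hlm
    have hg := greedy_union (rr p β κ) (P.BadV j) (BadV_meas j) π (hV j) m S hS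
    calc _ ≤ (N j : ℝ≥0∞) * (((2 * m + 1) ^ d : ℕ) * π) := by gcongr
      _ ≤ (N j : ℝ≥0∞) * (((5 * l j) ^ d : ℕ) * π) := by gcongr; omega
      _ = (2 ^ j * (1 / 2) ^ j) * ((N j : ℝ≥0∞) * (((5 * l j) ^ d : ℕ) * π)) := by rw [h2, one_mul]
      _ = (π * (((5 * l j) ^ d * (N j * 2 ^ j) : ℕ) : ℝ≥0∞)) * (1 / 2) ^ j := by push_cast; ring
      _ ≤ 1 * (1 / 2) ^ j := by gcongr
      _ ≤ ((m * (4 * d + 6) : ℕ) : ℝ≥0∞) * (1 / 2) ^ j := by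
          gcongr
          have : 1 ≤ m * (4 * d + 6) := Nat.mul_pos hm (by positivity)
          exact_mod_cast this
      _ = _ := by push_cast; ring

end Pr
end

section
variable {d : ℕ}

open Classical in
/-- restriction of a configuration to a region -/
noncomputable def rst (B : Set (V d)) (z : Config d) : Config d := fun e => if e ∈ EdgesIn B then z e else false

lemma rst_open {B : Set (V d)} {z : Config d} {w w' : V d} (h : edgeOpen (rst B z) w w') : edgeOpen z w w' := by
  obtain ⟨h1, h2⟩ := h
  refine ⟨h1, ?_⟩
  unfold rst at h2
  split_ifs at h2
  exact h2

lemma open_rst {B : Set (V d)} {z : Config d} {w w' : V d} (h : edgeOpen z w w') (hw : w ∈ B) (hw' : w' ∈ B) :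
    edgeOpen (rst B z) w w' := by
  obtain ⟨h1, h2⟩ := h
  refine ⟨h1, ?_⟩
  unfold rst
  rw [if_pos]
  · exact h2
  · intro v hv
    rcases Sym2.mem_iff.1 hv with rfl | rfl <;> assumption

lemma rst_congr {B : Set (V d)} {z z' : Config d} (h : ∀ e ∈ EdgesIn B, z e = z' e) : rst B z = rst B z' := by
  funext e; unfold rst; split_ifs with he
  · exact h e he
  · rfl

def GP (z : Config d) (ρ m : ℕ) (nf : ℕ × (ℕ → V d)) : Prop :=
  nf.1 ≤ m ∧ IsOpenPath z nf.1 nf.2 ∧ (∀ i ≤ nf.1, ∀ j ≤ nf.1, nf.2 i = nf.2 j → i = j) ∧ nf.2 0 ∈ cb (0 : V d) ρ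

open Classical in
noncomputable def sel (z : Config d) (ρ m : ℕ) (X : V d) : ℕ × (ℕ → V d) :=
  if h : ∃ nf : ℕ × (ℕ → V d), GP z ρ m nf ∧ nf.2 nf.1 ∈ cb X ρ then h.choose else (0, fun _ => 0)

lemma sel_spec (z : Config d) (ρ m : ℕ) (X : V d) : GP z ρ m (sel z ρ m X) := by
  unfold sel
  split_ifs with h
  · exact h.choose_spec.1
  · exact ⟨Nat.zero_le _, fun i hi => by simp at hi, fun i hi j hj _ => by simp at hi hj; omega, cb_self (by simp)⟩

lemma sel_end' {z : Config d} {ρ m : ℕ} {X : V d}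
    (h : ∃ nf : ℕ × (ℕ → V d), GP z ρ m nf ∧ nf.2 nf.1 ∈ cb X ρ) :
    (sel z ρ m X).2 (sel z ρ m X).1 ∈ cb X ρ := by
  unfold sel
  rw [dif_pos h]
  exact h.choose_spec.2

lemma geo_inj {z : Config d} {n : ℕ} {f : ℕ → V d} (h : IsOpenPath z n f) (hn : chemDist z (f 0) (f n) = n) :
    ∀ i ≤ n, ∀ j ≤ n, f i = f j → i = j := by
  have key : ∀ i j, i < j → j ≤ n → f i ≠ f j := by
    intro i j hij hj he
    have h1 : chemDist z (f 0) (f i) ≤ i := chemDist_le_path fun t ht => h t (by omega)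
    have h2 : chemDist z (f j) (f n) ≤ (n - j : ℕ) := by
      have := chemDist_le_path (ω := z) (n := n - j) (f := fun t => f (j + t)) fun t ht => by
        have := h (j + t) (by omega)
        exact this
      simpa [Nat.add_sub_cancel' hj] using this
    have h3 := chemDist_triangle z (f 0) (f i) (f n)
    rw [hn, he] at h3
    rw [he] at h1
    have h4 : (n : ℝ≥0∞) ≤ (i + (n - j) : ℕ) := h3.trans ((add_le_add h1 h2).trans (by push_cast; exact le_rfl))
    have : n ≤ i + (n - j) := by exact_mod_cast h4
    omega
  intro i hi j hj he
  rcases lt_trichotomy i j with h1 | h1 | h1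
  · exact absurd he (key i j h1 hj)
  · exact h1
  · exact absurd he.symm (key j i h1 hi)

lemma sel_end {y : Config d} {ρ m : ℕ} {X : V d}
    (h : ∃ v ∈ cb (0 : V d) ρ, ∃ v' ∈ cb X ρ, chemDist y v v' ≤ m) :
    (sel (rst (cb 0 (ρ + m)) y) ρ m X).2 (sel (rst (cb 0 (ρ + m)) y) ρ m X).1 ∈ cb X ρ := by
  obtain ⟨v, hv, v', hv', hd⟩ := h
  obtain ⟨n, f, h1, rfl, rfl, h4⟩ := exists_path (ne_top_of_le_ne_top (by finiteness) hd)
  have hnm : n ≤ m := by rw [h4] at hd; exact_mod_cast hd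
  have hB : ∀ i ≤ n, f i ∈ cb (0 : V d) (ρ + m) := fun i hi =>
    cb_mono (cb_trans (path_cb h1 hi) hv) (by have : (i : ℤ) ≤ m := by exact_mod_cast hi.trans hnm
                                              linarith)
  exact sel_end' ⟨(n, f), ⟨hnm, fun i hi => open_rst (h1 i hi) (hB i hi.le) (hB (i + 1) hi), geo_inj h1 h4, hv⟩, hv'⟩

def Use (nf : ℕ × (ℕ → V d)) (w w' : V d) : Prop := ∃ t < nf.1, nf.2 t = w ∧ nf.2 (t + 1) = w'

lemma GP.use_open {z : Config d} {ρ m : ℕ} {nf : ℕ × (ℕ → V d)} (h : GP z ρ m nf) {w w' : V d} (hu : Use nf w w') :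
    edgeOpen z w w' := by
  obtain ⟨t, ht, rfl, rfl⟩ := hu
  exact h.2.1 t ht

lemma GP.mem {z : Config d} {ρ m : ℕ} {nf : ℕ × (ℕ → V d)} (h : GP z ρ m nf) {t : ℕ} (ht : t ≤ nf.1) :
    nf.2 t ∈ cb (0 : V d) ((ρ + m : ℕ) : ℤ) :=
  cb_mono (cb_trans (path_cb h.2.1 ht) h.2.2.2) (by
    have : (t : ℤ) ≤ m := by exact_mod_cast ht.trans h.1
    push_cast; linarith)

open Classical in
lemma GP.sum_use {z : Config d} {ρ m : ℕ} {nf : ℕ × (ℕ → V d)} (h : GP z ρ m nf) (g : V d → V d → ℝ≥0∞) :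
    ∑ x ∈ cbF (0 : V d) ((ρ + m : ℕ) : ℤ) ×ˢ cbF (0 : V d) ((ρ + m : ℕ) : ℤ), (if Use nf x.1 x.2 then g x.1 x.2 else 0) =
      ∑ t ∈ Finset.range nf.1, g (nf.2 t) (nf.2 (t + 1)) := by
  symm
  rw [← Finset.sum_filter]
  refine Finset.sum_bij (fun t _ => (nf.2 t, nf.2 (t + 1))) ?_ ?_ ?_ ?_
  · intro t ht
    have ht := Finset.mem_range.1 ht
    refine Finset.mem_filter.2 ⟨Finset.mem_product.2 ⟨mem_cbF.2 (h.mem ht.le), mem_cbF.2 (h.mem ht)⟩, t, ht, rfl, rfl⟩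
  · intro t ht t' ht' he
    have ht := Finset.mem_range.1 ht
    have ht' := Finset.mem_range.1 ht'
    exact h.2.2.1 t ht.le t' ht'.le (Prod.ext_iff.1 he).1
  · rintro ⟨w, w'⟩ hw
    obtain ⟨-, t, ht, h1, h2⟩ := Finset.mem_filter.1 hw
    exact ⟨t, Finset.mem_range.2 ht, Prod.ext h1 h2⟩
  · intro t _; rfl

open Classical in
/-- the vertices of the path -/
noncomputable def vts (nf : ℕ × (ℕ → V d)) : Finset (V d) := (Finset.range (nf.1 + 1)).image nf.2

open Classical in
lemma GP.sum_left {z : Config d} {ρ m : ℕ} {nf : ℕ × (ℕ → V d)} (h : GP z ρ m nf) (B : V d → Prop) :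
    ∑ t ∈ Finset.range nf.1, (if B (nf.2 t) then (1 : ℝ≥0∞) else 0) ≤ ((vts nf).filter B).card := by
  rw [Finset.sum_boole]
  have : ((Finset.range nf.1).filter fun t => B (nf.2 t)).card ≤ ((vts nf).filter B).card := by
    refine Finset.card_le_card_of_injOn nf.2 ?_ ?_
    · intro t ht
      obtain ⟨h1, h2⟩ := Finset.mem_filter.1 ht
      have h1 := Finset.mem_range.1 h1
      exact Finset.mem_filter.2 ⟨Finset.mem_image_of_mem _ (Finset.mem_range.2 (by omega)), h2⟩
    · intro t ht t' ht' he
      have h1 := Finset.mem_range.1 (Finset.mem_filter.1 ht).1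
      have h2 := Finset.mem_range.1 (Finset.mem_filter.1 ht').1
      exact h.2.2.1 t h1.le t' h2.le he
  exact_mod_cast this

open Classical in
lemma GP.sum_right {z : Config d} {ρ m : ℕ} {nf : ℕ × (ℕ → V d)} (h : GP z ρ m nf) (B : V d → Prop) :
    ∑ t ∈ Finset.range nf.1, (if B (nf.2 (t + 1)) then (1 : ℝ≥0∞) else 0) ≤ ((vts nf).filter B).card := by
  rw [Finset.sum_boole]
  have : ((Finset.range nf.1).filter fun t => B (nf.2 (t + 1))).card ≤ ((vts nf).filter B).card := by
    refine Finset.card_le_card_of_injOn (fun t => nf.2 (t + 1)) ?_ ?_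
    · intro t ht
      obtain ⟨h1, h2⟩ := Finset.mem_filter.1 ht
      have h1 := Finset.mem_range.1 h1
      exact Finset.mem_filter.2 ⟨Finset.mem_image_of_mem _ (Finset.mem_range.2 (by omega)), h2⟩
    · intro t ht t' ht' he
      have h1 := Finset.mem_range.1 (Finset.mem_filter.1 ht).1
      have h2 := Finset.mem_range.1 (Finset.mem_filter.1 ht').1
      have := h.2.2.1 (t + 1) h1 (t' + 1) h2 he
      omega
  exact_mod_cast this

/-- a star path from `0` covering the vertices of the path -/
lemma GP.star {z : Config d} {ρ m : ℕ} {nf : ℕ × (ℕ → V d)} (h : GP z ρ m nf) :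
    ∃ f : ℕ → V d, f 0 = 0 ∧ (∀ t < ρ + m, f (t + 1) ∈ cb (f t) 1) ∧ ∀ w ∈ vts nf, ∃ t ≤ ρ + m, f t = w := by
  obtain ⟨n, g⟩ := nf
  obtain ⟨hn, hp, -, h0⟩ := h
  simp only at hn hp h0
  rw [mem_cb] at h0
  let f : ℕ → V d := fun t => if t ≤ ρ then fun k => max (-(t : ℤ)) (min t (g 0 k)) else g (min (t - ρ) n)
  have hfρ : f ρ = g 0 := by
    simp only [f, le_refl, if_true]
    funext k
    have := h0 k
    simp only [Pi.zero_apply, sub_zero] at this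
    rw [abs_le] at this
    omega
  have hfg : ∀ t, f (ρ + t) = g (min t n) := by
    intro t
    rcases Nat.eq_zero_or_pos t with rfl | ht
    · simpa using hfρ
    · simp only [f]; rw [if_neg (by omega), Nat.add_sub_cancel_left]
  refine ⟨f, ?_, ?_, ?_⟩
  · simp only [f, Nat.zero_le, if_true]; funext k; simp
  · intro t ht
    by_cases htρ : t < ρ
    · simp only [f]; rw [if_pos (by omega : t + 1 ≤ ρ), if_pos htρ.le, mem_cb]
      intro k
      rw [abs_le]; push_cast; constructor <;> omega
    · obtain ⟨u, rfl⟩ := Nat.exists_eq_add_of_le (not_lt.1 htρ)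
      rw [add_assoc, hfg, hfg]
      by_cases hu : u < n
      · rw [min_eq_left hu.le, min_eq_left (by omega : u + 1 ≤ n)]
        exact edgeOpen_cb (hp u hu)
      · rw [min_eq_right (by omega), min_eq_right (by omega)]
        exact cb_self (by norm_num)
  · intro w hw
    obtain ⟨t, ht, rfl⟩ := Finset.mem_image.1 hw
    have ht := Finset.mem_range.1 ht
    simp only at ht
    refine ⟨ρ + t, by omega, ?_⟩
    rw [hfg, min_eq_left (by omega)]

end

section
variable {d : ℕ}

lemma loc_edge (e : Edge d) (f : Om d → Bool) (hf : ∀ x y : Om d, (∀ i, x (e, i) = y (e, i)) → f x = f y) (b : Bool) :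
    Loc {x : Edge d × Fin 3 | x.1 = e} {ω | f ω = b} := by
  intro x y hxy hx
  have hx : f x = b := hx
  show f y = b
  rw [← hx]; exact (hf x y fun i => hxy (e, i) rfl).symm

lemma edge_fin (e : Edge d) : {x : Edge d × Fin 3 | x.1 = e}.Finite := by
  refine ((Set.finite_singleton e).prod (Set.finite_univ (α := Fin 3))).subset ?_
  rintro ⟨a, b⟩ h; exact ⟨h, trivial⟩

lemma wp_edge (e : Edge d) (b : Bool) : Loc {x : Edge d × Fin 3 | x.1 = e} {ω : Om d | wp ω e = b} :=
  loc_edge e (fun ω => wp ω e) (fun x y h => by simp [wp, h]) b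

lemma wq_edge (e : Edge d) (b : Bool) : Loc {x : Edge d × Fin 3 | x.1 = e} {ω : Om d | wq ω e = b} :=
  loc_edge e (fun ω => wq ω e) (fun x y h => by simp [wq, h]) b

section
variable {p' β κ p q : unitInterval}

lemma prob_diff (hp : (1 - p : ℝ) = (1 - p') * (1 - β))
    (hq : (1 - q : ℝ) = (1 - p') * (1 - β) * (1 - κ)) (e : Edge d) :
    PM (rr p' β κ) ({ω : Om d | wq ω e = true} ∩ {ω : Om d | wp ω e = false}) = ENNReal.ofReal (q - p) := by
  have h1 : (0 : ℝ) ≤ 1 - p' := by linarith [p'.2.2]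
  have h2 : (0 : ℝ) ≤ 1 - β := by linarith [β.2.2]
  have : {ω : Om d | wq ω e = true} ∩ {ω : Om d | wp ω e = false} =
      {ω : Om d | wp ω e = false} \ {ω : Om d | wq ω e = false} := by
    ext ω
    have := wp_le ω e
    simp only [Set.mem_inter_iff, Set.mem_sdiff]
    show (wq ω e = true ∧ wp ω e = false) ↔ (wp ω e = false ∧ ¬ wq ω e = false)
    cases wq ω e <;> cases wp ω e <;> simp_all
  rw [this, measure_sdiff]
  · rw [closed_wp, closed_wq, ← ENNReal.ofReal_mul h1, ← ENNReal.ofReal_mul (mul_nonneg h1 h2), ← hq, ← hp,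
      ← ENNReal.ofReal_sub _ (by linarith [q.2.2])]
    congr 1; ring
  · intro ω h
    have h : wq ω e = false := h
    have := wp_le ω e
    show wp ω e = false
    rw [h] at this; cases hw : wp ω e
    · rfl
    · rw [hw] at this; have h3 : (true : Bool) ≤ false := this
      exact absurd h3 (by decide)
  · exact ((wq_edge e false).measurable (edge_fin e)).nullMeasurableSet
  · finiteness

lemma prob_open (hq : (1 - q : ℝ) = (1 - p') * (1 - β) * (1 - κ)) (e : Edge d) : PM (rr p' β κ) {ω : Om d | wq ω e = true} = ENNReal.ofReal q := by
  have h1 : (0 : ℝ) ≤ 1 - p' := by linarith [p'.2.2]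
  have h2 : (0 : ℝ) ≤ 1 - β := by linarith [β.2.2]
  have : {ω : Om d | wq ω e = true} = {ω : Om d | wq ω e = false}ᶜ := by
    ext ω
    show wq ω e = true ↔ ¬ wq ω e = false
    simp
  rw [this, prob_compl_eq_one_sub ((wq_edge e false).measurable (edge_fin e)), closed_wq, ← ENNReal.ofReal_mul h1,
    ← ENNReal.ofReal_mul (mul_nonneg h1 h2), ← hq, ← ENNReal.ofReal_one, ← ENNReal.ofReal_sub _ (by linarith [q.2.2])]
  congr 1; ring

/-- the event that the selected path uses an edge -/
def Us (B : Set (V d)) (ρ m : ℕ) (X w w' : V d) : Set (Om d) := {ω | Use (sel (rst B (wq ω)) ρ m X) w w'}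

lemma Us_loc (B : Set (V d)) (ρ m : ℕ) (X w w' : V d) :
    Loc {x : Edge d × Fin 3 | x.1 ∈ EdgesIn B} (Us B ρ m X w w') := by
  intro x y hxy hx
  have : rst B (wq x) = rst B (wq y) := rst_congr fun e he => by
    simp only [wq, hxy (e, 0) he, hxy (e, 1) he, hxy (e, 2) he]
  have hx : Use (sel (rst B (wq x)) ρ m X) w w' := hx
  rw [this] at hx
  exact hx

lemma B_fin {B : Set (V d)} (hB : B.Finite) : {x : Edge d × Fin 3 | x.1 ∈ EdgesIn B}.Finite := by
  refine ((EdgesIn_finite hB).prod (Set.finite_univ (α := Fin 3))).subset ?_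
  rintro ⟨a, b⟩ h; exact ⟨h, trivial⟩

open Classical in
lemma use_fact (hp : (1 - p : ℝ) = (1 - p') * (1 - β))
    (hq : (1 - q : ℝ) = (1 - p') * (1 - β) * (1 - κ))
    (hp'0 : (0 : ℝ) < p') {B : Set (V d)} (hB : B.Finite) (ρ m : ℕ) (X w w' : V d) (e : Edge d)
    (he : e.1 = s(w, w')) {A : Set (Om d)} (hA : MeasurableSet A) (hAl : Loc {x : Edge d × Fin 3 | x.1 ≠ e} A) :
    PM (rr p' β κ) (Us B ρ m X w w' ∩ {ω | wp ω e = false} ∩ A) ≤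
      ENNReal.ofReal ((q - p) / p') * PM (rr p' β κ) (Us B ρ m X w w' ∩ A) := by
  let opn : Om d → Om d := fun ω => Function.update ω (e, 0) true
  let U' : Set (Om d) := {ω | opn ω ∈ Us B ρ m X w w'}
  have hopn : ∀ x y : Om d, (∀ i : Edge d × Fin 3, i.1 ≠ e → x i = y i) → wq (opn x) = wq (opn y) := by
    intro x y h
    funext e'
    by_cases hee : e' = e
    · subst hee; simp [wq, opn]
    · have : ∀ i : Fin 3, ((e', i) : Edge d × Fin 3) ≠ (e, 0) := fun i hi => hee (Prod.ext_iff.1 hi).1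
      simp only [wq, opn, Function.update_of_ne (this _)]
      rw [h (e', 0) hee, h (e', 1) hee, h (e', 2) hee]
  have hU1 : Us B ρ m X w w' = {ω : Om d | wq ω e = true} ∩ U' := by
    ext ω
    have hkey : wq ω e = true → wq (opn ω) = wq ω := by
      intro h
      funext e'
      by_cases hee : e' = e
      · subst hee; rw [h]; simp [wq, opn]
      · have : ∀ i : Fin 3, ((e', i) : Edge d × Fin 3) ≠ (e, 0) := fun i hi => hee (Prod.ext_iff.1 hi).1
        simp only [wq, opn, Function.update_of_ne (this _)]
    have hiff : wq ω e = true → (opn ω ∈ Us B ρ m X w w' ↔ ω ∈ Us B ρ m X w w') := by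
      intro h
      show Use (sel (rst B (wq (opn ω))) ρ m X) w w' ↔ Use (sel (rst B (wq ω)) ρ m X) w w'
      rw [hkey h]
    constructor
    · intro h
      have ho : wq ω e = true := by
        obtain ⟨h1, h2⟩ := rst_open ((sel_spec (rst B (wq ω)) ρ m X).use_open h)
        obtain ⟨e0, he0⟩ := e
        simp only at he
        subst he
        exact h2
      exact ⟨ho, (hiff ho).2 h⟩
    · rintro ⟨h1, h2⟩
      exact (hiff h1).1 h2
  have hU'l : Loc {x : Edge d × Fin 3 | x.1 ≠ e} U' := by
    intro x y hxy hx
    have hx : Use (sel (rst B (wq (opn x))) ρ m X) w w' := hx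
    rw [hopn x y hxy] at hx
    exact hx
  have hU'm : MeasurableSet U' := by
    have : Measurable opn := by
      refine measurable_pi_lambda _ fun i => ?_
      by_cases hi : i = (e, 0)
      · subst hi; simp only [opn, Function.update_self]; exact measurable_const
      · simp only [opn, Function.update_of_ne hi]; exact measurable_pi_apply i
    exact this ((Us_loc B ρ m X w w').measurable (B_fin hB))
  have hdj : Disjoint {x : Edge d × Fin 3 | x.1 ≠ e} {x : Edge d × Fin 3 | x.1 = e} := by
    rw [Set.disjoint_left]; intro x h1 h2; exact h1 h2
  have m1 := (wq_edge e true).measurable (edge_fin e)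
  have m2 := (wp_edge e false).measurable (edge_fin e)
  have e1 : PM (rr p' β κ) (Us B ρ m X w w' ∩ {ω | wp ω e = false} ∩ A) =
      ENNReal.ofReal (q - p) * PM (rr p' β κ) (U' ∩ A) := by
    rw [← prob_diff hp hq e, ← ind_eq (rr p' β κ) (m1.inter m2) (hU'm.inter hA) (hU'l.inter hAl)
      ((wq_edge e true).inter (wp_edge e false)) hdj]
    congr 1
    rw [hU1]
    ext ω; simp only [Set.mem_inter_iff]; constructor
    · rintro ⟨⟨⟨a, b⟩, c⟩, f⟩; exact ⟨⟨a, c⟩, b, f⟩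
    · rintro ⟨⟨a, c⟩, b, f⟩; exact ⟨⟨⟨a, b⟩, c⟩, f⟩
  have e2 : PM (rr p' β κ) (Us B ρ m X w w' ∩ A) = ENNReal.ofReal q * PM (rr p' β κ) (U' ∩ A) := by
    rw [← prob_open hq e, ← ind_eq (rr p' β κ) m1 (hU'm.inter hA) (hU'l.inter hAl) (wq_edge e true) hdj]
    congr 1
    rw [hU1, Set.inter_assoc]
  have hp'p : (p' : ℝ) ≤ p := by nlinarith [p'.2.2, β.2.1]
  have hpq : (p : ℝ) ≤ q := by
    have : (0 : ℝ) ≤ (1 - p') * (1 - β) := mul_nonneg (by linarith [p'.2.2]) (by linarith [β.2.2])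
    nlinarith [κ.2.1]
  rw [e1, e2, ← mul_assoc, ← ENNReal.ofReal_mul (div_nonneg (by linarith) hp'0.le)]
  gcongr
  rw [div_mul_eq_mul_div, le_div_iff₀ hp'0]
  exact mul_le_mul_of_nonneg_left (hp'p.trans hpq) (by linarith)
end

namespace Pr
variable {P : Pr d}

lemma BadE_loc' (k : ℕ) (w w' : V d) (e : Edge d) (he : e.1 = s(w, w')) :
    Loc {x : Edge d × Fin 3 | x.1 ≠ e} {ω | P.BadE k w w' ω} := by
  intro x y h hx
  have hd : ∀ z z' : Config d, (∀ e' ≠ e, z e' = z' e') → delc w w' z = delc w w' z' := by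
    intro z z' hz
    funext e'
    by_cases hee : e' = e
    · subst hee; unfold delc; rw [if_pos he, if_pos he]
    · exact delc_congr (hz e' hee)
  have h1 : delc w w' (la x) = delc w w' (la y) := hd _ _ fun e' he' => h (e', 0) he'
  have h2 : delc w w' (wp x) = delc w w' (wp y) := hd _ _ fun e' he' => by
    simp only [wp, h (e', 0) he', h (e', 1) he']
  have hx : P.Bad (delc w w' (la x)) (delc w w' (wp x)) k w := hx
  rw [h1, h2] at hx
  exact hx

lemma BadE_meas (k : ℕ) (w w' : V d) : MeasurableSet {ω : Om d | P.BadE k w w' ω} :=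
  (BadE_loc k w w').measurable (dep_fin k w)

end Pr
end

section
variable {d : ℕ}
namespace Pr
variable {P : Pr d}

/-- closed edges -/
def Qc (w w' : V d) : Set (Om d) := {ω | ¬ edgeOpen (wp ω) w w'}

lemma Qc_eq {w w' : V d} (h : sym2dist1 s(w, w') = 1) :
    Qc w w' = {ω : Om d | wp ω (⟨s(w, w'), h⟩ : Edge d) = false} := by
  ext ω
  show ¬ edgeOpen (wp ω) w w' ↔ wp ω (⟨s(w, w'), h⟩ : Edge d) = false
  constructor
  · intro h1
    by_contra h2
    exact h1 ⟨h, by simpa using h2⟩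
  · rintro h1 ⟨h2, h3⟩
    exact absurd (h1.symm.trans h3) (by decide)

lemma Us_adj {B : Set (V d)} {ρ m : ℕ} {X w w' : V d} {ω : Om d} (h : ω ∈ Us B ρ m X w w') :
    edgeOpen (wq ω) w w' := rst_open ((sel_spec (rst B (wq ω)) ρ m X).use_open h)

lemma Us_meas {B : Set (V d)} (hB : B.Finite) (ρ m : ℕ) (X w w' : V d) : MeasurableSet (Us B ρ m X w w') :=
  (Us_loc B ρ m X w w').measurable (B_fin hB)

lemma Qc_meas (w w' : V d) : MeasurableSet (Qc (d := d) w w') := by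
  by_cases h : sym2dist1 s(w, w') = 1
  · rw [Qc_eq h]; exact (wp_edge _ false).measurable (edge_fin _)
  · have : Qc w w' = (Set.univ : Set (Om d)) := by
      ext ω; simp only [Set.mem_univ, iff_true]
      rintro ⟨h1, -⟩; exact h h1
    rw [this]; exact MeasurableSet.univ

section
variable {p' β κ p q : unitInterval}

lemma use_le (hp : (1 - p : ℝ) = (1 - p') * (1 - β)) (hq : (1 - q : ℝ) = (1 - p') * (1 - β) * (1 - κ))
    (hp'0 : (0 : ℝ) < p') {B : Set (V d)} (hB : B.Finite) (ρ m : ℕ) (X w w' : V d)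
    {A : Set (Om d)} (hA : MeasurableSet A)
    (hAl : ∀ e : Edge d, e.1 = s(w, w') → Loc {x : Edge d × Fin 3 | x.1 ≠ e} A) :
    PM (rr p' β κ) (Us B ρ m X w w' ∩ Qc w w' ∩ A) ≤
      ENNReal.ofReal ((q - p) / p') * PM (rr p' β κ) (Us B ρ m X w w' ∩ A) := by
  by_cases h : sym2dist1 s(w, w') = 1
  · rw [Qc_eq h]
    exact use_fact hp hq hp'0 hB ρ m X w w' ⟨s(w, w'), h⟩ rfl hA (hAl _ rfl)
  · have : Us B ρ m X w w' = (∅ : Set (Om d)) := by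
      ext ω; simp only [Set.mem_empty_iff_false, iff_false]
      intro h1; exact h (Us_adj h1).1
    simp [this]

/-- upper bound on the cost of all detours -/
noncomputable def cost (P : Pr d) (ρ m : ℕ) (X : V d) (ω : Om d) : ℝ≥0∞ :=
  ∑ x ∈ cbF (0 : V d) ((ρ + m : ℕ) : ℤ) ×ˢ cbF (0 : V d) ((ρ + m : ℕ) : ℤ),
    3 * ((2 * P.NN 0 : ℕ) * (Us (cb 0 (ρ + m)) ρ m X x.1 x.2 ∩ Qc x.1 x.2).indicator 1 ω +
      ∑' j, (P.NN (j + 1) : ℝ≥0∞) * (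
        (Us (cb 0 (ρ + m)) ρ m X x.1 x.2 ∩ Qc x.1 x.2 ∩ {ω | P.BadE j x.1 x.2 ω}).indicator 1 ω +
        (Us (cb 0 (ρ + m)) ρ m X x.1 x.2 ∩ Qc x.1 x.2 ∩ {ω | P.BadE j x.2 x.1 ω}).indicator 1 ω))

noncomputable abbrev pth (ρ m : ℕ) (X : V d) (ω : Om d) : ℕ × (ℕ → V d) := sel (rst (cb 0 (ρ + m)) (wq ω)) ρ m X

lemma pth_GP (ρ m : ℕ) (X : V d) (ω : Om d) : GP (rst (cb 0 (ρ + m)) (wq ω)) ρ m (pth ρ m X ω) := sel_spec _ _ _ _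

open Classical in
lemma sum_use_exp (ν : Measure (Om d)) (ρ m : ℕ) (X : V d) (A : V d → V d → Set (Om d)) (hA : ∀ w w', MeasurableSet (A w w')) :
    ∑ x ∈ cbF (0 : V d) ((ρ + m : ℕ) : ℤ) ×ˢ cbF (0 : V d) ((ρ + m : ℕ) : ℤ), ν (Us (cb 0 (ρ + m)) ρ m X x.1 x.2 ∩ A x.1 x.2) =
      ∫⁻ ω, ∑ t ∈ Finset.range (pth ρ m X ω).1, (if ω ∈ A ((pth ρ m X ω).2 t) ((pth ρ m X ω).2 (t + 1)) then (1 : ℝ≥0∞) else 0) ∂ν := by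
  have : ∀ ω, ∑ t ∈ Finset.range (pth ρ m X ω).1, (if ω ∈ A ((pth ρ m X ω).2 t) ((pth ρ m X ω).2 (t + 1)) then (1 : ℝ≥0∞) else 0) =
      ∑ x ∈ cbF (0 : V d) ((ρ + m : ℕ) : ℤ) ×ˢ cbF (0 : V d) ((ρ + m : ℕ) : ℤ),
        (Us (cb 0 (ρ + m)) ρ m X x.1 x.2 ∩ A x.1 x.2).indicator 1 ω := by
    intro ω
    rw [← (pth_GP ρ m X ω).sum_use fun w w' => if ω ∈ A w w' then (1 : ℝ≥0∞) else 0]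
    refine Finset.sum_congr rfl fun x _ => ?_
    rw [Set.indicator_apply, ← ite_and]
    rfl
  simp only [this]
  rw [lintegral_finsetSum]
  · refine Finset.sum_congr rfl fun x _ => ?_
    rw [lintegral_indicator_one ((Us_meas (cb_finite _ _) _ _ _ _ _).inter (hA _ _))]
  · intro x _
    exact measurable_one.indicator ((Us_meas (cb_finite _ _) _ _ _ _ _).inter (hA _ _))

open Classical in
lemma cost_exp (hp : (1 - p : ℝ) = (1 - p') * (1 - β)) (hq : (1 - q : ℝ) = (1 - p') * (1 - β) * (1 - κ))
    (hp'0 : (0 : ℝ) < p') (ρ m : ℕ) (X : V d) {K : ℝ≥0∞}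
    (hK : ∑' j, (P.NN (j + 1) : ℝ≥0∞) * ∫⁻ ω, ((vts (pth ρ m X ω)).filter (fun w => ω ∈ P.BadV j w)).card ∂(PM (rr p' β κ))
      ≤ (ρ + m : ℕ) * K) :
    ∫⁻ ω, P.cost ρ m X ω ∂(PM (rr p' β κ)) ≤
      ENNReal.ofReal ((q - p) / p') * ((6 * (P.NN 0 + K)) * (ρ + m : ℕ)) := by
  set ν := PM (rr (d := d) p' β κ) with hν
  set c := ENNReal.ofReal ((q - p) / p') with hc
  set Bx := cbF (0 : V d) ((ρ + m : ℕ) : ℤ) ×ˢ cbF (0 : V d) ((ρ + m : ℕ) : ℤ) with hBx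
  have hBf : (cb (0 : V d) (ρ + m)).Finite := cb_finite _ _
  have hUm := fun w w' => Us_meas hBf ρ m X w w'
  have m1 : ∀ x : V d × V d, MeasurableSet (Us (cb 0 (ρ + m)) ρ m X x.1 x.2 ∩ Qc x.1 x.2) :=
    fun x => (hUm _ _).inter (Qc_meas _ _)
  have m2 : ∀ (j) (x : V d × V d), MeasurableSet (Us (cb 0 (ρ + m)) ρ m X x.1 x.2 ∩ Qc x.1 x.2 ∩ {ω | P.BadE j x.1 x.2 ω}) :=
    fun j x => (m1 x).inter (BadE_meas _ _ _)
  have m3 : ∀ (j) (x : V d × V d), MeasurableSet (Us (cb 0 (ρ + m)) ρ m X x.1 x.2 ∩ Qc x.1 x.2 ∩ {ω | P.BadE j x.2 x.1 ω}) :=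
    fun j x => (m1 x).inter (BadE_meas _ _ _)
  have i1 : ∀ A : Set (Om d), MeasurableSet A → Measurable (A.indicator (1 : Om d → ℝ≥0∞)) :=
    fun A hA => measurable_one.indicator hA
  have mj : ∀ (x : V d × V d) j, Measurable fun ω => (P.NN (j + 1) : ℝ≥0∞) * (
        (Us (cb 0 (ρ + m)) ρ m X x.1 x.2 ∩ Qc x.1 x.2 ∩ {ω | P.BadE j x.1 x.2 ω}).indicator (1 : Om d → ℝ≥0∞) ω +
        (Us (cb 0 (ρ + m)) ρ m X x.1 x.2 ∩ Qc x.1 x.2 ∩ {ω | P.BadE j x.2 x.1 ω}).indicator (1 : Om d → ℝ≥0∞) ω) :=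
    fun x j => ((i1 _ (m2 j x)).add (i1 _ (m3 j x))).const_mul _
  have e1 : ∫⁻ ω, P.cost ρ m X ω ∂ν = ∑ x ∈ Bx, 3 * ((2 * P.NN 0 : ℕ) * ν (Us (cb 0 (ρ + m)) ρ m X x.1 x.2 ∩ Qc x.1 x.2) +
      ∑' j, (P.NN (j + 1) : ℝ≥0∞) * (
        ν (Us (cb 0 (ρ + m)) ρ m X x.1 x.2 ∩ Qc x.1 x.2 ∩ {ω | P.BadE j x.1 x.2 ω}) +
        ν (Us (cb 0 (ρ + m)) ρ m X x.1 x.2 ∩ Qc x.1 x.2 ∩ {ω | P.BadE j x.2 x.1 ω}))) := by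
    unfold cost
    rw [lintegral_finsetSum _ fun x _ => ?_]
    · refine Finset.sum_congr rfl fun x _ => ?_
      rw [lintegral_const_mul _ ?_, lintegral_add_left ?_, lintegral_const_mul _ (i1 _ (m1 x)), lintegral_indicator_one (m1 x),
        lintegral_tsum fun j => (mj x j).aemeasurable]
      · congr 3
        funext j
        have hm : Measurable fun ω => (Us (cb 0 (ρ + m)) ρ m X x.1 x.2 ∩ Qc x.1 x.2 ∩ {ω | P.BadE j x.1 x.2 ω}).indicator (1 : Om d → ℝ≥0∞) ω +
            (Us (cb 0 (ρ + m)) ρ m X x.1 x.2 ∩ Qc x.1 x.2 ∩ {ω | P.BadE j x.2 x.1 ω}).indicator (1 : Om d → ℝ≥0∞) ω :=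
          (i1 _ (m2 j x)).add (i1 _ (m3 j x))
        rw [lintegral_const_mul _ hm, lintegral_add_left (i1 _ (m2 j x)),
          lintegral_indicator_one (m2 j x), lintegral_indicator_one (m3 j x)]
      · exact (i1 _ (m1 x)).const_mul _
      · exact ((i1 _ (m1 x)).const_mul _).add (Measurable.tsum (mj x))
    · exact (((i1 _ (m1 x)).const_mul _).add (Measurable.tsum (mj x))).const_mul _
  have b1 : ∀ x : V d × V d, ν (Us (cb 0 (ρ + m)) ρ m X x.1 x.2 ∩ Qc x.1 x.2) ≤
      c * ν (Us (cb 0 (ρ + m)) ρ m X x.1 x.2 ∩ Set.univ) := by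
    intro x
    have := use_le hp hq hp'0 hBf ρ m X x.1 x.2 MeasurableSet.univ (fun e _ => fun _ _ _ _ => trivial)
    rwa [Set.inter_univ (Us (cb 0 (ρ + m)) ρ m X x.1 x.2 ∩ Qc x.1 x.2)] at this
  have b2 : ∀ (j) (x : V d × V d), ν (Us (cb 0 (ρ + m)) ρ m X x.1 x.2 ∩ Qc x.1 x.2 ∩ {ω | P.BadE j x.1 x.2 ω}) ≤
      c * ν (Us (cb 0 (ρ + m)) ρ m X x.1 x.2 ∩ P.BadV j x.1) := by
    intro j x
    refine (use_le hp hq hp'0 hBf ρ m X x.1 x.2 (BadE_meas _ _ _) (fun e he => BadE_loc' j x.1 x.2 e he)).trans ?_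
    refine mul_le_mul_right (measure_mono ?_) _
    rintro ω ⟨h1, h2⟩
    exact ⟨h1, x.2, mem_cbF.2 (edgeOpen_cb (Us_adj h1)), h2⟩
  have b3 : ∀ (j) (x : V d × V d), ν (Us (cb 0 (ρ + m)) ρ m X x.1 x.2 ∩ Qc x.1 x.2 ∩ {ω | P.BadE j x.2 x.1 ω}) ≤
      c * ν (Us (cb 0 (ρ + m)) ρ m X x.1 x.2 ∩ P.BadV j x.2) := by
    intro j x
    refine (use_le hp hq hp'0 hBf ρ m X x.1 x.2 (BadE_meas _ _ _)
      (fun e he => BadE_loc' j x.2 x.1 e (by rw [he, Sym2.eq_swap]))).trans ?_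
    refine mul_le_mul_right (measure_mono ?_) _
    rintro ω ⟨h1, h2⟩
    exact ⟨h1, x.1, mem_cbF.2 (edgeOpen_cb (edgeOpen_symm (Us_adj h1))), h2⟩
  have s1 : ∑ x ∈ Bx, ν (Us (cb 0 (ρ + m)) ρ m X x.1 x.2 ∩ Set.univ) ≤ (ρ + m : ℕ) := by
    rw [sum_use_exp ν ρ m X (fun _ _ => Set.univ) (fun _ _ => MeasurableSet.univ)]
    calc _ ≤ ∫⁻ _, ((ρ + m : ℕ) : ℝ≥0∞) ∂ν := by
          refine lintegral_mono fun ω => ?_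
          simp only [Set.mem_univ, if_true, Finset.sum_const, Finset.card_range, nsmul_eq_mul, mul_one]
          have := (pth_GP ρ m X ω).1
          exact_mod_cast (by omega : (pth ρ m X ω).1 ≤ ρ + m)
      _ = _ := by rw [lintegral_const, hν, measure_univ, mul_one]
  have s2 : ∀ j, ∑ x ∈ Bx, ν (Us (cb 0 (ρ + m)) ρ m X x.1 x.2 ∩ P.BadV j x.1) ≤
      ∫⁻ ω, ((vts (pth ρ m X ω)).filter (fun w => ω ∈ P.BadV j w)).card ∂ν := by
    intro j
    rw [sum_use_exp ν ρ m X (fun w _ => P.BadV j w) (fun _ _ => BadV_meas _ _)]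
    exact lintegral_mono fun ω => (pth_GP ρ m X ω).sum_left fun w => ω ∈ P.BadV j w
  have s3 : ∀ j, ∑ x ∈ Bx, ν (Us (cb 0 (ρ + m)) ρ m X x.1 x.2 ∩ P.BadV j x.2) ≤
      ∫⁻ ω, ((vts (pth ρ m X ω)).filter (fun w => ω ∈ P.BadV j w)).card ∂ν := by
    intro j
    rw [sum_use_exp ν ρ m X (fun _ w => P.BadV j w) (fun _ _ => BadV_meas _ _)]
    exact lintegral_mono fun ω => (pth_GP ρ m X ω).sum_right fun w => ω ∈ P.BadV j w
  rw [e1]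
  calc _ ≤ ∑ x ∈ Bx, 3 * ((2 * P.NN 0 : ℕ) * (c * ν (Us (cb 0 (ρ + m)) ρ m X x.1 x.2 ∩ Set.univ)) +
      ∑' j, (P.NN (j + 1) : ℝ≥0∞) * (
        c * ν (Us (cb 0 (ρ + m)) ρ m X x.1 x.2 ∩ P.BadV j x.1) +
        c * ν (Us (cb 0 (ρ + m)) ρ m X x.1 x.2 ∩ P.BadV j x.2))) := by
        refine Finset.sum_le_sum fun x _ => ?_
        refine mul_le_mul_right (add_le_add (mul_le_mul_right (b1 x) _) (ENNReal.tsum_le_tsum fun j => ?_)) _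
        exact mul_le_mul_right (add_le_add (b2 j x) (b3 j x)) _
    _ = c * (3 * ((2 * P.NN 0 : ℕ) * (∑ x ∈ Bx, ν (Us (cb 0 (ρ + m)) ρ m X x.1 x.2 ∩ Set.univ)) +
        ∑' j, (P.NN (j + 1) : ℝ≥0∞) * (∑ x ∈ Bx, ν (Us (cb 0 (ρ + m)) ρ m X x.1 x.2 ∩ P.BadV j x.1) +
          ∑ x ∈ Bx, ν (Us (cb 0 (ρ + m)) ρ m X x.1 x.2 ∩ P.BadV j x.2)))) := by
        rw [← Finset.mul_sum, Finset.sum_add_distrib, ← Finset.mul_sum, ← Finset.mul_sum,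
          ← Summable.tsum_finsetSum fun _ _ => ENNReal.summable]
        have : ∀ j, ∑ x ∈ Bx, (P.NN (j + 1) : ℝ≥0∞) * (
            c * ν (Us (cb 0 (ρ + m)) ρ m X x.1 x.2 ∩ P.BadV j x.1) +
            c * ν (Us (cb 0 (ρ + m)) ρ m X x.1 x.2 ∩ P.BadV j x.2)) =
            c * ((P.NN (j + 1) : ℝ≥0∞) * (∑ x ∈ Bx, ν (Us (cb 0 (ρ + m)) ρ m X x.1 x.2 ∩ P.BadV j x.1) +
              ∑ x ∈ Bx, ν (Us (cb 0 (ρ + m)) ρ m X x.1 x.2 ∩ P.BadV j x.2))) := by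
          intro j
          rw [← Finset.mul_sum, Finset.sum_add_distrib, ← Finset.mul_sum, ← Finset.mul_sum]; ring
        simp only [this]
        rw [ENNReal.tsum_mul_left]; ring
    _ ≤ c * (3 * ((2 * P.NN 0 : ℕ) * (ρ + m : ℕ) +
        ∑' j, (P.NN (j + 1) : ℝ≥0∞) * (2 * ∫⁻ ω, ((vts (pth ρ m X ω)).filter (fun w => ω ∈ P.BadV j w)).card ∂ν))) := by
        refine mul_le_mul_right (mul_le_mul_right (add_le_add (mul_le_mul_right s1 _) (ENNReal.tsum_le_tsum fun j => ?_)) _) _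
        rw [two_mul]
        exact mul_le_mul_right (add_le_add (s2 j) (s3 j)) _
    _ ≤ c * (3 * ((2 * P.NN 0 : ℕ) * (ρ + m : ℕ) + 2 * ((ρ + m : ℕ) * K))) := by
        gcongr
        simp only [mul_left_comm _ (2 : ℝ≥0∞)]
        rw [ENNReal.tsum_mul_left]
        gcongr
    _ = _ := by push_cast; ring

end
end Pr
end

section
variable {d : ℕ}
namespace Pr
variable {P : Pr d}

open Classical in
/-- cost of a single edge of the path -/
noncomputable def gco (P : Pr d) (ω : Om d) (w w' : V d) : ℝ≥0∞ :=
  3 * ((2 * P.NN 0 : ℕ) * (if ω ∈ Qc w w' then 1 else 0) +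
      ∑' j, (P.NN (j + 1) : ℝ≥0∞) * (
        (if ω ∈ Qc w w' ∧ P.BadE j w w' ω then 1 else 0) + (if ω ∈ Qc w w' ∧ P.BadE j w' w ω then 1 else 0)))

open Classical in
lemma cost_eq (ρ m : ℕ) (X : V d) (ω : Om d) :
    P.cost ρ m X ω = ∑ t ∈ Finset.range (pth ρ m X ω).1, P.gco ω ((pth ρ m X ω).2 t) ((pth ρ m X ω).2 (t + 1)) := by
  rw [← (pth_GP ρ m X ω).sum_use fun w w' => P.gco ω w w']
  unfold cost
  refine Finset.sum_congr rfl fun x _ => ?_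
  by_cases hu : Use (pth ρ m X ω) x.1 x.2
  · have hu' : ω ∈ Us (cb 0 (ρ + m)) ρ m X x.1 x.2 := hu
    rw [if_pos hu]
    unfold gco
    congr 1
    congr 1
    · congr 1
      rw [Set.indicator_apply]
      simp only [Set.mem_inter_iff, hu', true_and, Pi.one_apply]
    · congr 1
      funext j
      congr 1
      rw [Set.indicator_apply, Set.indicator_apply]
      simp only [Set.mem_inter_iff, hu', true_and, Pi.one_apply]
      rfl
  · have hu' : ω ∉ Us (cb 0 (ρ + m)) ρ m X x.1 x.2 := hu
    rw [if_neg hu]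
    simp [hu']

open Classical in
lemma clc_le {ω : Om d} {κ : V d → ℕ}
    (hκ : ∀ w, (P.NN (κ w) : ℝ≥0∞) ≤ P.NN 0 + ∑' j, (P.NN (j + 1) : ℝ≥0∞) * (if P.Bad (la ω) (wp ω) j w then 1 else 0))
    (f : ℕ → V d) (t : ℕ) : P.clc (wp ω) κ f t ≤ P.gco ω (f t) (f (t + 1)) := by
  unfold clc
  split_ifs with h
  · exact zero_le
  · have hl : ¬ edgeOpen (la ω) (f t) (f (t + 1)) := by
      rintro ⟨h1, h2⟩
      refine h ⟨h1, ?_⟩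
      have := la_le ω ⟨_, h1⟩
      rw [h2] at this
      exact Bool.eq_true_of_true_le this
    have hQ : ω ∈ Qc (f t) (f (t + 1)) := h
    have e1 : ∀ j, P.BadE j (f t) (f (t + 1)) ω ↔ P.Bad (la ω) (wp ω) j (f t) := by
      intro j; unfold BadE; rw [delc_self h, delc_self hl]
    have e2 : ∀ j, P.BadE j (f (t + 1)) (f t) ω ↔ P.Bad (la ω) (wp ω) j (f (t + 1)) := by
      intro j; unfold BadE
      rw [delc_self fun h' => h (edgeOpen_symm h'), delc_self fun h' => hl (edgeOpen_symm h')]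
    unfold gco
    simp only [hQ, e1, e2, true_and, if_true]
    refine mul_le_mul_right ?_ _
    refine (add_le_add (hκ _) (hκ _)).trans (le_of_eq ?_)
    simp only [mul_add]
    rw [ENNReal.tsum_add]
    push_cast
    ring

lemma determ {ω : Om d} {ρ m k : ℕ} {X : V d} (hF : ∀ w, ∃ k, P.FF (la ω) (wp ω) k w)
    (hk : ∀ w, w ∈ cb (0 : V d) ρ ∨ w ∈ cb X ρ → ∀ j ≥ k, ω ∉ P.BadV j w)
    (hq : ∃ v ∈ cb (0 : V d) ρ, ∃ v' ∈ cb X ρ, chemDist (wq ω) v v' ≤ m) {L : ℝ≥0∞}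
    (hL : m + P.cost ρ m X ω + 4 * P.NN k ≤ L) :
    wp ω ∈ Pair X (ρ + (7 * P.U k).toNat) L := by
  classical
  choose κ h1 h2 h3 using fun w => exists_kappa (hF w)
  choose hub hh using fun w => BB_nonempty ((h1 w).f1 (κ w) le_rfl)
  have hG := pth_GP ρ m X ω
  have hend : (pth ρ m X ω).2 (pth ρ m X ω).1 ∈ cb X ρ := sel_end hq
  have hsmall : ∀ w, w ∈ cb (0 : V d) ρ ∨ w ∈ cb X ρ → κ w ≤ k := by
    intro w hw
    exact h2 w k fun j hj hb => hk w hw j hj (BadV_of_Bad hb)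
  have hpl := path_lemma (P := P) (la_le ω) h1 hh (n := (pth ρ m X ω).1) (f := (pth ρ m X ω).2)
    (fun t ht => edgeOpen_cb (hG.2.1 t ht))
  have near : ∀ w, κ w ≤ k → hub w ∈ cb w (7 * P.U k) := by
    intro w hw
    refine cb_mono (BB_near (hh w)) ?_
    have : P.U (κ w) ≤ P.U k := by
      unfold U
      have h0 : (1 : ℤ) ≤ P.A := by have := P.hA; omega
      have h1 : (0 : ℤ) ≤ P.M := Int.natCast_nonneg _
      have : (P.A : ℤ) ^ κ w ≤ (P.A : ℤ) ^ k := pow_le_pow_right₀ h0 hw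
      gcongr
    linarith
  have hU : ((ρ + (7 * P.U k).toNat : ℕ) : ℤ) = ρ + 7 * P.U k := by
    have := P.U0 k; push_cast; omega
  refine ⟨hub ((pth ρ m X ω).2 0), ?_, hub ((pth ρ m X ω).2 (pth ρ m X ω).1), ?_, BB_inf (la_le ω) (h1 _) (hh _),
    BB_inf (la_le ω) (h1 _) (hh _), hpl.trans (le_trans ?_ hL)⟩
  · exact cb_mono (cb_trans (near _ (hsmall _ (Or.inl hG.2.2.2))) hG.2.2.2) (by rw [hU]; linarith)
  · exact cb_mono (cb_trans (near _ (hsmall _ (Or.inr hend))) hend) (by rw [hU]; linarith)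
  · have a1 : ((pth ρ m X ω).1 : ℝ≥0∞) ≤ m := by exact_mod_cast hG.1
    have a2 : ∑ t ∈ Finset.range (pth ρ m X ω).1, P.clc (wp ω) κ (pth ρ m X ω).2 t ≤ P.cost ρ m X ω := by
      rw [cost_eq]
      exact Finset.sum_le_sum fun t _ => clc_le h3 _ t
    have a3 : (P.NN (κ ((pth ρ m X ω).2 0)) : ℝ≥0∞) ≤ P.NN k := by exact_mod_cast NN_mono P (hsmall _ (Or.inl hG.2.2.2))
    have a4 : (P.NN (κ ((pth ρ m X ω).2 (pth ρ m X ω).1)) : ℝ≥0∞) ≤ P.NN k := by exact_mod_cast NN_mono P (hsmall _ (Or.inr hend))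
    calc _ ≤ (m : ℝ≥0∞) + P.cost ρ m X ω + 2 * P.NN k + 2 * P.NN k := by gcongr
      _ = _ := by ring

end Pr
end

section
variable {d : ℕ}
namespace Pr
variable {P : Pr d}

lemma cost_meas (ρ m : ℕ) (X : V d) : Measurable (P.cost ρ m X) := by
  have hBf : (cb (0 : V d) (ρ + m)).Finite := cb_finite _ _
  have hUm := fun w w' => Us_meas hBf ρ m X w w'
  have m1 : ∀ x : V d × V d, MeasurableSet (Us (cb 0 (ρ + m)) ρ m X x.1 x.2 ∩ Qc x.1 x.2) :=
    fun x => (hUm _ _).inter (Qc_meas _ _)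
  have m2 : ∀ (j) (x : V d × V d), MeasurableSet (Us (cb 0 (ρ + m)) ρ m X x.1 x.2 ∩ Qc x.1 x.2 ∩ {ω | P.BadE j x.1 x.2 ω}) :=
    fun j x => (m1 x).inter (BadE_meas _ _ _)
  have m3 : ∀ (j) (x : V d × V d), MeasurableSet (Us (cb 0 (ρ + m)) ρ m X x.1 x.2 ∩ Qc x.1 x.2 ∩ {ω | P.BadE j x.2 x.1 ω}) :=
    fun j x => (m1 x).inter (BadE_meas _ _ _)
  have i1 : ∀ A : Set (Om d), MeasurableSet A → Measurable (A.indicator (1 : Om d → ℝ≥0∞)) :=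
    fun A hA => measurable_one.indicator hA
  unfold cost
  refine Finset.measurable_fun_sum _ fun x _ => ?_
  exact (((i1 _ (m1 x)).const_mul _).add (Measurable.tsum
    fun j => ((i1 _ (m2 j x)).add (i1 _ (m3 j x))).const_mul _)).const_mul _

lemma dexp_sum {C θ : ℝ≥0∞} (hC : C ≠ ⊤) (hθ : θ < 1) : ∑' k : ℕ, C * θ ^ 2 ^ k ≠ ⊤ := by
  rw [ENNReal.tsum_mul_left]
  refine ENNReal.mul_ne_top hC (ne_top_of_le_ne_top ?_ (ENNReal.tsum_le_tsum fun k =>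
    pow_le_pow_right_of_le_one' hθ.le Nat.lt_two_pow_self.le))
  rw [ENNReal.tsum_geometric]
  exact ENNReal.inv_ne_top.2 (tsub_pos_of_lt hθ).ne'

lemma ae_FF {ν : Measure (Om d)} {C θ : ℝ≥0∞} (hC : C ≠ ⊤) (hθ : θ < 1)
    (ht : ∀ k w, ν (P.BadV k w) ≤ C * θ ^ 2 ^ k) : ∀ᵐ ω ∂ν, ∀ w, ∃ k, P.FF (la ω) (wp ω) k w := by
  rw [ae_all_iff]
  intro w
  filter_upwards [ae_eventually_notMem (s := fun k => P.BadV k w)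
    (ne_top_of_le_ne_top (dexp_sum hC hθ) (ENNReal.tsum_le_tsum fun k => ht k w))] with ω hω
  obtain ⟨k, hk⟩ := eventually_atTop.1 hω
  exact ⟨k, fun j hj hb => hk j hj (BadV_of_Bad hb)⟩

lemma bad_near {ν : Measure (Om d)} {C θ : ℝ≥0∞} (hC : C ≠ ⊤) (hθ : θ < 1)
    (ht : ∀ k w, ν (P.BadV k w) ≤ C * θ ^ 2 ^ k) (ρ : ℕ) {δ : ℝ≥0∞} (hδ : 0 < δ) :
    ∃ k, ∀ X : V d, ν {ω | ¬ ∀ w, w ∈ cb (0 : V d) ρ ∨ w ∈ cb X ρ → ∀ j ≥ k, ω ∉ P.BadV j w} ≤ δ := by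
  classical
  let N : ℕ := (2 * ρ + 1) ^ d + (2 * ρ + 1) ^ d
  have h1 := ENNReal.tendsto_sum_nat_add _ (dexp_sum hC hθ)
  have h2 : Tendsto (fun i => (N : ℝ≥0∞) * ∑' k : ℕ, C * θ ^ 2 ^ (k + i)) atTop (𝓝 (N * 0)) :=
    ENNReal.Tendsto.const_mul h1 (Or.inr (by finiteness))
  rw [mul_zero] at h2
  obtain ⟨k, hk⟩ := (h2.eventually (gt_mem_nhds hδ)).exists
  refine ⟨k, fun X => le_trans ?_ hk.le⟩
  calc _ ≤ ν (⋃ w ∈ cbF (0 : V d) ρ ∪ cbF X ρ, ⋃ j, P.BadV (j + k) w) := by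
        refine measure_mono fun ω hω => ?_
        have hω : ¬ ∀ w, w ∈ cb (0 : V d) ρ ∨ w ∈ cb X ρ → ∀ j ≥ k, ω ∉ P.BadV j w := hω
        push Not at hω
        obtain ⟨w, hw, j, hj, hb⟩ := hω
        simp only [Set.mem_iUnion]
        refine ⟨w, ?_, j - k, by rwa [Nat.sub_add_cancel hj]⟩
        rw [Finset.mem_union]
        exact hw.imp mem_cbF.2 mem_cbF.2
    _ ≤ ∑ w ∈ cbF (0 : V d) ρ ∪ cbF X ρ, ν (⋃ j, P.BadV (j + k) w) := measure_biUnion_finset_le _ _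
    _ ≤ ∑ w ∈ cbF (0 : V d) ρ ∪ cbF X ρ, ∑' j : ℕ, C * θ ^ 2 ^ (j + k) :=
        Finset.sum_le_sum fun w _ => (measure_iUnion_le _).trans (ENNReal.tsum_le_tsum fun j => ht _ _)
    _ ≤ _ := by
        rw [Finset.sum_const, nsmul_eq_mul]
        have : (cbF (0 : V d) ρ ∪ cbF X ρ).card ≤ N := by
          refine (Finset.card_union_le _ _).trans ?_
          rw [card_cbF, card_cbF]
        gcongr

section
variable {p' β κ p q : unitInterval}

open Classical in
lemma tc_key (hp : (1 - p : ℝ) = (1 - p') * (1 - β)) (hq : (1 - q : ℝ) = (1 - p') * (1 - β) * (1 - κ))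
    (hp'0 : (0 : ℝ) < p') (hpq : (p : ℝ) ≤ q) {C θ K : ℝ≥0∞} (hC : C ≠ ⊤) (hθ : θ < 1)
    (ht : ∀ k w, PM (rr p' β κ) (P.BadV k w) ≤ C * θ ^ 2 ^ k) (hK0 : K ≠ ⊤)
    (hK : ∀ (m : ℕ), 1 ≤ m → ∀ S : Om d → Finset (V d),
      (∀ ω, ∃ f : ℕ → V d, f 0 = 0 ∧ (∀ t < m, f (t + 1) ∈ cb (f t) 1) ∧ ∀ w ∈ S ω, ∃ t ≤ m, f t = w) →
      ∑' j, (P.NN (j + 1) : ℝ≥0∞) * ∫⁻ ω, ((S ω).filter (fun w => ω ∈ P.BadV j w)).card ∂(PM (rr p' β κ)) ≤ m * K)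
    {tp tq : V d → ℝ} (Hp : TC p tp) (Hq : TC q tq) (x : V d) :
    tp x ≤ (1 + 8 * (6 * (P.NN 0 + K)).toReal * ((q - p) / p')) * tq x := by
  set C1 : ℝ := (6 * ((P.NN 0 : ℝ≥0∞) + K)).toReal with hC1
  set e : ℝ := ((q : ℝ) - p) / p' with he
  have he0 : 0 ≤ e := div_nonneg (by linarith) hp'0.le
  have hC10 : 0 ≤ C1 := ENNReal.toReal_nonneg
  have hC1' : 6 * ((P.NN 0 : ℝ≥0∞) + K) = ENNReal.ofReal C1 := (ENNReal.ofReal_toReal (by finiteness)).symm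
  set D : ℝ := 1 + 8 * C1 * e with hD
  have hD1 : 1 ≤ D := by have := mul_nonneg hC10 he0; nlinarith
  by_contra hcon
  push Not at hcon
  have hd1 : 1 ≤ d := by have := P.hd; omega
  obtain ⟨s, hs1, hs2⟩ : ∃ s, tq x < s ∧ s < tp x / D := exists_between (by
    rw [lt_div_iff₀ (by linarith)]; linarith)
  rw [lt_div_iff₀ (by linarith)] at hs2
  obtain ⟨s', hs3, hs4⟩ := exists_between hs2
  have hs0 : 0 < s := (Hq.nonneg x).trans_lt hs1
  have hs'0 : 0 ≤ s' := by nlinarith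
  have hδ : (0 : ℝ≥0∞) < 8⁻¹ := by simp
  obtain ⟨ρ, n0, hup⟩ := up hd1 Hq x hs1 hδ
  obtain ⟨k, hk⟩ := bad_near hC hθ ht ρ hδ
  obtain ⟨n1, hlow⟩ := low hd1 Hp x hs'0 hs4 hδ (ρ + (7 * P.U k).toNat)
  -- choose n
  obtain ⟨n2, hn2⟩ := exists_nat_gt ((8 * C1 * e * ρ + 1 + 4 * P.NN k) / (s' - s * D))
  obtain ⟨n3, hn3⟩ := exists_nat_gt (1 / s)
  let n : ℕ := max (max n0 n1) (max n2 n3)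
  have hn2' : (n2 : ℝ) ≤ n := by exact_mod_cast (le_max_left n2 n3).trans (le_max_right _ _)
  have hn3' : (n3 : ℝ) ≤ n := by exact_mod_cast (le_max_right n2 n3).trans (le_max_right _ _)
  have hu := hup n ((le_max_left n0 n1).trans (le_max_left _ _))
  have hl := hlow n ((le_max_right n0 n1).trans (le_max_left _ _))
  have hsn : 1 ≤ s * n := by
    rw [div_lt_iff₀ hs0] at hn3
    nlinarith
  have hbig : 8 * C1 * e * ρ + 1 + 4 * P.NN k ≤ (s' - s * D) * n := by
    rw [div_lt_iff₀ (by linarith)] at hn2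
    nlinarith
  set m : ℕ := ⌊s * n⌋₊ with hm
  have hm1 : 1 ≤ m := Nat.le_floor (by exact_mod_cast hsn)
  have hmle : (m : ℝ) ≤ s * n := Nat.floor_le (by linarith)
  set X : V d := n • x with hX
  set ν := PM (rr (d := d) p' β κ) with hν
  -- expected cost
  have hE : ∫⁻ ω, P.cost ρ m X ω ∂ν ≤ ENNReal.ofReal (e * (C1 * (ρ + m : ℕ))) := by
    refine (cost_exp (P := P) hp hq hp'0 ρ m X (hK (ρ + m) (by omega) _ fun ω => (pth_GP ρ m X ω).star)).trans (le_of_eq ?_)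
    rw [hC1', ENNReal.ofReal_mul he0, ENNReal.ofReal_mul hC10, ENNReal.ofReal_natCast]
  set E : ℝ := e * (C1 * (ρ + m : ℕ)) with hEd
  have hE0 : 0 ≤ E := by positivity
  have hmar : ν {ω | ENNReal.ofReal (8 * E + 1) ≤ P.cost ρ m X ω} ≤ 8⁻¹ := by
    refine (meas_ge_le_lintegral_div (cost_meas ρ m X).aemeasurable
      (ENNReal.ofReal_pos.2 (by linarith)).ne' ENNReal.ofReal_ne_top).trans ?_
    refine (ENNReal.div_le_div_right hE _).trans ?_
    rw [← ENNReal.ofReal_div_of_pos (by linarith), show (8⁻¹ : ℝ≥0∞) = ENNReal.ofReal 8⁻¹ by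
      rw [ENNReal.ofReal_inv_of_pos (by norm_num)]; norm_num]
    refine ENNReal.ofReal_le_ofReal ?_
    rw [div_le_iff₀ (by linarith)]; linarith
  have hu' : ν {ω | wq ω ∉ Pair X ρ (ENNReal.ofReal (s * n))} ≤ 8⁻¹ := by
    rw [← law_wq p' β κ q hq, Measure.map_apply measurable_wq (meas_Pair _ _ _).compl] at hu
    exact hu
  have hl' : ν {ω | wp ω ∈ Pair X (ρ + (7 * P.U k).toNat) (ENNReal.ofReal (s' * n))} ≤ 8⁻¹ := by
    rw [← law_wp p' β κ p hp, Measure.map_apply measurable_wp (meas_Pair _ _ _)] at hl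
    exact hl
  have hnull : ν {ω | ¬ ∀ w, ∃ k, P.FF (la ω) (wp ω) k w} = 0 := ae_iff.1 (ae_FF hC hθ ht)
  have hcov : (Set.univ : Set (Om d)) ⊆ {ω | wp ω ∈ Pair X (ρ + (7 * P.U k).toNat) (ENNReal.ofReal (s' * n))} ∪
      ({ω | wq ω ∉ Pair X ρ (ENNReal.ofReal (s * n))} ∪ ({ω | ENNReal.ofReal (8 * E + 1) ≤ P.cost ρ m X ω} ∪
      ({ω | ¬ ∀ w, w ∈ cb (0 : V d) ρ ∨ w ∈ cb X ρ → ∀ j ≥ k, ω ∉ P.BadV j w} ∪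
      {ω | ¬ ∀ w, ∃ k, P.FF (la ω) (wp ω) k w}))) := by
    intro ω _
    by_contra hω
    simp only [Set.mem_union, Set.mem_ofPred_eq, not_or, not_not] at hω
    obtain ⟨a1, a2, a3, a4, a5⟩ := hω
    refine a1 (determ (m := m) a5 a4 ?_ ?_)
    · obtain ⟨v, hv, v', hv', -, -, hc⟩ := a2
      refine ⟨v, hv, v', hv', ?_⟩
      obtain ⟨l, -, -, -, -, hl⟩ := exists_path (ne_top_of_le_ne_top ENNReal.ofReal_ne_top hc)
      rw [hl] at hc ⊢
      have : (l : ℝ) ≤ s * n := by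
        rw [← ENNReal.ofReal_natCast, ENNReal.ofReal_le_ofReal_iff (by linarith)] at hc
        exact hc
      exact_mod_cast Nat.le_floor this
    · calc (m : ℝ≥0∞) + P.cost ρ m X ω + 4 * P.NN k ≤ ENNReal.ofReal m + ENNReal.ofReal (8 * E + 1) + ENNReal.ofReal (4 * P.NN k) := by
            refine add_le_add (add_le_add ?_ (not_le.1 a3).le) ?_
            · rw [ENNReal.ofReal_natCast]
            · rw [ENNReal.ofReal_mul (by norm_num), ENNReal.ofReal_natCast]; norm_num
        _ = ENNReal.ofReal (m + (8 * E + 1) + 4 * P.NN k) := by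
            rw [← ENNReal.ofReal_add (by positivity) (by positivity), ← ENNReal.ofReal_add (by positivity) (by positivity)]
        _ ≤ _ := by
            refine ENNReal.ofReal_le_ofReal ?_
            have : 8 * E = 8 * C1 * e * ρ + 8 * C1 * e * m := by rw [hEd]; push_cast; ring
            rw [this]
            have h8 : 0 ≤ 8 * C1 * e := by positivity
            have := mul_le_mul_of_nonneg_left hmle (by linarith : 0 ≤ 1 + 8 * C1 * e)
            rw [hD] at hbig
            nlinarith
  have hfin : (1 : ℝ≥0∞) ≤ 8⁻¹ + (8⁻¹ + (8⁻¹ + (8⁻¹ + 0))) := by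
    calc (1 : ℝ≥0∞) = ν Set.univ := by rw [hν, measure_univ]
      _ ≤ _ := measure_mono hcov
      _ ≤ _ := measure_union_le _ _
      _ ≤ _ := add_le_add hl' ((measure_union_le _ _).trans (add_le_add hu' ((measure_union_le _ _).trans
          (add_le_add hmar ((measure_union_le _ _).trans (add_le_add (hk X) hnull.le))))))
  have h8 : (8⁻¹ : ℝ≥0∞) = ENNReal.ofReal 8⁻¹ := by
    rw [ENNReal.ofReal_inv_of_pos (by norm_num)]; norm_num
  rw [h8, add_zero, ← ENNReal.ofReal_add (by norm_num) (by norm_num), ← ENNReal.ofReal_add (by norm_num) (by norm_num),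
    ← ENNReal.ofReal_add (by norm_num) (by norm_num), ENNReal.one_le_ofReal] at hfin
  norm_num at hfin

end
end Pr

/-- Monotonicity of the time constant. -/
lemma tc_mono (hd : 1 ≤ d) {p q : unitInterval} (hpq : (p : ℝ) ≤ q) (hp1 : (p : ℝ) < 1)
    {tp tq : V d → ℝ} (Hp : TC p tp) (Hq : TC q tq) (x : V d) : tq x ≤ tp x := by
  by_contra hcon
  push Not at hcon
  obtain ⟨s, hs1, hs2⟩ := exists_between hcon
  have hs0 : 0 ≤ s := (Hp.nonneg x).trans hs1.le
  have h8 : (8⁻¹ : ℝ≥0∞) = ENNReal.ofReal 8⁻¹ := by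
    rw [ENNReal.ofReal_inv_of_pos (by norm_num)]; norm_num
  have hδ : (0 : ℝ≥0∞) < 8⁻¹ := by simp
  obtain ⟨ρ, n0, hup⟩ := up hd Hp x hs1 hδ
  obtain ⟨n1, hlow⟩ := low hd Hq x hs0 hs2 hδ ρ
  let n := max n0 n1
  have hu := hup n (le_max_left _ _)
  have hl := hlow n (le_max_right _ _)
  have hκ0 : 0 ≤ ((q : ℝ) - p) / (1 - p) := div_nonneg (by linarith) (by linarith)
  have hκ1 : ((q : ℝ) - p) / (1 - p) ≤ 1 := by rw [div_le_one (by linarith)]; linarith [q.2.2]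
  let κ : unitInterval := ⟨((q : ℝ) - p) / (1 - p), hκ0, hκ1⟩
  have e1 : (1 - p : ℝ) = (1 - p) * (1 - (0 : unitInterval)) := by simp
  have e2 : (1 - q : ℝ) = (1 - p) * (1 - (0 : unitInterval)) * (1 - κ) := by
    have : (1 - p : ℝ) ≠ 0 := by linarith
    have h0 : ((0 : unitInterval) : ℝ) = 0 := rfl
    simp only [κ, h0]
    field_simp
    ring
  rw [← law_wp p 0 κ p e1, Measure.map_apply measurable_wp (meas_Pair _ _ _).compl] at hu
  rw [← law_wq p 0 κ q e2, Measure.map_apply measurable_wq (meas_Pair _ _ _)] at hl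
  have hcov : (Set.univ : Set (Om d)) ⊆ wp ⁻¹' (Pair (n • x) ρ (ENNReal.ofReal (s * n)))ᶜ ∪
      wq ⁻¹' (Pair (n • x) ρ (ENNReal.ofReal (s * n))) := by
    intro ω _
    by_cases h : wp ω ∈ Pair (n • x) ρ (ENNReal.ofReal (s * n))
    · right
      obtain ⟨v, hv, v', hv', i1, i2, hc⟩ := h
      exact ⟨v, hv, v', hv', inf_mono (wp_le ω) i1, inf_mono (wp_le ω) i2, (chemDist_mono (wp_le ω) _ _).trans hc⟩
    · exact Or.inl h
  have hfin : (1 : ℝ≥0∞) ≤ 8⁻¹ + 8⁻¹ := by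
    calc (1 : ℝ≥0∞) = PM (rr (d := d) p 0 κ) Set.univ := by rw [measure_univ]
      _ ≤ _ := measure_mono hcov
      _ ≤ _ := measure_union_le _ _
      _ ≤ _ := add_le_add hu hl
  rw [h8, ← ENNReal.ofReal_add (by norm_num) (by norm_num), ENNReal.one_le_ofReal] at hfin
  norm_num at hfin

end

section
variable {d : ℕ}

lemma uniform (hd : 2 ≤ d) {p' p0 : unitInterval} (hp' : (0 : ℝ) < p') (hp0 : (p' : ℝ) < p0) {t' : V d → ℝ}
    (H' : TC p' t') : ∃ C : ℝ, 0 ≤ C ∧ ∀ p q : unitInterval, (p0 : ℝ) ≤ p → (p : ℝ) < q →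
      ∀ tp tq : V d → ℝ, TC p tp → TC q tq → ∀ x, tp x ≤ (1 + C * (q - p)) * tq x := by
  classical
  have hp'1 : (p' : ℝ) < 1 := hp0.trans_le p0.2.2
  obtain ⟨c0, hc0⟩ : ∃ c0 : ℕ, ∀ x ∈ cb (0 : V d) 1, t' x < c0 := by
    obtain ⟨B, hB⟩ := ((cb_finite (0 : V d) 1).image t').bddAbove
    obtain ⟨c0, h⟩ := exists_nat_gt B
    exact ⟨c0, fun x hx => (hB ⟨x, hx, rfl⟩).trans_lt h⟩
  have hc1 : 1 ≤ c0 := by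
    have h1 := (H'.nonneg 0).trans_lt (hc0 0 (cb_self (by norm_num)))
    exact_mod_cast h1
  let A : ℕ := 2 * (3 * (2 * (4 + (c0 + 2))) + 9) + 5
  let N : ℕ := ((2 * (3 * A) + 1) ^ d) ^ 2
  have hN : 0 < N := by positivity
  obtain ⟨R, h, hR, hh, hη⟩ := base hd H' c0 hc0 (η := ((2 * N : ℕ) : ℝ≥0∞)⁻¹) (ENNReal.inv_pos.2 (ENNReal.natCast_ne_top _))
  let P : Pr d := ⟨h, R, c0 + 2, A, hd, hh, hR, by omega, le_rfl, by omega⟩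
  have hη2 : (P.KK : ℝ≥0∞) * ((2 * N : ℕ) : ℝ≥0∞)⁻¹ ≤ 1 / 2 := by
    have e : P.KK = N := rfl
    have hN0 : (N : ℝ≥0∞) ≠ 0 := by exact_mod_cast hN.ne'
    rw [e, Nat.cast_mul, ENNReal.mul_inv (Or.inl (by simp)) (Or.inl (by simp)), mul_left_comm,
      ENNReal.mul_inv_cancel hN0 (by finiteness)]
    simp
  let δr : ℝ := ((p0 : ℝ) - p') / (1 - p')
  have hδ0 : 0 < δr := div_pos (by linarith) (by linarith)
  let δ : ℝ≥0∞ := ENNReal.ofReal δr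
  have hδ : 0 < δ := ENNReal.ofReal_pos.2 hδ0
  let θ : ℝ≥0∞ := max (1 / 2) (1 - δ ^ P.mE)
  have hθ : θ < 1 := by
    refine max_lt (by norm_num) ?_
    exact ENNReal.sub_lt_self (by simp) (by simp) (pow_ne_zero _ hδ.ne')
  obtain ⟨K, hK0, hK⟩ := Pr.sum_bad (P := P) (p := p') (Pr.C0_ne (P := P) hp'1) hθ
  refine ⟨8 * (6 * (P.NN 0 + K)).toReal / p', by positivity, fun p q hp hpq tp tq Hp Hq x => ?_⟩
  have hp1 : (p : ℝ) < 1 := hpq.trans_le q.2.2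
  have b0 : 0 ≤ ((p : ℝ) - p') / (1 - p') := div_nonneg (by linarith) (by linarith)
  have b1 : ((p : ℝ) - p') / (1 - p') < 1 := by rw [div_lt_one (by linarith)]; linarith
  let β : unitInterval := ⟨((p : ℝ) - p') / (1 - p'), b0, b1.le⟩
  have hκ0 : 0 ≤ ((q : ℝ) - p) / (1 - p) := div_nonneg (by linarith) (by linarith)
  have hκ1 : ((q : ℝ) - p) / (1 - p) ≤ 1 := by rw [div_le_one (by linarith)]; linarith [q.2.2]
  let κ : unitInterval := ⟨((q : ℝ) - p) / (1 - p), hκ0, hκ1⟩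
  have n1 : (1 - p' : ℝ) ≠ 0 := by linarith
  have n2 : (1 - p : ℝ) ≠ 0 := by linarith
  have e1 : (1 - p : ℝ) = (1 - p') * (1 - β) := by
    simp only [β]; field_simp; ring
  have e2 : (1 - q : ℝ) = (1 - p') * (1 - β) * (1 - κ) := by
    rw [← e1]; simp only [κ]; field_simp; ring
  have ht : ∀ k w, PM (rr p' β κ) (P.BadV k w) ≤ P.C0 p' * θ ^ 2 ^ k :=
    fun k w => Pr.BadV_tail (P := P) (δ := δ) hp'1 hη hη2 b1
      (ENNReal.ofReal_le_ofReal (div_le_div_of_nonneg_right (by linarith) (by linarith)))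
      (le_max_left _ _) (le_max_right _ _) k w
  have := Pr.tc_key (P := P) e1 e2 hp' hpq.le (Pr.C0_ne (P := P) hp'1) hθ ht hK0 (hK β κ ht) Hp Hq x
  refine this.trans (le_of_eq ?_)
  ring

end

section
variable {d : ℕ}

lemma toEuc_apply (x : V d) (i : Fin d) : toEuc x i = (x i : ℝ) := rfl

lemma toEuc_ne {x : V d} (h : x ≠ 0) : toEuc x ≠ 0 := by
  intro h0
  apply h
  funext i
  have : toEuc x i = (0 : EuclideanSpace ℝ (Fin d)) i := by rw [h0]
  rw [toEuc_apply] at this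
  simpa using this

/-- A crude upper bound of a norm. -/
lemma IsNorm.bd {f : EuclideanSpace ℝ (Fin d) → ℝ} (hf : IsNorm f) : ∃ M, 0 ≤ M ∧
    ∀ (r : ℝ) z, (∀ i, |z i| ≤ r) → f z ≤ M * r := by
  obtain ⟨h1, h2, h3, h4⟩ := hf
  let e : Fin d → EuclideanSpace ℝ (Fin d) := fun i => EuclideanSpace.single i 1
  refine ⟨∑ i, f (e i), Finset.sum_nonneg fun i _ => h1 _, fun r z hz => ?_⟩
  have hs : ∀ (s : Finset (Fin d)) (g : Fin d → EuclideanSpace ℝ (Fin d)), f (∑ i ∈ s, g i) ≤ ∑ i ∈ s, f (g i) := by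
    classical
    intro s g
    induction s using Finset.induction_on with
    | empty => simp [(h2 0).2 rfl]
    | insert a s ha ih =>
      rw [Finset.sum_insert ha, Finset.sum_insert ha]
      exact (h4 _ _).trans (by linarith)
  have hz' : z = ∑ i, z i • e i := by
    ext j
    simp [e, Finset.sum_apply, Pi.single_apply]
  rw [hz']
  refine (hs _ _).trans ?_
  rw [Finset.sum_mul]
  refine Finset.sum_le_sum fun i _ => ?_
  rw [h3, mul_comm]
  exact mul_le_mul_of_nonneg_left (hz i) (h1 _)

lemma norm_ext {f g : EuclideanSpace ℝ (Fin d) → ℝ} (hf : IsNorm f) (hg : IsNorm g) {c : ℝ} (hc : 0 ≤ c)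
    (h : ∀ x : V d, f (toEuc x) ≤ c * g (toEuc x)) (x : EuclideanSpace ℝ (Fin d)) : f x ≤ c * g x := by
  obtain ⟨M, hM0, hM⟩ := hf.bd
  obtain ⟨M', hM'0, hM'⟩ := hg.bd
  have key : ∀ n : ℕ, (n : ℝ) * f x ≤ n * (c * g x) + (c * M' + M) := by
    intro n
    let y : V d := fun i => ⌊(n : ℝ) * x i⌋
    have hz : ∀ i, |((n : ℝ) • x - toEuc y) i| ≤ 1 := by
      intro i
      have e : ((n : ℝ) • x - toEuc y) i = Int.fract ((n : ℝ) * x i) := by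
        simp [toEuc_apply, y]
      rw [e, abs_of_nonneg (Int.fract_nonneg _)]
      exact (Int.fract_lt_one _).le
    have hz' : ∀ i, |(toEuc y - (n : ℝ) • x) i| ≤ 1 := by
      intro i
      have := hz i
      rw [← neg_sub, PiLp.neg_apply, abs_neg] at this
      exact this
    have f1 : f ((n : ℝ) • x) ≤ f (toEuc y) + M := by
      have := hf.2.2.2 (toEuc y) ((n : ℝ) • x - toEuc y)
      rw [add_sub_cancel] at this
      linarith [hM 1 _ hz]
    have g1 : g (toEuc y) ≤ g ((n : ℝ) • x) + M' := by
      have := hg.2.2.2 ((n : ℝ) • x) (toEuc y - (n : ℝ) • x)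
      rw [add_sub_cancel] at this
      linarith [hM' 1 _ hz']
    rw [hf.2.2.1, abs_of_nonneg (Nat.cast_nonneg n)] at f1
    rw [hg.2.2.1, abs_of_nonneg (Nat.cast_nonneg n)] at g1
    have := mul_le_mul_of_nonneg_left g1 hc
    linarith [h y]
  by_contra hcon
  push Not at hcon
  obtain ⟨n, hn⟩ := exists_nat_gt ((c * M' + M) / (f x - c * g x))
  rw [div_lt_iff₀ (by linarith)] at hn
  have := key n
  linarith

lemma IsNorm.coer (hd : 1 ≤ d) {f : EuclideanSpace ℝ (Fin d) → ℝ} (hf : IsNorm f) : ∃ B, 0 < B ∧ ∀ x, ‖x‖ ≤ B * f x := by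
  obtain ⟨M, hM0, hM⟩ := hf.bd
  have hM1 : ∀ z, f z ≤ M * ‖z‖ := fun z => hM _ z fun i => PiLp.norm_apply_le z i
  have hcont : Continuous f := by
    refine (LipschitzWith.of_le_add_mul ⟨M, hM0⟩ fun x y => ?_).continuous
    have := hf.2.2.2 y (x - y)
    rw [add_sub_cancel] at this
    rw [dist_eq_norm]
    exact this.trans (add_le_add le_rfl (hM1 (x - y)))
  have : Nonempty (Fin d) := ⟨⟨0, hd⟩⟩
  obtain ⟨u, hu, hmin⟩ := (isCompact_sphere (0 : EuclideanSpace ℝ (Fin d)) 1).exists_isMinOn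
    (NormedSpace.sphere_nonempty.2 zero_le_one) hcont.continuousOn
  have hu1 : ‖u‖ = 1 := by simpa using hu
  have hfu : 0 < f u := lt_of_le_of_ne (hf.1 u) fun h0 => by
    have := (hf.2.1 u).1 h0.symm
    rw [this] at hu1; simp at hu1
  refine ⟨(f u)⁻¹, inv_pos.2 hfu, fun x => ?_⟩
  by_cases hx : x = 0
  · rw [hx, norm_zero]; exact mul_nonneg (inv_nonneg.2 hfu.le) (hf.1 _)
  have hx0 : 0 < ‖x‖ := norm_pos_iff.2 hx
  have hm : f u ≤ f (‖x‖⁻¹ • x) := hmin (by simp [norm_smul, hx0.ne'])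
  rw [hf.2.2.1, abs_of_pos (inv_pos.2 hx0)] at hm
  rw [← div_eq_inv_mul, le_div_iff₀ hx0] at hm
  rw [← div_eq_inv_mul, le_div_iff₀ hfu]
  linarith

theorem main (d : ℕ) (hd : 2 ≤ d) (F : BernoulliFamily d)
    (p₀ : ℝ) (hp₀ : pc F < p₀) (hp₀1 : p₀ ≤ 1)
    (μ : ℝ → EuclideanSpace ℝ (Fin d) → ℝ)
    (hnorm : ∀ p, pc F < p → p ≤ 1 → IsNorm (μ p))
    (hconv : ∀ p, pc F < p → p ≤ 1 →
      ASTimeConstant (F.P p) (fun x : V d => μ p (toEuc x))) :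
    ∃ κ' : ℝ, 0 < κ' ∧ ∀ p q : ℝ, p₀ ≤ p → p ≤ q → q ≤ 1 →
      Metric.hausdorffDist {x : EuclideanSpace ℝ (Fin d) | μ q x ≤ 1}
          {x : EuclideanSpace ℝ (Fin d) | μ p x ≤ 1}
        ≤ κ' * (q - p) * |Real.log (q - p)| := by
  have hpc : 0 ≤ pc F := Real.sInf_nonneg fun x hx => hx.1
  have hTC : ∀ p : unitInterval, pc F < p → TC p (fun x : V d => μ p (toEuc x)) := by
    intro p hp
    refine ⟨fun x hx => ?_, fun x => (hnorm p hp p.2.2).1 _, ?_⟩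
    · refine lt_of_le_of_ne ((hnorm p hp p.2.2).1 _) fun h => toEuc_ne hx (((hnorm p hp p.2.2).2.1 _).1 h.symm)
    · rw [← BernoulliFamily.eq_PM F p]; exact hconv p hp p.2.2
  rcases hp₀1.lt_or_eq with h01 | h01
  swap
  · refine ⟨1, one_pos, fun p q h1 h2 h3 => ?_⟩
    have : p = q := by linarith
    rw [this]; simp
  let P' : unitInterval := ⟨(pc F + p₀) / 2, by linarith, by linarith⟩
  let P0 : unitInterval := ⟨p₀, by linarith, hp₀1⟩
  have hP' : pc F < P' := by show pc F < (pc F + p₀) / 2; linarith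
  obtain ⟨C, hC0, hC⟩ := uniform hd (p' := P') (p0 := P0) (by linarith)
    (by show (pc F + p₀) / 2 < p₀; linarith) (hTC P' hP')
  have hp1 : pc F < 1 := by linarith
  obtain ⟨B, hB0, hB⟩ := (hnorm 1 hp1 le_rfl).coer (by omega)
  have hmono : ∀ p q : ℝ, p₀ ≤ p → p < q → q ≤ 1 → ∀ x, μ q x ≤ μ p x := by
    intro p q h1 h2 h3 x
    have hp : pc F < p := by linarith
    have hq : pc F < q := by linarith
    have := norm_ext (hnorm q hq h3) (hnorm p hp (by linarith)) (c := 1) zero_le_one (fun y => ?_) x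
    · linarith
    · rw [one_mul]
      exact tc_mono (p := ⟨p, by linarith, by linarith⟩) (q := ⟨q, by linarith, h3⟩) (by omega) h2.le
        (h2.trans_le h3) (hTC _ hp) (hTC _ hq) y
  have hlog : Real.log (1 - p₀) < 0 := Real.log_neg (by linarith) (by linarith)
  refine ⟨(B * C + 1) / (-Real.log (1 - p₀)), div_pos (by positivity) (by linarith), fun p q h1 h2 h3 => ?_⟩
  rcases h2.lt_or_eq with h2 | h2
  swap
  · rw [h2]; simp
  have hp : pc F < p := by linarith
  have hq : pc F < q := by linarith
  have hNp := hnorm p hp (by linarith)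
  have hNq := hnorm q hq h3
  have hε : 0 < q - p := by linarith
  have hcmp : ∀ x, μ p x ≤ (1 + C * (q - p)) * μ q x :=
    norm_ext hNp hNq (by positivity) fun y =>
      hC ⟨p, by linarith, by linarith⟩ ⟨q, by linarith, h3⟩ h1 h2 _ _ (hTC _ hp) (hTC _ hq) y
  have hbd : ∀ x, μ q x ≤ 1 → ‖x‖ ≤ B := by
    intro x hx
    have : μ 1 x ≤ μ q x := by
      rcases h3.lt_or_eq with h | h
      · exact hmono q 1 (by linarith) h le_rfl x
      · rw [h]
    have := mul_le_mul_of_nonneg_left (this.trans hx) hB0.le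
    linarith [hB x]
  have hmain : Metric.hausdorffDist {x : EuclideanSpace ℝ (Fin d) | μ q x ≤ 1}
      {x : EuclideanSpace ℝ (Fin d) | μ p x ≤ 1} ≤ B * C * (q - p) := by
    refine Metric.hausdorffDist_le_of_mem_dist (by positivity) ?_ ?_
    · intro x hx
      have hx : μ q x ≤ 1 := hx
      have hD : 0 < 1 + C * (q - p) := by positivity
      refine ⟨(1 + C * (q - p))⁻¹ • x, ?_, ?_⟩
      · show μ p _ ≤ 1
        rw [hNp.2.2.1, abs_of_pos (inv_pos.2 hD), ← div_eq_inv_mul, div_le_one hD]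
        refine (hcmp x).trans ?_
        have := mul_le_mul_of_nonneg_left hx hD.le
        linarith
      · have e : x - (1 + C * (q - p))⁻¹ • x = (C * (q - p) / (1 + C * (q - p))) • x := by
          rw [show C * (q - p) / (1 + C * (q - p)) = 1 - (1 + C * (q - p))⁻¹ by field_simp; ring, sub_smul, one_smul]
        rw [dist_eq_norm, e, norm_smul, Real.norm_eq_abs, abs_of_nonneg (by positivity)]
        have h5 : C * (q - p) / (1 + C * (q - p)) ≤ C * (q - p) :=
          div_le_self (by positivity) (by have : 0 ≤ C * (q - p) := by positivity
                                          linarith)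
        calc _ ≤ (C * (q - p)) * B := mul_le_mul h5 (hbd x hx) (norm_nonneg _) (by positivity)
          _ = _ := by ring
    · intro x hx
      have hx : μ p x ≤ 1 := hx
      exact ⟨x, (hmono p q h1 h2 h3 x).trans hx, by rw [dist_self]; positivity⟩
  refine hmain.trans ?_
  have hl : -Real.log (1 - p₀) ≤ |Real.log (q - p)| := by
    have : Real.log (q - p) ≤ Real.log (1 - p₀) := Real.log_le_log hε (by linarith)
    have := neg_abs_le (Real.log (q - p))
    have := neg_le_abs (Real.log (q - p))
    linarith
  have hl0 : 0 < -Real.log (1 - p₀) := by linarith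
  calc B * C * (q - p) ≤ (B * C + 1) * (q - p) := by nlinarith
    _ = (B * C + 1) / (-Real.log (1 - p₀)) * (q - p) * (-Real.log (1 - p₀)) := by
      rw [mul_right_comm, div_mul_cancel₀ _ hl0.ne']
    _ ≤ _ := by
      refine mul_le_mul_of_nonneg_left hl ?_
      have : 0 ≤ (B * C + 1) / (-Real.log (1 - p₀)) := by positivity
      positivity

end

/-- **Regularity of the asymptotic shapes.**
Let `d ≥ 2` and `p₀ > p_c(d)`. There is a constant `κ'_d > 0`, depending only on `d` and
`p₀`, such that for all `p ≤ q` in `[p₀, 1]`,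
`d_H(𝓑_{μ_q}, 𝓑_{μ_p}) ≤ κ'_d (q-p)|log (q-p)|`. -/
theorem statement_1 (d : ℕ) (hd : 2 ≤ d) (F : BernoulliFamily d)
    (p₀ : ℝ) (hp₀ : pc F < p₀) (hp₀1 : p₀ ≤ 1)
    (μ : ℝ → EuclideanSpace ℝ (Fin d) → ℝ)
    (hnorm : ∀ p, pc F < p → p ≤ 1 → IsNorm (μ p))
    (hconv : ∀ p, pc F < p → p ≤ 1 →
      ASTimeConstant (F.P p) (fun x : V d => μ p (toEuc x))) :
    ∃ κ' : ℝ, 0 < κ' ∧ ∀ p q : ℝ, p₀ ≤ p → p ≤ q → q ≤ 1 →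
      Metric.hausdorffDist {x : EuclideanSpace ℝ (Fin d) | μ q x ≤ 1}
          {x : EuclideanSpace ℝ (Fin d) | μ p x ≤ 1}
        ≤ κ' * (q - p) * |Real.log (q - p)| := by
  exact main d hd F p₀ hp₀ hp₀1 μ hnorm hconv

end Perco
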